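/- Let T and U be computable consistent extensions of PA and n ≥ 1. The following are equivalent: (1) (T,U) is a C_n-pair; (2) there is a Σ_n ∧ Π_n sentence which is simultaneously exactly hereditarily Σ_n↓Π_n-conservative over T and U; (3) there is a sentence which is simultaneously exactly hereditarily Σ_n↓Π_n-conservative over T and U. -/

import Mathlib

open FirstOrder Language
open scoped FirstOrder

namespace Guaspari

/-- The first-order language of arithmetic: a constant `0`, a unary function `S`,
binary functions `+` (coded `false`) and `·` (coded `true`), and a binary relation `≤`. -/
def LA : FirstOrder.Language :=
  ⟨fun n => match n with | 0 => Unit | 1 => Unit | 2 => Bool | _ => Empty,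
   fun n => match n with | 2 => Unit | _ => Empty⟩

/-- Sentences of the language of arithmetic. -/
abbrev Snt : Type := LA.Sentence

/-- Theories (sets of sentences) in the language of arithmetic. -/
abbrev Thy : Type := LA.Theory

/-- The term `0`. -/
def zeroT {α : Type} {n : ℕ} : LA.Term (α ⊕ Fin n) :=
  Constants.term (show LA.Constants from Unit.unit)

/-- The term `S t`. -/
def succT {α : Type} {n : ℕ} (t : LA.Term (α ⊕ Fin n)) : LA.Term (α ⊕ Fin n) :=
  Functions.apply₁ (show LA.Functions 1 from Unit.unit) t

/-- The term `t + u`. -/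
def addT {α : Type} {n : ℕ} (t u : LA.Term (α ⊕ Fin n)) : LA.Term (α ⊕ Fin n) :=
  Functions.apply₂ (show LA.Functions 2 from false) t u

/-- The term `t * u`. -/
def mulT {α : Type} {n : ℕ} (t u : LA.Term (α ⊕ Fin n)) : LA.Term (α ⊕ Fin n) :=
  Functions.apply₂ (show LA.Functions 2 from true) t u

/-- The atomic formula `t ≤ u`. -/
def leF {α : Type} {n : ℕ} (t u : LA.Term (α ⊕ Fin n)) : LA.BoundedFormula α n :=
  Relations.boundedFormula₂ (show LA.Relations 2 from Unit.unit) t u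

/-- The `i`-th (de Bruijn-indexed) bound variable as a term. -/
def vT {m : ℕ} (i : Fin m) : LA.Term (Empty ⊕ Fin m) := Term.var (Sum.inr i)

/-- The induction axiom for the formula `φ(x₀,…,x_{k-1}, x_k)` with induction on `x_k`,
universally closed over the parameters `x₀,…,x_{k-1}`. -/
def indAxiom {k : ℕ} (φ : LA.BoundedFormula Empty (k + 1)) : Snt :=
  let base := ∀' ((vT (Fin.last k) =' zeroT) ⟹ φ)
  let step := ∀' (φ ⟹
    ∀' ((vT (Fin.last (k + 1)) =' succT (vT (Fin.castSucc (Fin.last k)))) ⟹ φ.liftAt 1 k))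
  ((base ⊓ step) ⟹ ∀' φ).alls

/-- The axioms of Peano arithmetic `PA`: the basic axioms for `0`, `S`, `+`, `·`, `≤`,
together with the full induction scheme. -/
def PAAx : Thy :=
  {∀' ∼(succT (vT 0) =' zeroT),
   ∀' ∀' ((succT (vT 0) =' succT (vT 1)) ⟹ (vT 0 =' vT 1)),
   ∀' (addT (vT 0) zeroT =' vT 0),
   ∀' ∀' (addT (vT 0) (succT (vT 1)) =' succT (addT (vT 0) (vT 1))),
   ∀' (mulT (vT 0) zeroT =' zeroT),
   ∀' ∀' (mulT (vT 0) (succT (vT 1)) =' addT (mulT (vT 0) (vT 1)) (vT 0)),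
   ∀' ∀' (leF (vT 0) (vT 1) ⇔ ∃' (addT (vT 2) (vT 0) =' vT 1))} ∪
  {φ | ∃ (k : ℕ) (ψ : LA.BoundedFormula Empty (k + 1)), φ = indAxiom ψ}

/-- `Prv T φ`: the sentence `φ` is provable from the theory `T` (equivalently, by the
Gödel completeness theorem, `φ` holds in every model of `T`). -/
def Prv (T : Thy) (φ : Snt) : Prop := T ⊨ᵇ φ

/-- `Th T`: the set of sentences provable from `T`. -/
def Th (T : Thy) : Set Snt := {φ | Prv T φ}

/-- `Con T`: the theory `T` is consistent. -/
def Con (T : Thy) : Prop := ¬ Prv T ⊥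

/-- The theory `T + φ`. -/
def add (T : Thy) (φ : Snt) : Thy := insert φ T

/-- `T` is an extension of `PA`. -/
def ExtPA (T : Thy) : Prop := ∀ φ ∈ PAAx, Prv T φ

/-- `V` is a subtheory of `T` (containing `PA`, as assumed throughout the paper). -/
def SubThy (V T : Thy) : Prop := ExtPA V ∧ ∀ φ, Prv V φ → Prv T φ

/-- Δ₀ (bounded) formulas. -/
inductive IsDelta0 : ∀ {m : ℕ}, LA.BoundedFormula Empty m → Prop
  | falsum {m : ℕ} : IsDelta0 (⊥ : LA.BoundedFormula Empty m)
  | equal {m : ℕ} (t u : LA.Term (Empty ⊕ Fin m)) : IsDelta0 (t =' u)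
  | le {m : ℕ} (t u : LA.Term (Empty ⊕ Fin m)) : IsDelta0 (leF t u)
  | imp {m : ℕ} {φ ψ : LA.BoundedFormula Empty m} :
      IsDelta0 φ → IsDelta0 ψ → IsDelta0 (φ ⟹ ψ)
  | ball {m : ℕ} (t : LA.Term (Empty ⊕ Fin m)) {φ : LA.BoundedFormula Empty (m + 1)} :
      IsDelta0 φ →
      IsDelta0 (∀' (leF (vT (Fin.last m)) (t.relabel (Sum.map id Fin.castSucc)) ⟹ φ))
  | bex {m : ℕ} (t : LA.Term (Empty ⊕ Fin m)) {φ : LA.BoundedFormula Empty (m + 1)} :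
      IsDelta0 φ →
      IsDelta0 (∃' (leF (vT (Fin.last m)) (t.relabel (Sum.map id Fin.castSucc)) ⊓ φ))

mutual
  /-- `Σ_k` formulas (cumulatively: every `Π_k` formula is `Σ_{k+1}`). -/
  inductive IsSigmaFml : ℕ → ∀ {m : ℕ}, LA.BoundedFormula Empty m → Prop
    | ofDelta0 {m : ℕ} {φ : LA.BoundedFormula Empty m} : IsDelta0 φ → IsSigmaFml 0 φ
    | ofPi {k : ℕ} {m : ℕ} {φ : LA.BoundedFormula Empty m} :
        IsPiFml k φ → IsSigmaFml (k + 1) φ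
    | ex {k : ℕ} {m : ℕ} {φ : LA.BoundedFormula Empty (m + 1)} :
        IsSigmaFml (k + 1) φ → IsSigmaFml (k + 1) (∃' φ)
  inductive IsPiFml : ℕ → ∀ {m : ℕ}, LA.BoundedFormula Empty m → Prop
    | ofDelta0 {m : ℕ} {φ : LA.BoundedFormula Empty m} : IsDelta0 φ → IsPiFml 0 φ
    | ofSigma {k : ℕ} {m : ℕ} {φ : LA.BoundedFormula Empty m} :
        IsSigmaFml k φ → IsPiFml (k + 1) φ
    | all {k : ℕ} {m : ℕ} {φ : LA.BoundedFormula Empty (m + 1)} :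
        IsPiFml (k + 1) φ → IsPiFml (k + 1) (∀' φ)
end

/-- The set of `Σ_k` sentences. -/
def SigmaS (k : ℕ) : Set Snt := {φ | IsSigmaFml k φ}

/-- The set of `Π_k` sentences. -/
def PiS (k : ℕ) : Set Snt := {φ | IsPiFml k φ}

/-- The set of `Σ_k ∧ Π_k` sentences, i.e. sentences of the form `σ ∧ π` with
`σ` a `Σ_k` sentence and `π` a `Π_k` sentence. -/
def SigAndPiS (k : ℕ) : Set Snt :=
  {φ | ∃ σ ∈ SigmaS k, ∃ π ∈ PiS k, φ = σ ⊓ π}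

/-- `B(Σ_k)` sentences: Boolean combinations of `Σ_k` sentences. -/
inductive IsBoolSigma (k : ℕ) : Snt → Prop
  | base {φ : Snt} : φ ∈ SigmaS k → IsBoolSigma k φ
  | not {φ : Snt} : IsBoolSigma k φ → IsBoolSigma k (∼φ)
  | imp {φ ψ : Snt} : IsBoolSigma k φ → IsBoolSigma k ψ → IsBoolSigma k (φ ⟹ ψ)
  | inf {φ ψ : Snt} : IsBoolSigma k φ → IsBoolSigma k ψ → IsBoolSigma k (φ ⊓ ψ)
  | sup {φ ψ : Snt} : IsBoolSigma k φ → IsBoolSigma k ψ → IsBoolSigma k (φ ⊔ ψ)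

/-- The set of `B(Σ_k)` sentences. -/
def BSigmaS (k : ℕ) : Set Snt := {φ | IsBoolSigma k φ}

/-- The set of `Γ` sentences provable in `T`, `Th_Γ(T)`. -/
def ThIn (Γ : Set Snt) (T : Thy) : Set Snt := Γ ∩ Th T

instance (i : ℕ) : Encodable (LA.Functions i) :=
  match i with
  | 0 => inferInstanceAs (Encodable Unit)
  | 1 => inferInstanceAs (Encodable Unit)
  | 2 => inferInstanceAs (Encodable Bool)
  | (_ + 3) => inferInstanceAs (Encodable Empty)

instance (i : ℕ) : Encodable (LA.Relations i) :=
  match i with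
  | 0 => inferInstanceAs (Encodable Empty)
  | 1 => inferInstanceAs (Encodable Empty)
  | 2 => inferInstanceAs (Encodable Unit)
  | (_ + 3) => inferInstanceAs (Encodable Empty)

/-- A Gödel numbering of sentences, via Mathlib's encoding of bounded formulas. -/
def gnum (φ : Snt) : ℕ :=
  Encodable.encode
    (show List ((Σ k, LA.Term (Empty ⊕ Fin k)) ⊕ ((Σ n, LA.Relations n) ⊕ ℕ)) from
      BoundedFormula.encoding.encode (⟨0, φ⟩ : Σ n, LA.BoundedFormula Empty n))

/-- The (axiom set of the) theory `T` is computable. -/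
def CompThy (T : Thy) : Prop :=
  ComputablePred (fun m : ℕ => ∃ φ ∈ T, gnum φ = m)

/-- `T` is a computable consistent extension of `PA`. -/
def GoodThy (T : Thy) : Prop := CompThy T ∧ Con T ∧ ExtPA T

/-- `φ` is `Γ`-conservative over `T` for a class of sentences `Γ`:
every `Γ` sentence provable in `T + φ` is provable in `T`. -/
def ConsIn (Γ : Set Snt) (T : Thy) (φ : Snt) : Prop :=
  ∀ γ ∈ Γ, Prv (add T φ) γ → Prv T γ

/-- `φ` is hereditarily `Γ`-conservative over `T`: `Γ`-conservative over every
subtheory of `T` (containing `PA`). -/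
def HConsIn (Γ : Set Snt) (T : Thy) (φ : Snt) : Prop :=
  ∀ V : Thy, SubThy V T → ConsIn Γ V φ

/-- `φ` is `Σ_k↓Π_k`-conservative over `V`. -/
def SPCons (k : ℕ) (V : Thy) (φ : Snt) : Prop :=
  ∀ σ ∈ SigmaS k, ∀ π ∈ PiS k, Prv (add V φ) (σ ⊓ π) → Prv V (σ ⊔ π)

/-- `φ` is hereditarily `Σ_k↓Π_k`-conservative over `T`. -/
def HSPCons (k : ℕ) (T : Thy) (φ : Snt) : Prop :=
  ∀ V : Thy, SubThy V T → SPCons k V φ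

/-- The theory `S` is `Σ_k↓Π_k`-conservative over `PA`. -/
def ThySPConsPA (k : ℕ) (S : Thy) : Prop :=
  ∀ σ ∈ SigmaS k, ∀ π ∈ PiS k, Prv S (σ ⊓ π) → Prv PAAx (σ ⊔ π)

/-- `δ` is a `Δ_k(S)` sentence: `S`-provably equivalent to both a `Σ_k` sentence
and a `Π_k` sentence. -/
def IsDeltaIn (k : ℕ) (S : Thy) (δ : Snt) : Prop :=
  (∃ σ ∈ SigmaS k, Prv S (δ ⇔ σ)) ∧ ∃ π ∈ PiS k, Prv S (δ ⇔ π)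

/-- `φ` is `Δ_k(S)`-conservative over `V`. -/
def DeltaConsRel (k : ℕ) (S V : Thy) (φ : Snt) : Prop :=
  ∀ δ : Snt, IsDeltaIn k S δ → Prv (add V φ) δ → Prv V δ

/-- `φ` is `Δ_k`-conservative over `T`, i.e. `Δ_k(Th(T))`-conservative over `T`. -/
def DeltaCons (k : ℕ) (T : Thy) (φ : Snt) : Prop := DeltaConsRel k (Th T) T φ

/-- `φ` is hereditarily `Δ_k`-conservative over `T`. -/
def HDeltaCons (k : ℕ) (T : Thy) (φ : Snt) : Prop :=
  ∀ V : Thy, SubThy V T → DeltaConsRel k (Th V) V φ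

/-- `φ` is doubly `Π_k`-conservative over `T`: `φ` is `Π_k`-conservative and `¬φ` is
`Σ_k`-conservative over `T`. -/
def DCons (k : ℕ) (T : Thy) (φ : Snt) : Prop :=
  ConsIn (PiS k) T φ ∧ ConsIn (SigmaS k) T (∼φ)

/-- `φ` is hereditarily doubly `Π_k`-conservative over `T`. -/
def HDCons (k : ℕ) (T : Thy) (φ : Snt) : Prop :=
  ∀ V : Thy, SubThy V T → DCons k V φ

/-- `(T,U)` is a `B_n`-pair. -/
def Bpair (n : ℕ) (T U : Thy) : Prop :=
  (¬ ThIn (PiS n) T ⊆ Th U ∨ Con (T ∪ ThIn (PiS n) U)) ∧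
  (¬ ThIn (PiS n) U ⊆ Th T ∨ Con (U ∪ ThIn (PiS n) T))

/-- `(T,U)` is a `C_n`-pair. -/
def Cpair (n : ℕ) (T U : Thy) : Prop :=
  Con (T ∪ ThIn (PiS n) U) ∧ Con (U ∪ ThIn (PiS n) T)

/-- `(T,U)` is a `C⁻_n`-pair. -/
def Cmpair (n : ℕ) (T U : Thy) : Prop :=
  Con (T ∪ ThIn (PiS n) U) ∨ Con (U ∪ ThIn (PiS n) T)

/-- `(T,U)` is a `C^∧_n`-pair. -/
def Capair (n : ℕ) (T U : Thy) : Prop :=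
  Con (T ∪ ThIn (SigAndPiS n) U) ∧ Con (U ∪ ThIn (SigAndPiS n) T)

/-- `(T,U)` is a `C^B_n`-pair. -/
def CBpair (n : ℕ) (T U : Thy) : Prop :=
  Con (T ∪ ThIn (BSigmaS n) U)


/-- `φ` is simultaneously exactly hereditarily `Σ_n↓Π_n`-conservative over `T` and `U`. -/
def SimExHSP (n : ℕ) (T U : Thy) (φ : Snt) : Prop :=
  HSPCons n T φ ∧ HSPCons n U φ ∧
  (∃ ψ ∈ SigmaS n, Prv (add PAAx φ) ψ ∧ ¬ Prv T ψ ∧ ¬ Prv U ψ) ∧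
  (∃ ψ ∈ PiS n, Prv (add PAAx φ) ψ ∧ ¬ Prv T ψ ∧ ¬ Prv U ψ)


end Guaspari

open FirstOrder Language
open scoped FirstOrder
namespace Guaspari

/-! ### Raw operations -/
section raw
variable {M : Type} [LA.Structure M]
def rz : M := Structure.funMap (L := LA) (show LA.Functions 0 from Unit.unit) ![]
def rs (x : M) : M := Structure.funMap (L := LA) (show LA.Functions 1 from Unit.unit) ![x]
def ra (x y : M) : M := Structure.funMap (L := LA) (show LA.Functions 2 from false) ![x, y]
def rm (x y : M) : M := Structure.funMap (L := LA) (show LA.Functions 2 from true) ![x, y]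
def rle (x y : M) : Prop := Structure.RelMap (L := LA) (show LA.Relations 2 from Unit.unit) ![x, y]

variable {α : Type} {n : ℕ} (t u : LA.Term (α ⊕ Fin n)) (v : α ⊕ Fin n → M)

theorem real_zero : (zeroT : LA.Term (α ⊕ Fin n)).realize v = (rz : M) := by
  unfold zeroT rz
  exact Term.realize_constants.trans (congrArg (Structure.funMap (L := LA) (show LA.Functions 0 from Unit.unit)) (Subsingleton.elim (default : Fin 0 → M) ![]))
theorem real_succ : (succT t).realize v = rs (t.realize v) :=
  Term.realize_functions_apply₁
theorem real_add : (addT t u).realize v = ra (t.realize v) (u.realize v) :=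
  Term.realize_functions_apply₂
theorem real_mul : (mulT t u).realize v = rm (t.realize v) (u.realize v) :=
  Term.realize_functions_apply₂
theorem real_le (v : α → M) (xs : Fin n → M) : (leF t u).Realize v xs ↔
    rle (t.realize (Sum.elim v xs)) (u.realize (Sum.elim v xs)) :=
  BoundedFormula.realize_rel₂
theorem real_v (i : Fin n) (v : Empty → M) (xs : Fin n → M) :
    (vT i).realize (Sum.elim v xs) = xs i := rfl
end raw

/-- Syntactic existential substitution, for all formulas. -/
def lsub {m l : ℕ} (ts : Fin m → LA.Term (Empty ⊕ Fin l)) :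
    Fin (m + 1) → LA.Term (Empty ⊕ Fin (l + 1)) :=
  Fin.snoc (fun i => (ts i).relabel (Sum.map id Fin.castSucc)) (vT (Fin.last l))

theorem relabel_cast {M : Type} [LA.Structure M] {l : ℕ} (t : LA.Term (Empty ⊕ Fin l))
    (v : Empty → M) (xs : Fin l → M) (x : M) :
    (t.relabel (Sum.map id Fin.castSucc)).realize (Sum.elim v (Fin.snoc xs x : Fin (l+1) → M))
      = t.realize (Sum.elim v xs) := by
  rw [Term.realize_relabel]
  congr 1
  funext i
  rcases i with i | i
  · rfl
  · simp

theorem lsub_real {M : Type} [LA.Structure M] {m l : ℕ} (ts : Fin m → LA.Term (Empty ⊕ Fin l))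
    (v : Empty → M) (xs : Fin l → M) (x : M) :
    (fun i => (lsub ts i).realize (Sum.elim v (Fin.snoc xs x : Fin (l+1) → M)))
      = (Fin.snoc (fun i => (ts i).realize (Sum.elim v xs)) x : Fin (m+1) → M) := by
  funext i
  refine Fin.lastCases ?_ (fun i => ?_) i
  · simp [lsub, real_v]
  · simp only [lsub, Fin.snoc_castSucc, relabel_cast]

theorem tsub_real {M : Type} [LA.Structure M] {m l : ℕ} (ts : Fin m → LA.Term (Empty ⊕ Fin l))
    (t : LA.Term (Empty ⊕ Fin m)) (v : Empty → M) (xs : Fin l → M) :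
    (t.subst (Sum.elim (fun e => Term.var (Sum.inl e)) ts)).realize (Sum.elim v xs)
      = t.realize (Sum.elim v (fun i => (ts i).realize (Sum.elim v xs))) := by
  rw [Term.realize_subst]
  congr 1
  funext i
  rcases i with i | i
  · rfl
  · rfl

def SubOK {m l : ℕ} (φ : LA.BoundedFormula Empty m) (ts : Fin m → LA.Term (Empty ⊕ Fin l))
    (ψ : LA.BoundedFormula Empty l) : Prop :=
  ∀ (M : Type) [LA.Structure M] (v : Empty → M) (xs : Fin l → M),
    ψ.Realize v xs ↔ φ.Realize v (fun i => (ts i).realize (Sum.elim v xs))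

theorem df_sub {m : ℕ} (φ : LA.BoundedFormula Empty m) : ∀ {l : ℕ}
    (ts : Fin m → LA.Term (Empty ⊕ Fin l)), ∃ ψ, SubOK φ ts ψ := by
  induction φ with
  | falsum => exact fun ts => ⟨⊥, fun M _ v xs => by rfl⟩
  | equal t u =>
    intro l ts
    refine ⟨.equal (t.subst (Sum.elim (fun e => Term.var (Sum.inl e)) ts))
      (u.subst (Sum.elim (fun e => Term.var (Sum.inl e)) ts)), fun M _ v xs => ?_⟩
    simp only [BoundedFormula.Realize, tsub_real]
  | rel R us =>
    intro l ts
    refine ⟨.rel R (fun i => (us i).subst (Sum.elim (fun e => Term.var (Sum.inl e)) ts)), 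
      fun M _ v xs => ?_⟩
    simp only [BoundedFormula.Realize, tsub_real]
  | imp _ _ h1 h2 =>
    intro l ts
    obtain ⟨p1, h1⟩ := h1 ts
    obtain ⟨p2, h2⟩ := h2 ts
    exact ⟨p1.imp p2, fun M _ v xs => by simp only [BoundedFormula.realize_imp, h1 M v xs, h2 M v xs]⟩
  | all _ h =>
    intro l ts
    obtain ⟨p, h⟩ := h (lsub ts)
    exact ⟨p.all, fun M _ v xs => by simp only [BoundedFormula.realize_all, h M, lsub_real]⟩

theorem d0_sub {m : ℕ} {φ : LA.BoundedFormula Empty m} (hφ : IsDelta0 φ) : ∀ {l : ℕ}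
    (ts : Fin m → LA.Term (Empty ⊕ Fin l)), ∃ ψ, IsDelta0 ψ ∧ SubOK φ ts ψ := by
  induction hφ with
  | falsum => exact fun ts => ⟨⊥, .falsum, fun M _ v xs => by rfl⟩
  | equal t u =>
    intro l ts
    refine ⟨_, .equal (t.subst (Sum.elim (fun e => Term.var (Sum.inl e)) ts))
      (u.subst (Sum.elim (fun e => Term.var (Sum.inl e)) ts)), fun M _ v xs => ?_⟩
    simp only [BoundedFormula.realize_bdEqual, tsub_real]
  | le t u =>
    intro l ts
    refine ⟨_, .le (t.subst (Sum.elim (fun e => Term.var (Sum.inl e)) ts))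
      (u.subst (Sum.elim (fun e => Term.var (Sum.inl e)) ts)), fun M _ v xs => ?_⟩
    simp only [real_le, tsub_real]
  | imp _ _ h1 h2 =>
    intro l ts
    obtain ⟨p1, d1, h1⟩ := h1 ts
    obtain ⟨p2, d2, h2⟩ := h2 ts
    exact ⟨p1.imp p2, .imp d1 d2,
      fun M _ v xs => by simp only [BoundedFormula.realize_imp, h1 M v xs, h2 M v xs]⟩
  | ball t _ h =>
    intro l ts
    obtain ⟨p, d, h⟩ := h (lsub ts)
    refine ⟨_, .ball (t.subst (Sum.elim (fun e => Term.var (Sum.inl e)) ts)) d,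
      fun M _ v xs => ?_⟩
    simp only [BoundedFormula.realize_all, BoundedFormula.realize_imp, real_le, real_v,
      relabel_cast, tsub_real, h M, lsub_real, Fin.snoc_last]
  | bex t _ h =>
    intro l ts
    obtain ⟨p, d, h⟩ := h (lsub ts)
    refine ⟨_, .bex (t.subst (Sum.elim (fun e => Term.var (Sum.inl e)) ts)) d,
      fun M _ v xs => ?_⟩
    simp only [BoundedFormula.realize_ex, BoundedFormula.realize_inf, real_le, real_v,
      relabel_cast, tsub_real, h M, lsub_real, Fin.snoc_last]

theorem sgf_elim {k : ℕ} {R : ∀ m, LA.BoundedFormula Empty m → Prop}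
    (h1 : ∀ m P, IsPiFml k P → R m P)
    (h2 : ∀ m P, R (m + 1) P → R m (∃' P)) :
    ∀ {m : ℕ} {φ : LA.BoundedFormula Empty m}, IsSigmaFml (k + 1) φ → R m φ
  | _, _, .ofPi h => h1 _ _ h
  | _, _, .ex h => h2 _ _ (sgf_elim h1 h2 h)
theorem pif_elim {k : ℕ} {R : ∀ m, LA.BoundedFormula Empty m → Prop}
    (h1 : ∀ m P, IsSigmaFml k P → R m P)
    (h2 : ∀ m P, R (m + 1) P → R m (∀' P)) :
    ∀ {m : ℕ} {φ : LA.BoundedFormula Empty m}, IsPiFml (k + 1) φ → R m φ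
  | _, _, .ofSigma h => h1 _ _ h
  | _, _, .all h => h2 _ _ (pif_elim h1 h2 h)

theorem sgpi_sub (k : ℕ) :
    (∀ {m : ℕ} {φ : LA.BoundedFormula Empty m}, IsSigmaFml k φ → ∀ {l : ℕ}
      (ts : Fin m → LA.Term (Empty ⊕ Fin l)), ∃ ψ, IsSigmaFml k ψ ∧ SubOK φ ts ψ) ∧
    (∀ {m : ℕ} {φ : LA.BoundedFormula Empty m}, IsPiFml k φ → ∀ {l : ℕ}
      (ts : Fin m → LA.Term (Empty ⊕ Fin l)), ∃ ψ, IsPiFml k ψ ∧ SubOK φ ts ψ) := by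
  induction k with
  | zero =>
    constructor
    · rintro m φ ⟨h⟩ l ts
      obtain ⟨p, d, h⟩ := d0_sub h ts
      exact ⟨p, .ofDelta0 d, h⟩
    · rintro m φ ⟨h⟩ l ts
      obtain ⟨p, d, h⟩ := d0_sub h ts
      exact ⟨p, .ofDelta0 d, h⟩
  | succ k ih =>
    constructor
    · intro m φ h
      refine sgf_elim (R := fun m φ => ∀ {l : ℕ}
        (ts : Fin m → LA.Term (Empty ⊕ Fin l)), ∃ ψ, IsSigmaFml (k+1) ψ ∧ SubOK φ ts ψ) ?_ ?_ h
      · intro m P hP l ts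
        obtain ⟨p, d, h⟩ := ih.2 hP ts
        exact ⟨p, .ofPi d, h⟩
      · intro m P hP l ts
        obtain ⟨p, d, h⟩ := hP (lsub ts)
        exact ⟨_, .ex d, fun M _ v xs => by simp only [BoundedFormula.realize_ex, h M, lsub_real]⟩
    · intro m φ h
      refine pif_elim (R := fun m φ => ∀ {l : ℕ}
        (ts : Fin m → LA.Term (Empty ⊕ Fin l)), ∃ ψ, IsPiFml (k+1) ψ ∧ SubOK φ ts ψ) ?_ ?_ h
      · intro m P hP l ts
        obtain ⟨p, d, h⟩ := ih.1 hP ts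
        exact ⟨p, .ofSigma d, h⟩
      · intro m P hP l ts
        obtain ⟨p, d, h⟩ := hP (lsub ts)
        exact ⟨_, .all d, fun M _ v xs => by simp only [BoundedFormula.realize_all, h M, lsub_real]⟩

/-! ### Definability -/
abbrev PAM := Theory.ModelType.{0, 0, 0} PAAx
abbrev Pd (m : ℕ) := ∀ M : PAM, (Fin m → M) → Prop
abbrev Fu (m : ℕ) := ∀ M : PAM, (Fin m → M) → M

def IsTm {m : ℕ} (f : Fu m) : Prop :=
  ∃ t : LA.Term (Empty ⊕ Fin m), ∀ M v, t.realize (Sum.elim default v) = f M v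
def Df {m : ℕ} (P : Pd m) : Prop :=
  ∃ φ : LA.BoundedFormula Empty m, ∀ M v, φ.Realize default v ↔ P M v
def D0 {m : ℕ} (P : Pd m) : Prop :=
  ∃ φ : LA.BoundedFormula Empty m, IsDelta0 φ ∧ ∀ M v, φ.Realize default v ↔ P M v
def Sg (k : ℕ) {m : ℕ} (P : Pd m) : Prop :=
  ∃ φ : LA.BoundedFormula Empty m, IsSigmaFml k φ ∧ ∀ M v, φ.Realize default v ↔ P M v
def Pi (k : ℕ) {m : ℕ} (P : Pd m) : Prop :=
  ∃ φ : LA.BoundedFormula Empty m, IsPiFml k φ ∧ ∀ M v, φ.Realize default v ↔ P M v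

theorem IsTm.var {m : ℕ} (i : Fin m) : IsTm (fun _ v => v i) := ⟨vT i, fun _ _ => rfl⟩
theorem IsTm.rz {m : ℕ} : IsTm (m := m) (fun _ _ => Guaspari.rz) := ⟨zeroT, fun _ _ => real_zero _⟩
theorem IsTm.rs {m : ℕ} {f : Fu m} (hf : IsTm f) : IsTm (fun M v => Guaspari.rs (f M v)) := by
  obtain ⟨t, h⟩ := hf
  exact ⟨succT t, fun M v => by rw [real_succ, h]⟩
theorem IsTm.ra {m : ℕ} {f g : Fu m} (hf : IsTm f) (hg : IsTm g) :
    IsTm (fun M v => Guaspari.ra (f M v) (g M v)) := by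
  obtain ⟨t, h⟩ := hf
  obtain ⟨u, h'⟩ := hg
  exact ⟨addT t u, fun M v => by rw [real_add, h, h']⟩
theorem IsTm.rm {m : ℕ} {f g : Fu m} (hf : IsTm f) (hg : IsTm g) :
    IsTm (fun M v => Guaspari.rm (f M v) (g M v)) := by
  obtain ⟨t, h⟩ := hf
  obtain ⟨u, h'⟩ := hg
  exact ⟨mulT t u, fun M v => by rw [real_mul, h, h']⟩

variable {m l : ℕ}
section Df
variable {P Q : Pd m} {f g : Fu m}
theorem Df.falsum : Df (m := m) (fun _ _ => False) := ⟨⊥, fun _ _ => Iff.rfl⟩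
theorem Df.eq (hf : IsTm f) (hg : IsTm g) : Df (fun M v => f M v = g M v) := by
  obtain ⟨t, h⟩ := hf
  obtain ⟨u, h'⟩ := hg
  exact ⟨t =' u, fun M v => by rw [BoundedFormula.realize_bdEqual, h, h']⟩
theorem Df.rle (hf : IsTm f) (hg : IsTm g) : Df (fun M v => rle (f M v) (g M v)) := by
  obtain ⟨t, h⟩ := hf
  obtain ⟨u, h'⟩ := hg
  exact ⟨leF t u, fun M v => by rw [real_le, h, h']⟩
theorem Df.imp (hP : Df P) (hQ : Df Q) : Df (fun M v => P M v → Q M v) := by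
  obtain ⟨t, h⟩ := hP
  obtain ⟨u, h'⟩ := hQ
  exact ⟨t ⟹ u, fun M v => by rw [BoundedFormula.realize_imp, h, h']⟩
theorem Df.congr (hP : Df P) (h : ∀ M v, Q M v ↔ P M v) : Df Q := by
  obtain ⟨t, h'⟩ := hP
  exact ⟨t, fun M v => by rw [h', h]⟩
theorem Df.not (hP : Df P) : Df (fun M v => ¬ P M v) := hP.imp Df.falsum
theorem Df.and (hP : Df P) (hQ : Df Q) : Df (fun M v => P M v ∧ Q M v) :=
  (hP.imp hQ.not).not.congr fun M v => by tauto
theorem Df.or (hP : Df P) (hQ : Df Q) : Df (fun M v => P M v ∨ Q M v) :=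
  (hP.not.imp hQ).congr fun M v => by tauto
theorem Df.iff (hP : Df P) (hQ : Df Q) : Df (fun M v => P M v ↔ Q M v) :=
  ((hP.imp hQ).and (hQ.imp hP)).congr fun M v => by tauto
theorem Df.all {P : ∀ M : PAM, (Fin m → M) → M → Prop}
    (h : Df (m := m + 1) (fun M w => P M (fun i => w i.castSucc) (w (Fin.last m)))) :
    Df (fun M v => ∀ x, P M v x) := by
  obtain ⟨t, h⟩ := h
  exact ⟨∀' t, fun M v => by simp only [BoundedFormula.realize_all, h, Fin.snoc_castSucc, Fin.snoc_last]⟩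
theorem Df.ex {P : ∀ M : PAM, (Fin m → M) → M → Prop}
    (h : Df (m := m + 1) (fun M w => P M (fun i => w i.castSucc) (w (Fin.last m)))) :
    Df (fun M v => ∃ x, P M v x) := by
  obtain ⟨t, h⟩ := h
  exact ⟨∃' t, fun M v => by simp only [BoundedFormula.realize_ex, h, Fin.snoc_castSucc, Fin.snoc_last]⟩
theorem Df.sub {P : Pd l} (h : Df P) {f : Fin l → Fu m} (hf : ∀ i, IsTm (f i)) :
    Df (fun M v => P M (fun i => f i M v)) := by
  obtain ⟨t, h⟩ := h
  choose ts hts using hf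
  obtain ⟨p, hp⟩ := df_sub t ts
  exact ⟨p, fun M v => by rw [hp M, h]; simp only [hts]⟩
end Df

section D0
variable {P Q : Pd m} {f g : Fu m}
theorem D0.toDf (h : D0 P) : Df P := let ⟨t, _, h⟩ := h; ⟨t, h⟩
theorem D0.falsum : D0 (m := m) (fun _ _ => False) := ⟨⊥, .falsum, fun _ _ => Iff.rfl⟩
theorem D0.eq (hf : IsTm f) (hg : IsTm g) : D0 (fun M v => f M v = g M v) := by
  obtain ⟨t, h⟩ := hf
  obtain ⟨u, h'⟩ := hg
  exact ⟨t =' u, .equal _ _, fun M v => by rw [BoundedFormula.realize_bdEqual, h, h']⟩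
theorem D0.rle (hf : IsTm f) (hg : IsTm g) : D0 (fun M v => rle (f M v) (g M v)) := by
  obtain ⟨t, h⟩ := hf
  obtain ⟨u, h'⟩ := hg
  exact ⟨leF t u, .le _ _, fun M v => by rw [real_le, h, h']⟩
theorem D0.imp (hP : D0 P) (hQ : D0 Q) : D0 (fun M v => P M v → Q M v) := by
  obtain ⟨t, d, h⟩ := hP
  obtain ⟨u, d', h'⟩ := hQ
  exact ⟨t ⟹ u, .imp d d', fun M v => by rw [BoundedFormula.realize_imp, h, h']⟩
theorem D0.congr (hP : D0 P) (h : ∀ M v, Q M v ↔ P M v) : D0 Q := by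
  obtain ⟨t, d, h'⟩ := hP
  exact ⟨t, d, fun M v => by rw [h', h]⟩
theorem D0.not (hP : D0 P) : D0 (fun M v => ¬ P M v) := hP.imp D0.falsum
theorem D0.and (hP : D0 P) (hQ : D0 Q) : D0 (fun M v => P M v ∧ Q M v) :=
  (hP.imp hQ.not).not.congr fun M v => by tauto
theorem D0.or (hP : D0 P) (hQ : D0 Q) : D0 (fun M v => P M v ∨ Q M v) :=
  (hP.not.imp hQ).congr fun M v => by tauto
theorem D0.iff (hP : D0 P) (hQ : D0 Q) : D0 (fun M v => P M v ↔ Q M v) :=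
  ((hP.imp hQ).and (hQ.imp hP)).congr fun M v => by tauto
theorem D0.rball {P : ∀ M : PAM, (Fin m → M) → M → Prop} (hf : IsTm f)
    (h : D0 (m := m + 1) (fun M w => P M (fun i => w i.castSucc) (w (Fin.last m)))) :
    D0 (fun M v => ∀ x, Guaspari.rle x (f M v) → P M v x) := by
  obtain ⟨t, d, h⟩ := h
  obtain ⟨u, h'⟩ := hf
  exact ⟨_, .ball u d, fun M v => by
    simp only [BoundedFormula.realize_all, BoundedFormula.realize_imp, real_le, real_v,
      relabel_cast, h, h', Fin.snoc_castSucc, Fin.snoc_last]⟩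
theorem D0.rbex {P : ∀ M : PAM, (Fin m → M) → M → Prop} (hf : IsTm f)
    (h : D0 (m := m + 1) (fun M w => P M (fun i => w i.castSucc) (w (Fin.last m)))) :
    D0 (fun M v => ∃ x, Guaspari.rle x (f M v) ∧ P M v x) := by
  obtain ⟨t, d, h⟩ := h
  obtain ⟨u, h'⟩ := hf
  exact ⟨_, .bex u d, fun M v => by
    simp only [BoundedFormula.realize_ex, BoundedFormula.realize_inf, real_le, real_v,
      relabel_cast, h, h', Fin.snoc_castSucc, Fin.snoc_last]⟩
theorem D0.sub {P : Pd l} (h : D0 P) {f : Fin l → Fu m} (hf : ∀ i, IsTm (f i)) :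
    D0 (fun M v => P M (fun i => f i M v)) := by
  obtain ⟨t, d, h⟩ := h
  choose ts hts using hf
  obtain ⟨p, d, hp⟩ := d0_sub d ts
  exact ⟨p, d, fun M v => by rw [hp M, h]; simp only [hts]⟩
end D0

section SgPi
variable {P Q : Pd m} {f g : Fu m} {k : ℕ}
theorem Sg.toDf (h : Sg k P) : Df P := let ⟨t, _, h⟩ := h; ⟨t, h⟩
theorem Pi.toDf (h : Pi k P) : Df P := let ⟨t, _, h⟩ := h; ⟨t, h⟩
theorem Sg.congr (hP : Sg k P) (h : ∀ M v, Q M v ↔ P M v) : Sg k Q := by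
  obtain ⟨t, d, h'⟩ := hP
  exact ⟨t, d, fun M v => by rw [h', h]⟩
theorem Pi.congr (hP : Pi k P) (h : ∀ M v, Q M v ↔ P M v) : Pi k Q := by
  obtain ⟨t, d, h'⟩ := hP
  exact ⟨t, d, fun M v => by rw [h', h]⟩
theorem Sg.sub {P : Pd l} (h : Sg k P) {f : Fin l → Fu m} (hf : ∀ i, IsTm (f i)) :
    Sg k (fun M v => P M (fun i => f i M v)) := by
  obtain ⟨t, d, h⟩ := h
  choose ts hts using hf
  obtain ⟨p, d, hp⟩ := (sgpi_sub _).1 d ts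
  exact ⟨p, d, fun M v => by rw [hp M, h]; simp only [hts]⟩
theorem Pi.sub {P : Pd l} (h : Pi k P) {f : Fin l → Fu m} (hf : ∀ i, IsTm (f i)) :
    Pi k (fun M v => P M (fun i => f i M v)) := by
  obtain ⟨t, d, h⟩ := h
  choose ts hts using hf
  obtain ⟨p, d, hp⟩ := (sgpi_sub _).2 d ts
  exact ⟨p, d, fun M v => by rw [hp M, h]; simp only [hts]⟩
theorem D0.sg0 (h : D0 P) : Sg 0 P := let ⟨t, d, h⟩ := h; ⟨t, .ofDelta0 d, h⟩
theorem D0.pi0 (h : D0 P) : Pi 0 P := let ⟨t, d, h⟩ := h; ⟨t, .ofDelta0 d, h⟩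
theorem Sg.d0 (h : Sg 0 P) : D0 P := by
  obtain ⟨t, d, h⟩ := h
  cases d with
  | ofDelta0 d => exact ⟨t, d, h⟩
theorem Pi.d0 (h : Pi 0 P) : D0 P := by
  obtain ⟨t, d, h⟩ := h
  cases d with
  | ofDelta0 d => exact ⟨t, d, h⟩
theorem Pi.sg (h : Pi k P) : Sg (k + 1) P := let ⟨t, d, h⟩ := h; ⟨t, .ofPi d, h⟩
theorem Sg.pi (h : Sg k P) : Pi (k + 1) P := let ⟨t, d, h⟩ := h; ⟨t, .ofSigma d, h⟩
theorem Sg.ex {P : ∀ M : PAM, (Fin m → M) → M → Prop}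
    (h : Sg (k + 1) (m := m + 1) (fun M w => P M (fun i => w i.castSucc) (w (Fin.last m)))) :
    Sg (k + 1) (fun M v => ∃ x, P M v x) := by
  obtain ⟨t, d, h⟩ := h
  exact ⟨∃' t, .ex d, fun M v => by
    simp only [BoundedFormula.realize_ex, h, Fin.snoc_castSucc, Fin.snoc_last]⟩
theorem Pi.all {P : ∀ M : PAM, (Fin m → M) → M → Prop}
    (h : Pi (k + 1) (m := m + 1) (fun M w => P M (fun i => w i.castSucc) (w (Fin.last m)))) :
    Pi (k + 1) (fun M v => ∀ x, P M v x) := by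
  obtain ⟨t, d, h⟩ := h
  exact ⟨∀' t, .all d, fun M v => by
    simp only [BoundedFormula.realize_all, h, Fin.snoc_castSucc, Fin.snoc_last]⟩
end SgPi

theorem Sg.elim {k : ℕ} {R : ∀ m, Pd m → Prop} {P : Pd m} (h : Sg (k + 1) P)
    (h1 : ∀ m P, Pi k P → R m P)
    (h2 : ∀ m (P : Pd (m + 1)), R (m + 1) P → R m (fun _ v => ∃ x, P _ (Fin.snoc v x))) :
    R m P := by
  obtain ⟨t, d, h⟩ := h
  have := sgf_elim (R := fun m φ => R m (fun M v => φ.Realize default v))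
    (fun m P hP => h1 _ _ ⟨_, hP, fun _ _ => Iff.rfl⟩)
    (fun m P hP => by simpa only [BoundedFormula.realize_ex] using h2 _ _ hP) d
  simpa only [h] using this
theorem Pi.elim {k : ℕ} {R : ∀ m, Pd m → Prop} {P : Pd m} (h : Pi (k + 1) P)
    (h1 : ∀ m P, Sg k P → R m P)
    (h2 : ∀ m (P : Pd (m + 1)), R (m + 1) P → R m (fun _ v => ∀ x, P _ (Fin.snoc v x))) :
    R m P := by
  obtain ⟨t, d, h⟩ := h
  have := pif_elim (R := fun m φ => R m (fun M v => φ.Realize default v))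
    (fun m P hP => h1 _ _ ⟨_, hP, fun _ _ => Iff.rfl⟩)
    (fun m P hP => by simpa only [BoundedFormula.realize_all] using h2 _ _ hP) d
  simpa only [h] using this

end Guaspari

open FirstOrder Language
open scoped FirstOrder
namespace Guaspari
set_option linter.all false

section
variable {m l k : ℕ}
theorem Sg.wk {P : Pd m} (h : Sg k P) : Sg k (m := m + 1) (fun M w => P M (fun i => w i.castSucc)) :=
  h.sub (f := fun i _ w => w i.castSucc) (fun i => IsTm.var _)
theorem Pi.wk {P : Pd m} (h : Pi k P) : Pi k (m := m + 1) (fun M w => P M (fun i => w i.castSucc)) :=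
  h.sub (f := fun i _ w => w i.castSucc) (fun i => IsTm.var _)
theorem snoc_self {M : Type} (w : Fin (m + 1) → M) :
    (Fin.snoc (fun i => w i.castSucc) (w (Fin.last m)) : Fin (m + 1) → M) = w := by
  funext i
  refine Fin.lastCases ?_ (fun i => ?_) i <;> simp
theorem Sg.exs {P : Pd (m + 1)} (h : Sg (k + 1) P) : Sg (k + 1) (fun M v => ∃ x, P M (Fin.snoc v x)) := by
  apply Sg.ex
  exact h.congr fun M v => by rw [snoc_self]
theorem Pi.alls {P : Pd (m + 1)} (h : Pi (k + 1) P) : Pi (k + 1) (fun M v => ∀ x, P M (Fin.snoc v x)) := by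
  apply Pi.all
  exact h.congr fun M v => by rw [snoc_self]

theorem sgpi_not (k : ℕ) : (∀ {m : ℕ} {P : Pd m}, Sg k P → Pi k (fun M v => ¬ P M v)) ∧
    (∀ {m : ℕ} {P : Pd m}, Pi k P → Sg k (fun M v => ¬ P M v)) := by
  induction k with
  | zero => exact ⟨fun h => h.d0.not.pi0, fun h => h.d0.not.sg0⟩
  | succ k ih =>
    constructor
    · intro m P h
      refine h.elim (R := fun m P => Pi (k+1) (fun M v => ¬ P M v)) (fun m P h => (ih.2 h).pi) ?_
      intro m P h
      exact h.alls.congr fun M v => by simp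
    · intro m P h
      refine h.elim (R := fun m P => Sg (k+1) (fun M v => ¬ P M v)) (fun m P h => (ih.1 h).sg) ?_
      intro m P h
      exact h.exs.congr fun M v => by simp
theorem Sg.not {P : Pd m} (h : Sg k P) : Pi k (fun M v => ¬ P M v) := (sgpi_not k).1 h
theorem Pi.not {P : Pd m} (h : Pi k P) : Sg k (fun M v => ¬ P M v) := (sgpi_not k).2 h

theorem sg_andor (k : ℕ) : (∀ {m : ℕ} {P Q : Pd m}, Sg k P → Sg k Q →
    Sg k (fun M v => P M v ∧ Q M v) ∧ Sg k (fun M v => P M v ∨ Q M v)) := by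
  induction k with
  | zero => exact fun h h' => ⟨(h.d0.and h'.d0).sg0, (h.d0.or h'.d0).sg0⟩
  | succ k ih =>
    have piand : ∀ {m : ℕ} {P Q : Pd m}, Pi k P → Pi k Q →
        Pi k (fun M v => P M v ∧ Q M v) ∧ Pi k (fun M v => P M v ∨ Q M v) := fun h h' =>
      ⟨(ih h.not h'.not).2.not.congr fun M v => by tauto,
       (ih h.not h'.not).1.not.congr fun M v => by tauto⟩
    have inner : ∀ {m : ℕ} {Q : Pd m}, Sg (k + 1) Q → ∀ P : Pd m, Pi k P →
        Sg (k+1) (fun M v => P M v ∧ Q M v) ∧ Sg (k+1) (fun M v => P M v ∨ Q M v) := by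
      intro m Q h
      refine h.elim (R := fun m Q => ∀ P : Pd m, Pi k P →
        Sg (k+1) (fun M v => P M v ∧ Q M v) ∧ Sg (k+1) (fun M v => P M v ∨ Q M v)) ?_ ?_
      · exact fun m Q hQ P hP => ⟨(piand hP hQ).1.sg, (piand hP hQ).2.sg⟩
      · intro m Q ih P hP
        have := ih _ hP.wk
        refine ⟨this.1.exs.congr fun M v => ?_, this.2.exs.congr fun M v => ?_⟩
        · simp only [Fin.snoc_castSucc, exists_and_left]
        · simp only [Fin.snoc_castSucc]
          haveI : Nonempty M := ⟨rz⟩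
          simp [exists_or]
    intro m P Q h hQ
    refine h.elim (R := fun m P => ∀ Q : Pd m, Sg (k+1) Q →
        Sg (k+1) (fun M v => P M v ∧ Q M v) ∧ Sg (k+1) (fun M v => P M v ∨ Q M v)) ?_ ?_ Q hQ
    · exact fun m P hP Q hQ => inner hQ P hP
    · intro m P ih Q hQ
      have := ih _ hQ.wk
      refine ⟨this.1.exs.congr fun M v => ?_, this.2.exs.congr fun M v => ?_⟩
      · simp only [Fin.snoc_castSucc, exists_and_right]
      · simp only [Fin.snoc_castSucc]
        haveI : Nonempty M := ⟨rz⟩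
        simp [exists_or]
theorem Sg.and {P Q : Pd m} (h : Sg k P) (h' : Sg k Q) : Sg k (fun M v => P M v ∧ Q M v) :=
  (sg_andor k h h').1
theorem Sg.or {P Q : Pd m} (h : Sg k P) (h' : Sg k Q) : Sg k (fun M v => P M v ∨ Q M v) :=
  (sg_andor k h h').2
theorem Pi.and {P Q : Pd m} (h : Pi k P) (h' : Pi k Q) : Pi k (fun M v => P M v ∧ Q M v) :=
  (h.not.or h'.not).not.congr fun M v => by tauto
theorem Pi.or {P Q : Pd m} (h : Pi k P) (h' : Pi k Q) : Pi k (fun M v => P M v ∨ Q M v) :=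
  (h.not.and h'.not).not.congr fun M v => by tauto
theorem Pi.imp {P Q : Pd m} (h : Sg k P) (h' : Pi k Q) : Pi k (fun M v => P M v → Q M v) :=
  (h.not.or h').congr fun M v => by tauto
theorem sgpi_mono (k : ℕ) : (∀ {m : ℕ} {P : Pd m}, Sg k P → Sg (k+1) P) ∧
    (∀ {m : ℕ} {P : Pd m}, Pi k P → Pi (k+1) P) := by
  induction k with
  | zero => exact ⟨fun h => h.d0.pi0.sg, fun h => h.d0.sg0.pi⟩
  | succ k ih =>
    have : ∀ {m : ℕ} {P : Pd m}, Sg (k+1) P → Sg (k+2) P := fun h =>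
      h.elim (R := fun m P => Sg (k+2) P) (fun m P h => (ih.2 h).sg) (fun m P h => h.exs)
    exact ⟨this, fun h => (this h.not).not.congr fun M v => by tauto⟩
theorem Sg.mono {P : Pd m} (h : Sg k P) : Sg (k + 1) P := (sgpi_mono k).1 h
theorem Pi.mono {P : Pd m} (h : Pi k P) : Pi (k + 1) P := (sgpi_mono k).2 h
theorem D0.sg {P : Pd m} (h : D0 P) : Sg k P := by
  induction k with
  | zero => exact h.sg0
  | succ k ih => exact ih.mono
theorem D0.pi {P : Pd m} (h : D0 P) : Pi k P := by
  induction k with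
  | zero => exact h.pi0
  | succ k ih => exact ih.mono
end

/-! ### Axioms in models -/
section ax
variable (M : PAM)

theorem ax1 (x : M) : rs x ≠ rz := by
  have := M.is_model.realize_of_mem (∀' ∼(succT (vT 0) =' zeroT)) (by simp [PAAx])
  simp only [Sentence.Realize, Formula.Realize, BoundedFormula.realize_all,
    BoundedFormula.realize_not, BoundedFormula.realize_bdEqual, real_succ, real_zero, real_v] at this
  exact this x
theorem ax2 (x y : M) : rs x = rs y → x = y := by
  have := M.is_model.realize_of_mem
    (∀' ∀' ((succT (vT 0) =' succT (vT 1)) ⟹ (vT 0 =' vT 1))) (by simp [PAAx])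
  simp only [Sentence.Realize, Formula.Realize, BoundedFormula.realize_all,
    BoundedFormula.realize_imp, BoundedFormula.realize_bdEqual, real_succ, real_zero, real_v] at this
  exact this x y
theorem ax3 (x : M) : ra x rz = x := by
  have := M.is_model.realize_of_mem
    (∀' (addT (vT 0) zeroT =' vT 0)) (by simp [PAAx])
  simp only [Sentence.Realize, Formula.Realize, BoundedFormula.realize_all,
    BoundedFormula.realize_imp, BoundedFormula.realize_bdEqual, real_succ, real_zero, real_v,
    real_add] at this
  exact this x
theorem ax4 (x y : M) : ra x (rs y) = rs (ra x y) := by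
  have := M.is_model.realize_of_mem
    (∀' ∀' (addT (vT 0) (succT (vT 1)) =' succT (addT (vT 0) (vT 1)))) (by simp [PAAx])
  simp only [Sentence.Realize, Formula.Realize, BoundedFormula.realize_all,
    BoundedFormula.realize_imp, BoundedFormula.realize_bdEqual, real_succ, real_zero, real_v,
    real_add] at this
  exact this x y
theorem ax5 (x : M) : rm x rz = rz := by
  have := M.is_model.realize_of_mem
    (∀' (mulT (vT 0) zeroT =' zeroT)) (by simp [PAAx])
  simp only [Sentence.Realize, Formula.Realize, BoundedFormula.realize_all,
    BoundedFormula.realize_imp, BoundedFormula.realize_bdEqual, real_succ, real_zero, real_v,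
    real_mul] at this
  exact this x
theorem ax6 (x y : M) : rm x (rs y) = ra (rm x y) x := by
  have := M.is_model.realize_of_mem
    (∀' ∀' (mulT (vT 0) (succT (vT 1)) =' addT (mulT (vT 0) (vT 1)) (vT 0))) (by simp [PAAx])
  simp only [Sentence.Realize, Formula.Realize, BoundedFormula.realize_all,
    BoundedFormula.realize_imp, BoundedFormula.realize_bdEqual, real_succ, real_zero, real_v,
    real_mul, real_add] at this
  exact this x y
theorem ax7 (x y : M) : rle x y ↔ ∃ z, ra z x = y := by
  have := M.is_model.realize_of_mem
    (∀' ∀' (leF (vT 0) (vT 1) ⇔ ∃' (addT (vT 2) (vT 0) =' vT 1))) (by simp [PAAx])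
  simp only [Sentence.Realize, Formula.Realize, BoundedFormula.realize_all,
    BoundedFormula.realize_iff, BoundedFormula.realize_bdEqual, BoundedFormula.realize_ex, real_v,
    real_le, real_add] at this
  exact this x y

theorem real_ind {k : ℕ} (N : Type) [LA.Structure N] (φ : LA.BoundedFormula Empty (k + 1)) :
    Sentence.Realize N (indAxiom φ) ↔ ∀ v : Fin k → N, φ.Realize default (Fin.snoc v rz : Fin (k+1) → N) →
      (∀ x, φ.Realize default (Fin.snoc v x : Fin (k+1) → N) →
        φ.Realize default (Fin.snoc v (rs x) : Fin (k+1) → N)) →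
      ∀ x, φ.Realize default (Fin.snoc v x : Fin (k+1) → N) := by
  have key : ∀ (v : Fin k → N) (x y : N),
      ((Fin.snoc (Fin.snoc v x : Fin (k+1) → N) y : Fin (k+2) → N) ∘
        fun i : Fin (k+1) => if (i : ℕ) < k then i.castSucc else i.succ) = Fin.snoc v y := by
    intro v x y
    funext i
    refine Fin.lastCases ?_ (fun i => ?_) i
    · simp only [Function.comp, Fin.val_last, lt_irrefl, if_false, Fin.succ_last, Fin.snoc_last]
    · simp
  simp only [Sentence.Realize, indAxiom]
  rw [BoundedFormula.realize_alls]
  simp only [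
    BoundedFormula.realize_all, BoundedFormula.realize_imp, BoundedFormula.realize_inf,
    BoundedFormula.realize_bdEqual, real_succ, real_zero, real_v, Fin.snoc_last, Fin.snoc_castSucc,
    BoundedFormula.realize_liftAt_one (Nat.le_succ k), key, forall_eq, and_imp]

theorem indf {k : ℕ} {P : ∀ M : PAM, (Fin k → M) → M → Prop}
    (h : Df (m := k + 1) (fun M w => P M (fun i => w i.castSucc) (w (Fin.last k))))
    (v : Fin k → M) (h0 : P M v rz) (hs : ∀ x, P M v x → P M v (rs x)) (x : M) : P M v x := by
  obtain ⟨φ, h⟩ := h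
  have := (real_ind M φ).1 (M.is_model.realize_of_mem _ (Or.inr ⟨_, φ, rfl⟩)) v
  simp only [h, Fin.snoc_castSucc, Fin.snoc_last] at this
  exact this h0 hs x
end ax

end Guaspari

open FirstOrder Language
open scoped FirstOrder
namespace Guaspari
set_option linter.all false

section raw
variable {M : PAM}
theorem ind0 {P : ∀ M : PAM, M → Prop} (h : Df (m := 1) (fun M w => P M (w 0)))
    (h0 : P M rz) (hs : ∀ x, P M x → P M (rs x)) (x : M) : P M x :=
  indf M (k := 0) (P := fun M v x => P M x) h ![] h0 hs x
theorem ind1 {P : ∀ M : PAM, M → M → Prop} (h : Df (m := 2) (fun M w => P M (w 0) (w 1)))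
    (a : M) (h0 : P M a rz) (hs : ∀ x, P M a x → P M a (rs x)) (x : M) : P M a x :=
  indf M (k := 1) (P := fun M v x => P M (v 0) x) h ![a] h0 hs x
theorem ind2 {P : ∀ M : PAM, M → M → M → Prop} (h : Df (m := 3) (fun M w => P M (w 0) (w 1) (w 2)))
    (a b : M) (h0 : P M a b rz) (hs : ∀ x, P M a b x → P M a b (rs x)) (x : M) : P M a b x :=
  indf M (k := 2) (P := fun M v x => P M (v 0) (v 1) x) h ![a, b] h0 hs x

theorem rzero_add (x : M) : ra rz x = x := by
  refine ind0 (P := fun M x => ra rz x = x) ?_ (ax3 _ _) (fun x h => ?_) x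
  · apply_rules [Df.eq, IsTm.ra, IsTm.rz, IsTm.var]
  · rw [ax4, h]
theorem rsucc_add (x y : M) : ra (rs x) y = rs (ra x y) := by
  refine ind1 (P := fun M x y => ra (rs x) y = rs (ra x y)) ?_ x ?_ (fun y h => ?_) y
  · apply_rules [Df.eq, IsTm.ra, IsTm.rz, IsTm.var, IsTm.rs]
  · rw [ax3, ax3]
  · rw [ax4, h, ax4]
theorem radd_comm (x y : M) : ra x y = ra y x := by
  refine ind1 (P := fun M x y => ra x y = ra y x) ?_ x ?_ (fun y h => ?_) y
  · apply_rules [Df.eq, IsTm.ra, IsTm.rz, IsTm.var, IsTm.rs]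
  · rw [ax3, rzero_add]
  · rw [ax4, h, rsucc_add]
theorem radd_assoc (x y z : M) : ra (ra x y) z = ra x (ra y z) := by
  refine ind2 (P := fun M x y z => ra (ra x y) z = ra x (ra y z)) ?_ x y ?_ (fun y h => ?_) z
  · apply_rules [Df.eq, IsTm.ra, IsTm.rz, IsTm.var, IsTm.rs]
  · rw [ax3, ax3]
  · rw [ax4, h, ax4, ax4]
theorem rzero_mul (x : M) : rm rz x = rz := by
  refine ind0 (P := fun M x => rm rz x = rz) ?_ (ax5 _ _) (fun x h => ?_) x
  · apply_rules [Df.eq, IsTm.rm, IsTm.rz, IsTm.var]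
  · rw [ax6, h, ax3]
theorem rsucc_mul (x y : M) : rm (rs x) y = ra (rm x y) y := by
  refine ind1 (P := fun M x y => rm (rs x) y = ra (rm x y) y) ?_ x ?_ (fun y h => ?_) y
  · apply_rules [Df.eq, IsTm.ra, IsTm.rm, IsTm.rz, IsTm.var, IsTm.rs]
  · rw [ax5, ax5, ax3]
  · rw [ax6, h, ax6, ax4, ax4, radd_assoc, radd_assoc, radd_comm y x]
theorem rmul_comm (x y : M) : rm x y = rm y x := by
  refine ind1 (P := fun M x y => rm x y = rm y x) ?_ x ?_ (fun y h => ?_) y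
  · apply_rules [Df.eq, IsTm.rm, IsTm.rz, IsTm.var, IsTm.rs]
  · rw [ax5, rzero_mul]
  · rw [ax6, h, rsucc_mul]
theorem rmul_add (x y z : M) : rm x (ra y z) = ra (rm x y) (rm x z) := by
  refine ind2 (P := fun M x y z => rm x (ra y z) = ra (rm x y) (rm x z)) ?_ x y ?_ (fun y h => ?_) z
  · apply_rules [Df.eq, IsTm.ra, IsTm.rm, IsTm.rz, IsTm.var, IsTm.rs]
  · rw [ax3, ax5, ax3]
  · rw [ax4, ax6, h, ax6, radd_assoc]
theorem rmul_assoc (x y z : M) : rm (rm x y) z = rm x (rm y z) := by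
  refine ind2 (P := fun M x y z => rm (rm x y) z = rm x (rm y z)) ?_ x y ?_ (fun y h => ?_) z
  · apply_rules [Df.eq, IsTm.ra, IsTm.rm, IsTm.rz, IsTm.var, IsTm.rs]
  · rw [ax5, ax5, ax5]
  · rw [ax6, h, ax6, rmul_add]
theorem radd_cancel (x y z : M) : ra x z = ra y z → x = y := by
  refine ind2 (P := fun M x y z => ra x z = ra y z → x = y) ?_ x y ?_ (fun y h => ?_) z
  · apply_rules [Df.eq, Df.imp, IsTm.ra, IsTm.rm, IsTm.rz, IsTm.var, IsTm.rs]
  · rw [ax3, ax3]; exact id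
  · rw [ax4, ax4]; exact fun h' => h (ax2 _ _ _ h')
theorem rcases0 (x : M) : x = rz ∨ ∃ y, x = rs y := by
  refine ind0 (P := fun M x => x = rz ∨ ∃ y, x = rs y) ?_ (Or.inl rfl) (fun x h => Or.inr ⟨x, rfl⟩) x
  apply_rules [Df.eq, Df.or, Df.ex, IsTm.ra, IsTm.rm, IsTm.rz, IsTm.var, IsTm.rs]
theorem radd_eq_zero (x y : M) (h : ra x y = rz) : y = rz := by
  rcases rcases0 y with rfl | ⟨z, rfl⟩
  · rfl
  · rw [ax4] at h
    exact absurd h (ax1 _ _)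
theorem rle_total (x y : M) : rle x y ∨ rle y x := by
  refine ind1 (P := fun M x y => rle x y ∨ rle y x) ?_ x ?_ (fun y h => ?_) y
  · apply_rules [Df.rle, Df.or, IsTm.ra, IsTm.rz, IsTm.var, IsTm.rs]
  · right; rw [ax7]; exact ⟨x, ax3 _ _⟩
  · simp only [ax7] at h ⊢
    rcases h with ⟨z, rfl⟩ | ⟨z, rfl⟩
    · left; exact ⟨rs z, rsucc_add _ _⟩
    · rcases rcases0 z with rfl | ⟨w, rfl⟩
      · left; exact ⟨rs rz, by rw [rzero_add, rsucc_add, rzero_add]⟩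
      · right; exact ⟨w, by rw [ax4, rsucc_add]⟩
end raw

noncomputable instance instCS (M : PAM) : CommSemiring M where
  zero := rz
  one := rs rz
  add := ra
  mul := rm
  add_assoc := radd_assoc
  zero_add := rzero_add
  add_zero := ax3 M
  nsmul := @nsmulRec _ ⟨rz⟩ ⟨ra⟩
  add_comm := radd_comm
  left_distrib := rmul_add
  right_distrib x y z := by
    change rm (ra x y) z = ra (rm x z) (rm y z)
    rw [rmul_comm, rmul_add, rmul_comm z, rmul_comm z]
  zero_mul := rzero_mul
  mul_zero := ax5 M
  mul_assoc := rmul_assoc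
  one_mul x := by
    change rm (rs rz) x = x
    rw [rsucc_mul, rzero_mul, rzero_add]
  mul_one x := by
    change rm x (rs rz) = x
    rw [ax6, ax5, rzero_add]
  mul_comm := rmul_comm

noncomputable instance instLO (M : PAM) : LinearOrder M where
  le := rle
  le_refl x := (ax7 M _ _).2 ⟨rz, rzero_add _⟩
  le_trans x y z h1 h2 := by
    change rle x y at h1
    change rle y z at h2
    change rle x z
    rw [ax7] at *
    obtain ⟨a, rfl⟩ := h1
    obtain ⟨b, rfl⟩ := h2
    exact ⟨ra b a, radd_assoc _ _ _⟩
  le_antisymm x y h1 h2 := by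
    change rle x y at h1
    change rle y x at h2
    rw [ax7] at *
    obtain ⟨a, rfl⟩ := h1
    obtain ⟨b, h⟩ := h2
    rw [← radd_assoc] at h
    have := radd_cancel _ _ _ (h.trans (rzero_add x).symm)
    have := radd_eq_zero _ _ this
    subst this
    rw [rzero_add]
  le_total := rle_total
  toDecidableLE := Classical.decRel _

section alg
variable {M : PAM}
theorem rle_iff (x y : M) : rle x y ↔ x ≤ y := Iff.rfl
theorem ra_eq (x y : M) : ra x y = x + y := rfl
theorem rm_eq (x y : M) : rm x y = x * y := rfl
theorem rz_eq : (rz : M) = 0 := rfl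
theorem rs_eq (x : M) : rs x = x + 1 := by
  change rs x = ra x (rs rz)
  rw [ax4, ax3]
theorem le_iff (x y : M) : x ≤ y ↔ ∃ z, z + x = y := ax7 M x y

instance instCan : CanonicallyOrderedAdd M where
  exists_add_of_le {a b} h := by
    obtain ⟨z, rfl⟩ := (le_iff _ _).1 h
    exact ⟨z, add_comm _ _⟩
  le_self_add a b := (le_iff _ _).2 ⟨b, add_comm _ _⟩
  le_add_self a b := (le_iff _ _).2 ⟨b, rfl⟩
instance instCancel : IsCancelAdd M := 
  { add_right_cancel := fun z x y h => radd_cancel x y z h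
    add_left_cancel := fun z x y h => radd_cancel x y z (by
      change z + x = z + y at h
      change x + z = y + z
      rw [add_comm, h, add_comm]) }
theorem zero_or_succ (x : M) : x = 0 ∨ ∃ y, x = y + 1 := by
  rcases rcases0 x with h | ⟨y, h⟩
  · exact Or.inl h
  · exact Or.inr ⟨y, by rw [h, rs_eq]⟩
instance instSOR : IsStrictOrderedRing M where
  add_le_add_left a b h c := by
    obtain ⟨z, rfl⟩ := (le_iff _ _).1 h
    exact (le_iff _ _).2 ⟨z, by ring⟩
  le_of_add_le_add_left a b c h := by
    obtain ⟨z, hz⟩ := (le_iff _ _).1 h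
    exact (le_iff _ _).2 ⟨z, add_left_cancel (a := a) (by rw [← hz]; ring)⟩
  zero_le_one := zero_le
  exists_pair_ne := ⟨0, 1, fun h => ax1 M rz h.symm⟩
  mul_lt_mul_of_pos_left a ha b c h := by
    obtain ⟨z, rfl⟩ := (le_iff _ _).1 h.le
    rcases zero_or_succ z with rfl | ⟨z, rfl⟩
    · simp at h
    rcases zero_or_succ a with rfl | ⟨a, rfl⟩
    · simp at ha
    refine lt_of_le_of_ne ((le_iff _ _).2 ⟨(a+1)*(z+1), by ring⟩) fun h => ?_
    have : (0 : M) = (a * z + a + z) + 1 := add_right_cancel (b := (a+1)*b) (by 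
      rw [zero_add]; exact h.trans (by ring))
    exact ax1 M (a * z + a + z) (by rw [rs_eq, ← this]; rfl)
  mul_lt_mul_of_pos_right a ha b c h := by
    obtain ⟨z, rfl⟩ := (le_iff _ _).1 h.le
    rcases zero_or_succ z with rfl | ⟨z, rfl⟩
    · simp at h
    rcases zero_or_succ a with rfl | ⟨a, rfl⟩
    · simp at ha
    refine lt_of_le_of_ne ((le_iff _ _).2 ⟨(a+1)*(z+1), by ring⟩) fun h => ?_
    have : (0 : M) = (a * z + a + z) + 1 := add_right_cancel (b := (a+1)*b) (by 
      rw [zero_add]; exact (mul_comm _ _).trans (h.trans (by ring)))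
    exact ax1 M (a * z + a + z) (by rw [rs_eq, ← this]; rfl)

theorem lt_iff_succ (x y : M) : x < y ↔ x + 1 ≤ y := by
  constructor
  · intro h
    obtain ⟨z, rfl⟩ := (le_iff _ _).1 h.le
    rcases zero_or_succ z with rfl | ⟨z, rfl⟩
    · simp at h
    · exact (le_iff _ _).2 ⟨z, by ring⟩
  · intro h
    exact lt_of_lt_of_le (lt_add_one x) h
theorem lt_succ_iff (x y : M) : x < y + 1 ↔ x ≤ y := by
  rw [lt_iff_succ]; exact add_le_add_iff_right 1
theorem le_succ_iff (x y : M) : x ≤ y + 1 ↔ x ≤ y ∨ x = y + 1 := by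
  rw [le_iff_lt_or_eq, lt_succ_iff]

variable {m : ℕ} {f g : Fu m}
theorem IsTm.add (hf : IsTm f) (hg : IsTm g) : IsTm (fun M v => f M v + g M v) := hf.ra hg
theorem IsTm.mul (hf : IsTm f) (hg : IsTm g) : IsTm (fun M v => f M v * g M v) := hf.rm hg
theorem IsTm.zero : IsTm (m := m) (fun M v => 0) := IsTm.rz
theorem IsTm.one : IsTm (m := m) (fun M v => 1) := IsTm.rz.rs
theorem IsTm.natCast (n : ℕ) : IsTm (m := m) (fun M v => (n : M)) := by
  induction n with
  | zero => simp only [Nat.cast_zero]; exact IsTm.zero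
  | succ n ih => simp only [Nat.cast_succ]; exact ih.add IsTm.one
theorem IsTm.ofNat (n : ℕ) [n.AtLeastTwo] : IsTm (m := m) (fun M v => (OfNat.ofNat n : M)) := 
  IsTm.natCast n
theorem Df.le (hf : IsTm f) (hg : IsTm g) : Df (fun M v => f M v ≤ g M v) := Df.rle hf hg
theorem Df.lt (hf : IsTm f) (hg : IsTm g) : Df (fun M v => f M v < g M v) :=
  (Df.le hg hf).not.congr fun M v => not_le.symm
theorem D0.le (hf : IsTm f) (hg : IsTm g) : D0 (fun M v => f M v ≤ g M v) := D0.rle hf hg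
theorem D0.lt (hf : IsTm f) (hg : IsTm g) : D0 (fun M v => f M v < g M v) :=
  (D0.le hg hf).not.congr fun M v => not_le.symm
theorem D0.ball {P : ∀ M : PAM, (Fin m → M) → M → Prop} (hf : IsTm f)
    (h : D0 (m := m + 1) (fun M w => P M (fun i => w i.castSucc) (w (Fin.last m)))) :
    D0 (fun M v => ∀ x, x ≤ f M v → P M v x) := D0.rball hf h
theorem D0.bex {P : ∀ M : PAM, (Fin m → M) → M → Prop} (hf : IsTm f)
    (h : D0 (m := m + 1) (fun M w => P M (fun i => w i.castSucc) (w (Fin.last m)))) :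
    D0 (fun M v => ∃ x, x ≤ f M v ∧ P M v x) := D0.rbex hf h

theorem ind {k : ℕ} {P : ∀ M : PAM, (Fin k → M) → M → Prop}
    (h : Df (m := k + 1) (fun M w => P M (fun i => w i.castSucc) (w (Fin.last k))))
    (v : Fin k → M) (h0 : P M v 0) (hs : ∀ x, P M v x → P M v (x + 1)) (x : M) : P M v x :=
  indf M h v h0 (fun x hx => by rw [rs_eq]; exact hs x hx) x
end alg
end Guaspari

open FirstOrder Language
open scoped FirstOrder
namespace Guaspari
set_option linter.all false

theorem IsTm.vec {m l : ℕ} {f : Fin l → Fu m} (h : ∀ i, IsTm (f i)) : ∀ i, IsTm (f i) := h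
section subs
variable {m k : ℕ} {a b c d e f g h : Fu m}
theorem Df.s1 {P : ∀ M : PAM, M → Prop} (hP : Df (m := 1) (fun M v => P M (v 0)))
    (ha : IsTm a) : Df (fun M v => P M (a M v)) :=
  hP.sub (f := ![a]) (by
    intro i
    fin_cases i
    · exact ha)
theorem D0.s1 {P : ∀ M : PAM, M → Prop} (hP : D0 (m := 1) (fun M v => P M (v 0)))
    (ha : IsTm a) : D0 (fun M v => P M (a M v)) :=
  hP.sub (f := ![a]) (by
    intro i
    fin_cases i
    · exact ha)
theorem Sg.s1 {P : ∀ M : PAM, M → Prop} (hP : Sg k (m := 1) (fun M v => P M (v 0)))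
    (ha : IsTm a) : Sg k (fun M v => P M (a M v)) :=
  hP.sub (f := ![a]) (by
    intro i
    fin_cases i
    · exact ha)
theorem Pi.s1 {P : ∀ M : PAM, M → Prop} (hP : Pi k (m := 1) (fun M v => P M (v 0)))
    (ha : IsTm a) : Pi k (fun M v => P M (a M v)) :=
  hP.sub (f := ![a]) (by
    intro i
    fin_cases i
    · exact ha)
theorem Df.s2 {P : ∀ M : PAM, M → M → Prop} (hP : Df (m := 2) (fun M v => P M (v 0) (v 1)))
    (ha : IsTm a) (hb : IsTm b) : Df (fun M v => P M (a M v) (b M v)) :=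
  hP.sub (f := ![a, b]) (by
    intro i
    fin_cases i
    · exact ha
    · exact hb)
theorem D0.s2 {P : ∀ M : PAM, M → M → Prop} (hP : D0 (m := 2) (fun M v => P M (v 0) (v 1)))
    (ha : IsTm a) (hb : IsTm b) : D0 (fun M v => P M (a M v) (b M v)) :=
  hP.sub (f := ![a, b]) (by
    intro i
    fin_cases i
    · exact ha
    · exact hb)
theorem Sg.s2 {P : ∀ M : PAM, M → M → Prop} (hP : Sg k (m := 2) (fun M v => P M (v 0) (v 1)))
    (ha : IsTm a) (hb : IsTm b) : Sg k (fun M v => P M (a M v) (b M v)) :=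
  hP.sub (f := ![a, b]) (by
    intro i
    fin_cases i
    · exact ha
    · exact hb)
theorem Pi.s2 {P : ∀ M : PAM, M → M → Prop} (hP : Pi k (m := 2) (fun M v => P M (v 0) (v 1)))
    (ha : IsTm a) (hb : IsTm b) : Pi k (fun M v => P M (a M v) (b M v)) :=
  hP.sub (f := ![a, b]) (by
    intro i
    fin_cases i
    · exact ha
    · exact hb)
theorem Df.s3 {P : ∀ M : PAM, M → M → M → Prop} (hP : Df (m := 3) (fun M v => P M (v 0) (v 1) (v 2)))
    (ha : IsTm a) (hb : IsTm b) (hc : IsTm c) : Df (fun M v => P M (a M v) (b M v) (c M v)) :=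
  hP.sub (f := ![a, b, c]) (by
    intro i
    fin_cases i
    · exact ha
    · exact hb
    · exact hc)
theorem D0.s3 {P : ∀ M : PAM, M → M → M → Prop} (hP : D0 (m := 3) (fun M v => P M (v 0) (v 1) (v 2)))
    (ha : IsTm a) (hb : IsTm b) (hc : IsTm c) : D0 (fun M v => P M (a M v) (b M v) (c M v)) :=
  hP.sub (f := ![a, b, c]) (by
    intro i
    fin_cases i
    · exact ha
    · exact hb
    · exact hc)
theorem Sg.s3 {P : ∀ M : PAM, M → M → M → Prop} (hP : Sg k (m := 3) (fun M v => P M (v 0) (v 1) (v 2)))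
    (ha : IsTm a) (hb : IsTm b) (hc : IsTm c) : Sg k (fun M v => P M (a M v) (b M v) (c M v)) :=
  hP.sub (f := ![a, b, c]) (by
    intro i
    fin_cases i
    · exact ha
    · exact hb
    · exact hc)
theorem Pi.s3 {P : ∀ M : PAM, M → M → M → Prop} (hP : Pi k (m := 3) (fun M v => P M (v 0) (v 1) (v 2)))
    (ha : IsTm a) (hb : IsTm b) (hc : IsTm c) : Pi k (fun M v => P M (a M v) (b M v) (c M v)) :=
  hP.sub (f := ![a, b, c]) (by
    intro i
    fin_cases i
    · exact ha
    · exact hb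
    · exact hc)
theorem Df.s4 {P : ∀ M : PAM, M → M → M → M → Prop} (hP : Df (m := 4) (fun M v => P M (v 0) (v 1) (v 2) (v 3)))
    (ha : IsTm a) (hb : IsTm b) (hc : IsTm c) (hd : IsTm d) : Df (fun M v => P M (a M v) (b M v) (c M v) (d M v)) :=
  hP.sub (f := ![a, b, c, d]) (by
    intro i
    fin_cases i
    · exact ha
    · exact hb
    · exact hc
    · exact hd)
theorem D0.s4 {P : ∀ M : PAM, M → M → M → M → Prop} (hP : D0 (m := 4) (fun M v => P M (v 0) (v 1) (v 2) (v 3)))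
    (ha : IsTm a) (hb : IsTm b) (hc : IsTm c) (hd : IsTm d) : D0 (fun M v => P M (a M v) (b M v) (c M v) (d M v)) :=
  hP.sub (f := ![a, b, c, d]) (by
    intro i
    fin_cases i
    · exact ha
    · exact hb
    · exact hc
    · exact hd)
theorem Sg.s4 {P : ∀ M : PAM, M → M → M → M → Prop} (hP : Sg k (m := 4) (fun M v => P M (v 0) (v 1) (v 2) (v 3)))
    (ha : IsTm a) (hb : IsTm b) (hc : IsTm c) (hd : IsTm d) : Sg k (fun M v => P M (a M v) (b M v) (c M v) (d M v)) :=
  hP.sub (f := ![a, b, c, d]) (by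
    intro i
    fin_cases i
    · exact ha
    · exact hb
    · exact hc
    · exact hd)
theorem Pi.s4 {P : ∀ M : PAM, M → M → M → M → Prop} (hP : Pi k (m := 4) (fun M v => P M (v 0) (v 1) (v 2) (v 3)))
    (ha : IsTm a) (hb : IsTm b) (hc : IsTm c) (hd : IsTm d) : Pi k (fun M v => P M (a M v) (b M v) (c M v) (d M v)) :=
  hP.sub (f := ![a, b, c, d]) (by
    intro i
    fin_cases i
    · exact ha
    · exact hb
    · exact hc
    · exact hd)
theorem D0.s5 {P : ∀ M : PAM, M → M → M → M → M → Prop} (hP : D0 (m := 5) (fun M v => P M (v 0) (v 1) (v 2) (v 3) (v 4)))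
    (ha : IsTm a) (hb : IsTm b) (hc : IsTm c) (hd : IsTm d) (he : IsTm e) : D0 (fun M v => P M (a M v) (b M v) (c M v) (d M v) (e M v)) :=
  hP.sub (f := ![a, b, c, d, e]) (by
    intro i
    fin_cases i
    · exact ha
    · exact hb
    · exact hc
    · exact hd
    · exact he)
theorem Sg.s5 {P : ∀ M : PAM, M → M → M → M → M → Prop} (hP : Sg k (m := 5) (fun M v => P M (v 0) (v 1) (v 2) (v 3) (v 4)))
    (ha : IsTm a) (hb : IsTm b) (hc : IsTm c) (hd : IsTm d) (he : IsTm e) : Sg k (fun M v => P M (a M v) (b M v) (c M v) (d M v) (e M v)) :=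
  hP.sub (f := ![a, b, c, d, e]) (by
    intro i
    fin_cases i
    · exact ha
    · exact hb
    · exact hc
    · exact hd
    · exact he)
theorem Df.s6 {P : ∀ M : PAM, M → M → M → M → M → M → Prop} (hP : Df (m := 6) (fun M v => P M (v 0) (v 1) (v 2) (v 3) (v 4) (v 5)))
    (ha : IsTm a) (hb : IsTm b) (hc : IsTm c) (hd : IsTm d) (he : IsTm e) (hf : IsTm f) : Df (fun M v => P M (a M v) (b M v) (c M v) (d M v) (e M v) (f M v)) :=
  hP.sub (f := ![a, b, c, d, e, f]) (by
    intro i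
    fin_cases i
    · exact ha
    · exact hb
    · exact hc
    · exact hd
    · exact he
    · exact hf)
theorem D0.s6 {P : ∀ M : PAM, M → M → M → M → M → M → Prop} (hP : D0 (m := 6) (fun M v => P M (v 0) (v 1) (v 2) (v 3) (v 4) (v 5)))
    (ha : IsTm a) (hb : IsTm b) (hc : IsTm c) (hd : IsTm d) (he : IsTm e) (hf : IsTm f) : D0 (fun M v => P M (a M v) (b M v) (c M v) (d M v) (e M v) (f M v)) :=
  hP.sub (f := ![a, b, c, d, e, f]) (by
    intro i
    fin_cases i
    · exact ha
    · exact hb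
    · exact hc
    · exact hd
    · exact he
    · exact hf)
theorem Sg.s6 {P : ∀ M : PAM, M → M → M → M → M → M → Prop} (hP : Sg k (m := 6) (fun M v => P M (v 0) (v 1) (v 2) (v 3) (v 4) (v 5)))
    (ha : IsTm a) (hb : IsTm b) (hc : IsTm c) (hd : IsTm d) (he : IsTm e) (hf : IsTm f) : Sg k (fun M v => P M (a M v) (b M v) (c M v) (d M v) (e M v) (f M v)) :=
  hP.sub (f := ![a, b, c, d, e, f]) (by
    intro i
    fin_cases i
    · exact ha
    · exact hb
    · exact hc
    · exact hd
    · exact he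
    · exact hf)
theorem Pi.s6 {P : ∀ M : PAM, M → M → M → M → M → M → Prop} (hP : Pi k (m := 6) (fun M v => P M (v 0) (v 1) (v 2) (v 3) (v 4) (v 5)))
    (ha : IsTm a) (hb : IsTm b) (hc : IsTm c) (hd : IsTm d) (he : IsTm e) (hf : IsTm f) : Pi k (fun M v => P M (a M v) (b M v) (c M v) (d M v) (e M v) (f M v)) :=
  hP.sub (f := ![a, b, c, d, e, f]) (by
    intro i
    fin_cases i
    · exact ha
    · exact hb
    · exact hc
    · exact hd
    · exact he
    · exact hf)
end subs

/-! ### The standard model -/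
instance natStr : LA.Structure ℕ where
  funMap {n} f v := match n, f with
    | 0, _ => 0
    | 1, _ => v 0 + 1
    | 2, false => v 0 + v 1
    | 2, true => v 0 * v 1
  RelMap {n} r v := match n, r with
    | 2, _ => v 0 ≤ v 1

theorem nat_rz : (rz : ℕ) = 0 := rfl
theorem nat_rs (x : ℕ) : rs x = x + 1 := rfl
theorem nat_ra (x y : ℕ) : ra x y = x + y := rfl
theorem nat_rm (x y : ℕ) : rm x y = x * y := rfl
theorem nat_rle (x y : ℕ) : rle x y ↔ x ≤ y := Iff.rfl

instance natModel : Theory.Model ℕ PAAx where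
  realize_of_mem := by
    intro φ h
    rcases h with h | ⟨k, ψ, rfl⟩
    · simp only [Set.mem_insert_iff, Set.mem_singleton_iff] at h
      rcases h with rfl | rfl | rfl | rfl | rfl | rfl | rfl <;>
      simp only [Sentence.Realize, Formula.Realize, BoundedFormula.realize_all,
        BoundedFormula.realize_imp, BoundedFormula.realize_not,
        BoundedFormula.realize_iff, BoundedFormula.realize_bdEqual, BoundedFormula.realize_ex, real_v,
        real_succ, real_zero, real_le, real_add, real_mul, nat_rz, nat_rs, nat_ra, nat_rm, nat_rle]
      · intro x; omega
      · intro x y h; omega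
      · intro x; omega
      · intro x y; omega
      · intro x; exact Nat.mul_zero _
      · intro x y; exact Nat.mul_succ _ _
      · intro x y
        change x ≤ y ↔ ∃ z, z + x = y
        exact ⟨fun h => ⟨y - x, by omega⟩, fun ⟨z, h⟩ => by omega⟩
    · rw [real_ind]
      intro v h0 hs x
      induction x with
      | zero => exact h0
      | succ x ih => exact hs x ih

def NatM : PAM := Theory.ModelType.of PAAx ℕ

section abs
variable {M : PAM}
theorem le_nat (n : ℕ) (x : M) (h : x ≤ (n : M)) : ∃ k ≤ n, x = (k : M) := by
  induction n with
  | zero =>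
    refine ⟨0, le_rfl, le_antisymm h ?_⟩
    rw [Nat.cast_zero]; exact zero_le
  | succ n ih =>
    rw [Nat.cast_succ, le_succ_iff] at h
    rcases h with h | h
    · obtain ⟨k, h1, h2⟩ := ih h
      exact ⟨k, by omega, h2⟩
    · exact ⟨n + 1, le_rfl, by rw [h, Nat.cast_succ]⟩

theorem tm_abs {m : ℕ} (t : LA.Term (Empty ⊕ Fin m)) (v : Fin m → ℕ) :
    t.realize (Sum.elim default (fun i => ((v i : ℕ) : M))) =
      ((t.realize (Sum.elim default v) : ℕ) : M) := by
  induction t with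
  | var i =>
    rcases i with i | i
    · exact i.elim
    · rfl
  | @func l f ts ih =>
    match l, f, ts, ih with
    | 0, f, ts, ih =>
      change Structure.funMap _ _ = _
      have : (fun i : Fin 0 => (ts i).realize (Sum.elim default (fun i => ((v i : ℕ) : M)))) = ![] :=
        Subsingleton.elim _ _
      rw [this]
      exact Nat.cast_zero.symm
    | 1, f, ts, ih =>
      change Structure.funMap _ _ = _
      have : (fun i : Fin 1 => (ts i).realize (Sum.elim default (fun i => ((v i : ℕ) : M)))) =
          ![(((ts 0).realize (Sum.elim default v) : ℕ) : M)] := by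
        funext i
        rw [Subsingleton.elim i 0]
        exact ih 0
      rw [this]
      exact (rs_eq _).trans (Nat.cast_succ _).symm
    | 2, f, ts, ih =>
      change Structure.funMap _ _ = _
      have : (fun i : Fin 2 => (ts i).realize (Sum.elim default (fun i => ((v i : ℕ) : M)))) =
          ![(((ts 0).realize (Sum.elim default v) : ℕ) : M),
            (((ts 1).realize (Sum.elim default v) : ℕ) : M)] := by
        funext i
        fin_cases i
        · exact ih 0
        · exact ih 1
      rw [this]
      match f with
      | false => exact (Nat.cast_add _ _).symm
      | true => exact (Nat.cast_mul _ _).symm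

theorem cast_snoc {m : ℕ} (v : Fin m → ℕ) (x : ℕ) :
    (fun i => (((Fin.snoc v x : Fin (m+1) → ℕ) i : ℕ) : M)) =
      (Fin.snoc (fun i => ((v i : ℕ) : M)) (x : M) : Fin (m+1) → M) := by
  funext i
  refine Fin.lastCases ?_ (fun i => ?_) i <;> simp

theorem fml_abs {m : ℕ} {φ : LA.BoundedFormula Empty m} (hφ : IsDelta0 φ) : ∀ (v : Fin m → ℕ),
    φ.Realize default (fun i => ((v i : ℕ) : M)) ↔ φ.Realize default v := by
  induction hφ with
  | falsum => exact fun v => Iff.rfl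
  | equal t u =>
    intro v
    rw [BoundedFormula.realize_bdEqual, BoundedFormula.realize_bdEqual, tm_abs, tm_abs, Nat.cast_inj]
  | le t u =>
    intro v
    rw [real_le, real_le, tm_abs, tm_abs, rle_iff, nat_rle, Nat.cast_le]
  | imp _ _ h1 h2 =>
    intro v
    rw [BoundedFormula.realize_imp, BoundedFormula.realize_imp, h1, h2]
  | ball t _ h =>
    intro v
    simp only [BoundedFormula.realize_all, BoundedFormula.realize_imp, real_le, real_v,
      relabel_cast, Fin.snoc_last, tm_abs, rle_iff, nat_rle]
    constructor
    · intro H x hx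
      have := H (x : M) (Nat.cast_le.2 hx)
      rw [← cast_snoc, h] at this
      exact this
    · intro H x hx
      obtain ⟨k, hk, rfl⟩ := le_nat _ _ hx
      rw [← cast_snoc, h]
      exact H k hk
  | bex t _ h =>
    intro v
    simp only [BoundedFormula.realize_ex, BoundedFormula.realize_inf, real_le, real_v,
      relabel_cast, Fin.snoc_last, tm_abs, rle_iff, nat_rle]
    constructor
    · rintro ⟨x, hx, H⟩
      obtain ⟨k, hk, rfl⟩ := le_nat _ _ hx
      rw [← cast_snoc, h] at H
      exact ⟨k, hk, H⟩
    · rintro ⟨x, hx, H⟩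
      refine ⟨(x : M), Nat.cast_le.2 hx, ?_⟩
      rw [← cast_snoc, h]
      exact H

theorem D0.abs {m : ℕ} {P : Pd m} (h : D0 P) (v : Fin m → ℕ) :
    P M (fun i => ((v i : ℕ) : M)) ↔ P NatM v := by
  obtain ⟨φ, d, h⟩ := h
  have h2 := h NatM v
  have h1 := h M (fun i => ((v i : ℕ) : M))
  rw [← h1, ← h2]
  have h3 := fml_abs (M := M) d v
  rw [h3]
  have e : (default : Empty → ℕ) = (@default (Empty → NatM) Unique.instInhabited) := funext fun x => x.elim
  rw [e]
  rfl
end abs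

/-! ### Pairing -/
section pairing
variable {M : PAM}
noncomputable def J (a b : M) : M := (a + b) * (a + b) + a
theorem IsTm.J {m : ℕ} {f g : Fu m} (hf : IsTm f) (hg : IsTm g) :
    IsTm (fun M v => Guaspari.J (f M v) (g M v)) := by
  unfold Guaspari.J
  apply_rules [IsTm.add, IsTm.mul]
theorem J_aux {a b c d : M} (h : a + b < c + d) : J a b < J c d := by
  rw [lt_iff_succ] at h
  unfold J
  have h2 : (a + b + 1) * (a + b + 1) ≤ (c + d) * (c + d) := mul_le_mul' h h
  have e : (a + b + 1) * (a + b + 1) = (a + b) * (a + b) + a + (a + b + b + 1) := by ring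
  rw [lt_iff_succ]
  calc (a + b) * (a + b) + a + 1 ≤ (a + b) * (a + b) + a + (a + b + b + 1) := by
        gcongr; exact le_add_self
    _ = (a + b + 1) * (a + b + 1) := e.symm
    _ ≤ (c + d) * (c + d) := h2
    _ ≤ _ := le_self_add
theorem J_inj {a b c d : M} (h : J a b = J c d) : a = c ∧ b = d := by
  have h1 : a + b = c + d := by
    rcases lt_trichotomy (a + b) (c + d) with h' | h' | h'
    · exact absurd h (J_aux h').ne
    · exact h'
    · exact absurd h (J_aux h').ne'
  have h2 : a = c := by
    unfold J at h
    rw [h1] at h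
    exact add_left_cancel h
  subst h2
  exact ⟨rfl, add_left_cancel h1⟩
theorem J_eq {a b c d : M} : J a b = J c d ↔ a = c ∧ b = d :=
  ⟨J_inj, by rintro ⟨rfl, rfl⟩; rfl⟩
theorem le_J_left (a b : M) : a ≤ J a b := le_add_self
theorem le_sq (a : M) : a ≤ a * a := by
  rcases zero_or_succ a with rfl | ⟨c, rfl⟩
  · simp
  · exact le_mul_of_one_le_left zero_le le_add_self
theorem le_J_right (a b : M) : b ≤ J a b :=
  le_add_self.trans ((le_sq (a + b)).trans le_self_add)
end pairing

/-! ### Finite sets -/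
section sets
variable {M : PAM}
def Mem (p q r z : M) : Prop := z ≤ r ∧ ∃ u, u ≤ p ∧ (1 + (z + 1) * q) * u = p
theorem Mem_d0 : D0 (m := 4) (fun M v => Mem (v 0) (v 1) (v 2) (v 3)) := by
  unfold Mem
  apply_rules [D0.and, D0.le, IsTm.var, D0.bex, D0.eq, IsTm.mul, IsTm.add, IsTm.one]
theorem Mem_iff (p q r z : M) : Mem p q r z ↔ z ≤ r ∧ (1 + (z + 1) * q) ∣ p := by
  constructor
  · rintro ⟨h, u, -, h2⟩
    exact ⟨h, u, h2.symm⟩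
  · rintro ⟨h, u, h2⟩
    exact ⟨h, u, by rw [h2]; exact le_mul_of_one_le_left zero_le le_self_add, h2.symm⟩

def Cop (a p : M) : Prop := ∃ u v : M, p * v = a * u + 1
theorem Cop.mul {a p p' : M} (h : Cop a p) (h' : Cop a p') : Cop a (p * p') := by
  obtain ⟨u, v, h⟩ := h
  obtain ⟨u', v', h'⟩ := h'
  refine ⟨u * (a * u' + 1) + u', v * v', ?_⟩
  calc p * p' * (v * v') = (p * v) * (p' * v') := by ring
    _ = _ := by rw [h, h']; ring
theorem Cop.one (a : M) : Cop a 1 := ⟨0, 1, by simp⟩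

theorem cop_lt {q b x y : M} (hq : 0 < q) (hd : ∀ i, i ≤ b → 1 ≤ i → ∃ c, q = i * c)
    (hy : y ≤ b) (h : x < y) :
    Cop (1 + (x + 1) * q) (1 + (y + 1) * q) := by
  obtain ⟨e, rfl⟩ := (le_iff _ _).1 h.le
  obtain ⟨r, hr⟩ := hd e (le_self_add.trans hy) (by
    rcases zero_or_succ e with rfl | ⟨e, rfl⟩
    · simp at h
    · exact le_add_self)
  obtain h0 | ⟨u, hu⟩ := zero_or_succ ((x + 1) * (e + x + 1) * r)
  · exfalso
    rcases mul_eq_zero.1 h0 with h0 | h0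
    · exact absurd h0 (by positivity)
    · rw [hr, h0, mul_zero] at hq; exact lt_irrefl _ hq
  refine ⟨u, (x + 1) * (x + 1) * r, ?_⟩
  apply add_right_cancel (b := (1 + (x + 1) * q))
  calc (1 + (e + x + 1) * q) * ((x + 1) * (x + 1) * r) + (1 + (x + 1) * q)
      = (1 + (x + 1) * q) * ((x + 1) * (e + x + 1) * r) + 1 := by rw [hr]; ring
    _ = _ := by rw [hu]; ring
theorem cop_gt {q b x y : M} (hq : 0 < q) (hd : ∀ i, i ≤ b → 1 ≤ i → ∃ c, q = i * c)
    (hx : x ≤ b) (h : y < x) :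
    Cop (1 + (x + 1) * q) (1 + (y + 1) * q) := by
  obtain ⟨e, rfl⟩ := (le_iff _ _).1 h.le
  obtain ⟨r, hr⟩ := hd e (le_self_add.trans hx) (by
    rcases zero_or_succ e with rfl | ⟨e, rfl⟩
    · simp at h
    · exact le_add_self)
  obtain h0 | ⟨c, hc⟩ := zero_or_succ ((e + y + 1) * q)
  · exfalso
    rcases mul_eq_zero.1 h0 with h0 | h0
    · exact absurd h0 (by positivity)
    · rw [h0] at hq; exact lt_irrefl _ hq
  refine ⟨(y + 1) * (e + y + 1) * r * (c + 1) + c, (e + y + 1) * (e + y + 1) * r * (c + 1), ?_⟩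
  have key : (1 + (y + 1) * q) * ((e + y + 1) * (e + y + 1) * r) =
      (1 + (e + y + 1) * q) * ((y + 1) * (e + y + 1) * r) + (e + y + 1) * q := by
    rw [hr]; ring
  calc (1 + (y + 1) * q) * ((e + y + 1) * (e + y + 1) * r * (c + 1))
      = ((1 + (y + 1) * q) * ((e + y + 1) * (e + y + 1) * r)) * (c + 1) := by ring
    _ = ((1 + (e + y + 1) * q) * ((y + 1) * (e + y + 1) * r) + (e + y + 1) * q) * (c + 1) := by rw [key]
    _ = _ := by rw [hc]; ring
theorem exists_q (b : M) : ∃ q : M, 0 < q ∧ ∀ i, i ≤ b → 1 ≤ i → ∃ c, q = i * c := by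
  refine ind (k := 0) (P := fun M _ b => ∃ q : M, 0 < q ∧ ∀ i, i ≤ b → 1 ≤ i → ∃ c, q = i * c)
    ?_ ![] ?_ ?_ b
  · repeat' with_reducible (first | apply IsTm.var | apply IsTm.zero | apply IsTm.one | apply IsTm.mul | apply IsTm.add | apply Df.lt | apply Df.le | apply Df.eq | apply Df.ex | apply Df.and | apply Df.not | apply Df.all | apply Df.imp)
  · exact ⟨1, zero_lt_one, fun i h1 h2 => absurd (h2.trans h1) (by simp)⟩
  · rintro b ⟨q, hq, h⟩
    refine ⟨q * (b + 1), by positivity, fun i h1 h2 => ?_⟩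
    rcases (le_succ_iff _ _).1 h1 with h1 | rfl
    · obtain ⟨c, hc⟩ := h i h1 h2
      exact ⟨c * (b + 1), by rw [hc]; ring⟩
    · exact ⟨q, mul_comm _ _⟩

theorem compr {k : ℕ} {R : ∀ M : PAM, (Fin k → M) → M → Prop}
    (h : Df (m := k + 1) (fun M w => R M (fun i => w i.castSucc) (w (Fin.last k))))
    (v : Fin k → M) (b : M) : ∃ p q r : M, ∀ z, Mem p q r z ↔ z ≤ b ∧ R M v z := by
  have hR : ∀ {l : ℕ} (σ : Fin k → Fin l) {z : Fu l}, IsTm z →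
      Df (fun M w => R M (fun i => w (σ i)) (z M w)) := by
    intro l σ z hz
    have := h.sub (f := Fin.snoc (α := fun _ => Fu l) (fun i _ w => w (σ i)) z) (fun i => by
      refine Fin.lastCases ?_ (fun i => ?_) i
      · simpa using hz
      · simpa using IsTm.var _)
    simpa using this
  obtain ⟨q, hq, hd⟩ := exists_q b
  have main : ∀ x : M, x ≤ b + 1 → ∃ p : M,
      (∀ z, z < x → R M v z → ∃ c, p = (1 + (z + 1) * q) * c) ∧
      (∀ z, z ≤ b → ¬ (z < x ∧ R M v z) → ∃ u w : M, p * w = (1 + (z + 1) * q) * u + 1) := by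
    intro x
    have := ind (k := k + 2) (P := fun M w x => x ≤ w (Fin.last _) + 1 → ∃ p : M,
      (∀ z, z < x → R M (fun i => w (i.castSucc.castSucc)) z →
        ∃ c, p = (1 + (z + 1) * w ((Fin.last k).castSucc)) * c) ∧
      (∀ z, z ≤ w (Fin.last _) → ¬ (z < x ∧ R M (fun i => w (i.castSucc.castSucc)) z) →
        ∃ u t : M, p * t = (1 + (z + 1) * w ((Fin.last k).castSucc)) * u + 1))
      (by repeat' with_reducible (first | apply IsTm.var | apply IsTm.zero | apply IsTm.one | apply IsTm.mul | apply IsTm.add | apply Df.lt | apply Df.le | apply Df.eq | apply Df.ex | apply Df.and | apply Df.not | apply Df.all | apply Df.imp | refine hR (fun i => i.castSucc.castSucc.castSucc.castSucc.castSucc) (IsTm.var _)))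
      (Fin.snoc (Fin.snoc v q : Fin (k+1) → M) b : Fin (k+2) → M)
    simp only [Fin.snoc_castSucc, Fin.snoc_last] at this
    apply this
    · intro _
      refine ⟨1, fun z hz => absurd hz (by simp), fun z _ _ => Cop.one _⟩
    · intro x ih hx
      have hxb : x ≤ b := (add_le_add_iff_right 1).1 hx
      obtain ⟨p, h1, h2⟩ := ih (hxb.trans le_self_add)
      by_cases hRx : R M v x
      · refine ⟨p * (1 + (x + 1) * q), ?_, ?_⟩
        · intro z hz hRz
          rcases (lt_or_eq_of_le ((lt_succ_iff _ _).1 hz)) with hz | rfl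
          · obtain ⟨c, hc⟩ := h1 z hz hRz
            exact ⟨c * (1 + (x + 1) * q), by rw [hc]; ring⟩
          · exact ⟨p, mul_comm _ _⟩
        · intro z hz hn
          have hzx : z ≠ x := by
            rintro rfl
            exact hn ⟨lt_add_one _, hRx⟩
          refine Cop.mul (h2 z hz fun hh => hn ⟨hh.1.trans (lt_add_one _), hh.2⟩) ?_
          rcases lt_or_gt_of_ne hzx with hlt | hlt
          · exact cop_lt hq hd hxb hlt
          · exact cop_gt hq hd hz hlt
      · refine ⟨p, ?_, ?_⟩
        · intro z hz hRz
          rcases (lt_or_eq_of_le ((lt_succ_iff _ _).1 hz)) with hz | rfl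
          · exact h1 z hz hRz
          · exact absurd hRz hRx
        · intro z hz hn
          exact h2 z hz fun hh => hn ⟨hh.1.trans (lt_add_one _), hh.2⟩
  obtain ⟨p, h1, h2⟩ := main (b + 1) le_rfl
  refine ⟨p, q, b, fun z => ?_⟩
  rw [Mem_iff]
  refine and_congr_right fun hz => ⟨?_, fun hRz => h1 z ((lt_succ_iff _ _).2 hz) hRz⟩
  rintro ⟨c, hc⟩
  by_contra hRz
  obtain ⟨u, w, hu⟩ := h2 z hz fun hh => hRz hh.2
  have hdv : (1 + (z + 1) * q) ∣ 1 := by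
    have h3 : (1 + (z + 1) * q) ∣ (1 + (z + 1) * q) * u + 1 := ⟨c * w, by rw [← hu, hc]; ring⟩
    obtain ⟨t, ht⟩ := h3
    have hle : u ≤ t := by
      by_contra hlt
      have : t ≤ u := (not_le.1 hlt).le
      have h4 : (1 + (z + 1) * q) * t ≤ (1 + (z + 1) * q) * u := mul_le_mul_right this _
      rw [← ht, ← lt_iff_succ] at h4
      exact lt_irrefl _ h4
    obtain ⟨s, rfl⟩ := (le_iff _ _).1 hle
    refine ⟨s, add_left_cancel (a := (1 + (z + 1) * q) * u) ?_⟩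
    rw [ht]; ring
  obtain ⟨t, ht⟩ := hdv
  rcases zero_or_succ t with rfl | ⟨t, rfl⟩
  · simp at ht
  · have : (1 : M) < (1 + (z + 1) * q) * (t + 1) := by
      calc (1 : M) < 1 + (z + 1) * q := lt_add_of_pos_right _ (by positivity)
        _ ≤ _ := le_mul_of_one_le_right zero_le le_add_self
    exact this.ne ht
end sets
end Guaspari

open FirstOrder Language
open scoped FirstOrder
namespace Guaspari
set_option linter.all false

/-! ### Codes of relations -/
section codes
variable {M : PAM}

def Base (i a y : M) : Prop :=
  (i = 0 ∧ y = 0) ∨ (i = 1 ∧ y = a + 1) ∨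
  (i = 2 ∧ ∃ u ≤ a, a = J y u) ∨ (i = 3 ∧ ∃ u ≤ a, a = J u y) ∨
  (i = 4 ∧ ∃ u ≤ a, ∃ v ≤ a, a = J u v ∧ y = u + v) ∨
  (i = 5 ∧ ∃ u ≤ a, ∃ v ≤ a, a = J u v ∧ y = u * v) ∨
  (i = 6 ∧ ∃ u ≤ a, ∃ v ≤ a, a = J u v ∧ u ≤ v ∧ y = 0) ∨
  (i = 7 ∧ ∃ u ≤ a, ∃ v ≤ a, a = J u v ∧ u < v ∧ y = 0) ∨
  (i = 8) ∨ (i = 9 ∧ y = a)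

theorem Base_d0 : D0 (m := 3) (fun M v => Base (v 0) (v 1) (v 2)) := by
  unfold Base
  repeat' with_reducible (first | apply IsTm.var | apply IsTm.zero | apply IsTm.one | apply IsTm.ofNat | apply IsTm.mul | apply IsTm.add | apply IsTm.J | apply D0.lt | apply D0.le | apply D0.eq | apply D0.bex | apply D0.or | apply D0.and)

inductive Cd
  | base (i : ℕ) | comp (r s : Cd) | fork (r s : Cd) | union (r s : Cd) | ball (r : Cd)

def Rel : Cd → M → M → Prop
  | .base i, a, y => Base (i : M) a y
  | .comp r s, a, y => ∃ w, Rel r a w ∧ Rel s w y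
  | .fork r s, a, y => ∃ u v, y = J u v ∧ Rel r a u ∧ Rel s a v
  | .union r s, a, y => Rel r a y ∨ Rel s a y
  | .ball r, a, y => y = 0 ∧ ∃ c b, a = J c b ∧ ∀ x ≤ b, Rel r (J c x) 0

def jn (a b : ℕ) : ℕ := (a + b) * (a + b) + a
theorem jn_cast (a b : ℕ) : ((jn a b : ℕ) : M) = J (a : M) (b : M) := by
  unfold jn J; push_cast; rfl
def cde : Cd → ℕ
  | .base i => jn 0 i
  | .comp r s => jn 1 (jn (cde r) (cde s))
  | .fork r s => jn 2 (jn (cde r) (cde s))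
  | .union r s => jn 3 (jn (cde r) (cde s))
  | .ball r => jn 4 (cde r)

/-- one justification step -/
def JS (X : M → Prop) (e a y : M) : Prop :=
  (∃ i, e = J 0 i ∧ Base i a y) ∨
  (∃ r s, e = J 1 (J r s) ∧ ∃ w, X (J (J r a) w) ∧ X (J (J s w) y)) ∨
  (∃ r s, e = J 2 (J r s) ∧ ∃ u v, y = J u v ∧ X (J (J r a) u) ∧ X (J (J s a) v)) ∨
  (∃ r s, e = J 3 (J r s) ∧ (X (J (J r a) y) ∨ X (J (J s a) y))) ∨
  (∃ r, e = J 4 r ∧ y = 0 ∧ ∃ c b, a = J c b ∧ ∀ x ≤ b, X (J (J r (J c x)) 0))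

theorem JS.mono {X Y : M → Prop} (h : ∀ z, X z → Y z) {e a y : M} : JS X e a y → JS Y e a y := by
  rintro (h1 | ⟨r, s, h1, w, h2, h3⟩ | ⟨r, s, h1, u, v, h2, h3, h4⟩ | ⟨r, s, h1, h2 | h2⟩ |
    ⟨r, h1, h2, c, b, h3, h4⟩)
  · exact Or.inl h1
  · exact Or.inr (Or.inl ⟨r, s, h1, w, h _ h2, h _ h3⟩)
  · exact Or.inr (Or.inr (Or.inl ⟨r, s, h1, u, v, h2, h _ h3, h _ h4⟩))
  · exact Or.inr (Or.inr (Or.inr (Or.inl ⟨r, s, h1, Or.inl (h _ h2)⟩)))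
  · exact Or.inr (Or.inr (Or.inr (Or.inl ⟨r, s, h1, Or.inr (h _ h2)⟩)))
  · exact Or.inr (Or.inr (Or.inr (Or.inr ⟨r, h1, h2, c, b, h3, fun x hx => h _ (h4 x hx)⟩)))

def JD (p q l e a y : M) : Prop :=
  (∃ i ≤ e, e = J 0 i ∧ Base i a y) ∨
  (∃ r ≤ e, ∃ s ≤ e, e = J 1 (J r s) ∧ ∃ w ≤ l, Mem p q l (J (J r a) w) ∧ Mem p q l (J (J s w) y)) ∨
  (∃ r ≤ e, ∃ s ≤ e, e = J 2 (J r s) ∧ ∃ u ≤ y, ∃ v ≤ y, y = J u v ∧ Mem p q l (J (J r a) u) ∧ Mem p q l (J (J s a) v)) ∨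
  (∃ r ≤ e, ∃ s ≤ e, e = J 3 (J r s) ∧ (Mem p q l (J (J r a) y) ∨ Mem p q l (J (J s a) y))) ∨
  (∃ r ≤ e, e = J 4 r ∧ y = 0 ∧ ∃ c ≤ a, ∃ b ≤ a, a = J c b ∧ ∀ x ≤ b, Mem p q l (J (J r (J c x)) 0))

theorem JD_d0 : D0 (m := 6) (fun M v => JD (v 0) (v 1) (v 2) (v 3) (v 4) (v 5)) := by
  unfold JD
  repeat' with_reducible (first | apply IsTm.var | apply IsTm.zero | apply IsTm.one | apply IsTm.ofNat | apply IsTm.mul | apply IsTm.add | apply IsTm.J | apply D0.lt | apply D0.le | apply D0.eq | apply D0.bex | apply D0.ball | apply D0.or | apply D0.and | apply Mem_d0.s4 | apply Base_d0.s3)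

theorem Mem_le {p q r z : M} (h : Mem p q r z) : z ≤ r := h.1

theorem JD_iff (p q l e a y : M) : JD p q l e a y ↔ JS (Mem p q l) e a y := by
  unfold JD JS
  refine or_congr ?_ (or_congr ?_ (or_congr ?_ (or_congr ?_ ?_)))
  · constructor
    · rintro ⟨i, -, h⟩; exact ⟨i, h⟩
    · rintro ⟨i, h1, h⟩; exact ⟨i, h1 ▸ le_J_right _ _, h1, h⟩
  · constructor
    · rintro ⟨r, -, s, -, h, w, -, h'⟩; exact ⟨r, s, h, w, h'⟩
    · rintro ⟨r, s, h, w, h'⟩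
      refine ⟨r, ?_, s, ?_, h, w, (le_J_right _ _).trans (Mem_le h'.1), h'⟩ <;> rw [h]
      · exact (le_J_left _ _).trans (le_J_right _ _)
      · exact (le_J_right _ _).trans (le_J_right _ _)
  · constructor
    · rintro ⟨r, -, s, -, h, u, -, v, -, h'⟩; exact ⟨r, s, h, u, v, h'⟩
    · rintro ⟨r, s, h, u, v, h', h''⟩
      refine ⟨r, ?_, s, ?_, h, u, h' ▸ le_J_left _ _, v, h' ▸ le_J_right _ _, h', h''⟩ <;> rw [h]
      · exact (le_J_left _ _).trans (le_J_right _ _)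
      · exact (le_J_right _ _).trans (le_J_right _ _)
  · constructor
    · rintro ⟨r, -, s, -, h⟩; exact ⟨r, s, h⟩
    · rintro ⟨r, s, h, h'⟩
      refine ⟨r, ?_, s, ?_, h, h'⟩ <;> rw [h]
      · exact (le_J_left _ _).trans (le_J_right _ _)
      · exact (le_J_right _ _).trans (le_J_right _ _)
  · constructor
    · rintro ⟨r, -, h, h1, c, -, b, -, h2⟩; exact ⟨r, h, h1, c, b, h2⟩
    · rintro ⟨r, h, h1, c, b, h2, h3⟩
      exact ⟨r, h ▸ le_J_right _ _, h, h1, c, h2 ▸ le_J_left _ _, b, h2 ▸ le_J_right _ _, h2, h3⟩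

def Cert (p q l : M) : Prop :=
  ∀ z ≤ l, Mem p q l z → ∃ e ≤ z, ∃ a ≤ z, ∃ y ≤ z, z = J (J e a) y ∧ JD p q l e a y
theorem Cert_d0 : D0 (m := 3) (fun M v => Cert (v 0) (v 1) (v 2)) := by
  unfold Cert
  repeat' with_reducible (first | apply IsTm.var | apply IsTm.J | apply D0.le | apply D0.eq | apply D0.bex | apply D0.ball | apply D0.or | apply D0.and | apply D0.imp | apply Mem_d0.s4 | apply JD_d0.s6)

def Good (X : M → Prop) : Prop := ∀ z, X z → ∃ e a y, z = J (J e a) y ∧ JS X e a y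
theorem Cert_iff (p q l : M) : Cert p q l ↔ Good (Mem p q l) := by
  constructor
  · intro h z hz
    obtain ⟨e, -, a, -, y, -, h1, h2⟩ := h z (Mem_le hz) hz
    exact ⟨e, a, y, h1, (JD_iff _ _ _ _ _ _).1 h2⟩
  · intro h z _ hz
    obtain ⟨e, a, y, rfl, h2⟩ := h z hz
    exact ⟨e, (le_J_left _ _).trans (le_J_left _ _), a, (le_J_right _ _).trans (le_J_left _ _), y,
      le_J_right _ _, rfl, (JD_iff _ _ _ _ _ _).2 h2⟩

theorem JS_base {X : M → Prop} {i a y : M} : JS X (J 0 i) a y ↔ Base i a y := by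
  simp [JS, J_eq]
theorem JS_comp {X : M → Prop} {r s a y : M} : JS X (J 1 (J r s)) a y ↔
    ∃ w, X (J (J r a) w) ∧ X (J (J s w) y) := by
  simp only [JS, J_eq]
  norm_num
  constructor
  · rintro ⟨r', s', ⟨rfl, rfl⟩, h⟩; exact h
  · intro h; exact ⟨r, s, ⟨rfl, rfl⟩, h⟩
theorem JS_fork {X : M → Prop} {r s a y : M} : JS X (J 2 (J r s)) a y ↔
    ∃ u v, y = J u v ∧ X (J (J r a) u) ∧ X (J (J s a) v) := by
  simp only [JS, J_eq]
  norm_num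
  constructor
  · rintro ⟨r', s', ⟨rfl, rfl⟩, h⟩; exact h
  · intro h; exact ⟨r, s, ⟨rfl, rfl⟩, h⟩
theorem JS_union {X : M → Prop} {r s a y : M} : JS X (J 3 (J r s)) a y ↔
    (X (J (J r a) y) ∨ X (J (J s a) y)) := by
  simp only [JS, J_eq]
  norm_num
  constructor
  · rintro ⟨r', s', ⟨rfl, rfl⟩, h⟩; exact h
  · intro h; exact ⟨r, s, ⟨rfl, rfl⟩, h⟩
theorem JS_ball {X : M → Prop} {r a y : M} : JS X (J 4 r) a y ↔
    y = 0 ∧ ∃ c b, a = J c b ∧ ∀ x ≤ b, X (J (J r (J c x)) 0) := by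
  simp only [JS, J_eq]
  norm_num

theorem Good.js {X : M → Prop} (h : Good X) {e a y : M} (hx : X (J (J e a) y)) : JS X e a y := by
  obtain ⟨e', a', y', h1, h2⟩ := h _ hx
  obtain ⟨h3, rfl⟩ := J_inj h1
  obtain ⟨rfl, rfl⟩ := J_inj h3
  exact h2

theorem sound {X : M → Prop} (hX : Good X) (c : Cd) : ∀ a y : M,
    X (J (J (cde c : M) a) y) → Rel c a y := by
  induction c with
  | base i =>
    intro a y h
    have := hX.js h
    simp only [cde, jn_cast, Nat.cast_zero, JS_base] at this
    exact this
  | comp r s h1 h2 =>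
    intro a y h
    have := hX.js h
    simp only [cde, jn_cast, Nat.cast_one, JS_comp] at this
    obtain ⟨w, h3, h4⟩ := this
    exact ⟨w, h1 _ _ h3, h2 _ _ h4⟩
  | fork r s h1 h2 =>
    intro a y h
    have := hX.js h
    simp only [cde, jn_cast, Nat.cast_ofNat, JS_fork] at this
    obtain ⟨u, v, h5, h3, h4⟩ := this
    exact ⟨u, v, h5, h1 _ _ h3, h2 _ _ h4⟩
  | union r s h1 h2 =>
    intro a y h
    have := hX.js h
    simp only [cde, jn_cast, Nat.cast_ofNat, JS_union] at this
    exact this.imp (h1 _ _) (h2 _ _)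
  | ball r h1 =>
    intro a y h
    have := hX.js h
    simp only [cde, jn_cast, Nat.cast_ofNat, JS_ball] at this
    obtain ⟨h0, c, b, h2, h3⟩ := this
    exact ⟨h0, c, b, h2, fun x hx => h1 _ _ (h3 x hx)⟩

/-- set operations -/
theorem ins (p q l p' q' l' z0 : M) : ∃ P Q L : M, ∀ z, Mem P Q L z ↔ Mem p q l z ∨ Mem p' q' l' z ∨ z = z0 := by
  have hd : Df (m := 8) (fun M v => Mem (v 0) (v 1) (v 2) (v 7) ∨ Mem (v 3) (v 4) (v 5) (v 7) ∨ v 7 = v 6) := by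
    apply D0.toDf
    repeat' with_reducible (first | apply IsTm.var | apply D0.eq | apply D0.or | apply Mem_d0.s4)
  obtain ⟨P, Q, L, h⟩ := compr (M := M) (k := 7) (R := fun M v z => Mem (v 0) (v 1) (v 2) z ∨ Mem (v 3) (v 4) (v 5) z ∨ z = v 6)
    hd ![p, q, l, p', q', l', z0] (l + l' + z0)
  refine ⟨P, Q, L, fun z => (h z).trans ?_⟩
  change z ≤ _ ∧ (Mem p q l z ∨ Mem p' q' l' z ∨ z = z0) ↔ _
  refine ⟨fun h => h.2, fun h => ⟨?_, h⟩⟩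
  rcases h with h | h | rfl
  · exact (Mem_le h).trans (le_self_add.trans le_self_add)
  · exact (Mem_le h).trans (le_add_self.trans le_self_add)
  · exact le_add_self

theorem emp : ∃ P Q L : M, ∀ z, ¬ Mem P Q L z := by
  obtain ⟨P, Q, L, h⟩ := compr (M := M) (k := 0) (R := fun M v z => False) Df.falsum ![] 0
  exact ⟨P, Q, L, fun z hz => ((h z).1 hz).2⟩

def Has (z : M) : Prop := ∃ p q l, Cert p q l ∧ Mem p q l z

theorem step {p q l p' q' l' e a y : M} (h : Cert p q l) (h' : Cert p' q' l')
    (hs : JS (fun z => Mem p q l z ∨ Mem p' q' l' z) e a y) :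
    ∃ P Q L : M, Cert P Q L ∧ (∀ z, Mem P Q L z ↔ Mem p q l z ∨ Mem p' q' l' z ∨ z = J (J e a) y) := by
  obtain ⟨P, Q, L, hP⟩ := ins p q l p' q' l' (J (J e a) y)
  refine ⟨P, Q, L, (Cert_iff _ _ _).2 ?_, hP⟩
  rw [Cert_iff] at h h'
  intro z hz
  rcases (hP z).1 hz with hz | hz | rfl
  · obtain ⟨e, a, y, h1, h2⟩ := h z hz
    exact ⟨e, a, y, h1, h2.mono fun z hz => (hP z).2 (Or.inl hz)⟩
  · obtain ⟨e, a, y, h1, h2⟩ := h' z hz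
    exact ⟨e, a, y, h1, h2.mono fun z hz => (hP z).2 (Or.inr (Or.inl hz))⟩
  · exact ⟨e, a, y, rfl, hs.mono fun z hz => (hP z).2 (hz.imp id Or.inl)⟩

theorem Has.step {p q l p' q' l' e a y : M} (h : Cert p q l) (h' : Cert p' q' l')
    (hs : JS (fun z => Mem p q l z ∨ Mem p' q' l' z) e a y) : Has (J (J e a) y) := by
  obtain ⟨P, Q, L, h1, h2⟩ := Guaspari.step h h' hs
  exact ⟨P, Q, L, h1, (h2 _).2 (Or.inr (Or.inr rfl))⟩

theorem cert_emp : ∃ p q l : M, Cert p q l := by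
  obtain ⟨P, Q, L, h⟩ := emp (M := M)
  exact ⟨P, Q, L, fun z _ hz => absurd hz (h z)⟩

theorem has_ball (r c b : M) (h : ∀ x ≤ b, Has (J (J r (J c x)) 0)) :
    ∃ p q l : M, Cert p q l ∧ ∀ x ≤ b, Mem p q l (J (J r (J c x)) 0) := by
  have key : ∀ x : M, x ≤ b → ∃ p q l : M, Cert p q l ∧ ∀ t ≤ x, Mem p q l (J (J r (J c t)) 0) := by
    refine ind (k := 3) (P := fun M v x => x ≤ v 2 → ∃ p q l : M, Cert p q l ∧
      ∀ t, t ≤ x → Mem p q l (J (J (v 0) (J (v 1) t)) 0)) ?_ ![r, c, b] ?_ ?_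
    · repeat' with_reducible (first | apply IsTm.var | apply IsTm.zero | apply IsTm.J | apply Df.le | apply Df.ex | apply Df.and | apply Df.all | apply Df.imp | apply Cert_d0.toDf.s3 | apply Mem_d0.toDf.s4)
    · intro _
      obtain ⟨p, q, l, h1, h2⟩ := h 0 zero_le
      refine ⟨p, q, l, h1, fun t ht => ?_⟩
      obtain rfl : t = 0 := le_antisymm ht zero_le
      exact h2
    · intro x ih hx
      change x + 1 ≤ b at hx
      obtain ⟨p, q, l, h1, h2⟩ := ih (le_self_add.trans hx)
      obtain ⟨p', q', l', h1', h2'⟩ := h _ hx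
      obtain ⟨P, Q, L, h3, h4⟩ := step h1 h1' ((((Cert_iff _ _ _).1 h1').js h2').mono fun z hz => Or.inr hz)
      refine ⟨P, Q, L, h3, fun t ht => ?_⟩
      rcases (le_succ_iff _ _).1 ht with ht | rfl
      · exact (h4 _).2 (Or.inl (h2 t ht))
      · exact (h4 _).2 (Or.inr (Or.inl h2'))
  exact key b le_rfl

theorem complete (c : Cd) : ∀ a y : M, Rel c a y → Has (J (J (cde c : M) a) y) := by
  induction c with
  | base i =>
    intro a y h
    obtain ⟨p, q, l, h0⟩ := cert_emp (M := M)
    refine Has.step h0 h0 ?_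
    simp only [cde, jn_cast, Nat.cast_zero, JS_base]
    exact h
  | comp r s h1 h2 =>
    rintro a y ⟨w, h3, h4⟩
    obtain ⟨p, q, l, h5, h6⟩ := h1 _ _ h3
    obtain ⟨p', q', l', h5', h6'⟩ := h2 _ _ h4
    refine Has.step h5 h5' ?_
    simp only [cde, jn_cast, Nat.cast_one, JS_comp]
    exact ⟨w, Or.inl h6, Or.inr h6'⟩
  | fork r s h1 h2 =>
    rintro a y ⟨u, v, h0, h3, h4⟩
    obtain ⟨p, q, l, h5, h6⟩ := h1 _ _ h3
    obtain ⟨p', q', l', h5', h6'⟩ := h2 _ _ h4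
    refine Has.step h5 h5' ?_
    simp only [cde, jn_cast, Nat.cast_ofNat, JS_fork]
    exact ⟨u, v, h0, Or.inl h6, Or.inr h6'⟩
  | union r s h1 h2 =>
    rintro a y (h | h)
    · obtain ⟨p, q, l, h5, h6⟩ := h1 _ _ h
      refine Has.step h5 h5 ?_
      simp only [cde, jn_cast, Nat.cast_ofNat, JS_union]
      exact Or.inl (Or.inl h6)
    · obtain ⟨p, q, l, h5, h6⟩ := h2 _ _ h
      refine Has.step h5 h5 ?_
      simp only [cde, jn_cast, Nat.cast_ofNat, JS_union]
      exact Or.inr (Or.inl h6)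
  | ball r h1 =>
    rintro a y ⟨h0, c, b, h2, h3⟩
    obtain ⟨p, q, l, h5, h6⟩ := has_ball (M := M) (cde r) c b (fun x hx => h1 _ _ (h3 x hx))
    refine Has.step h5 h5 ?_
    simp only [cde, jn_cast, Nat.cast_ofNat, JS_ball]
    exact ⟨h0, c, b, h2, fun x hx => Or.inl (h6 x hx)⟩

theorem has_iff (c : Cd) (a y : M) : Has (J (J (cde c : M) a) y) ↔ Rel c a y := by
  refine ⟨?_, complete c a y⟩
  rintro ⟨p, q, l, h1, h2⟩
  exact sound ((Cert_iff _ _ _).1 h1) c a y h2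
end codes
end Guaspari

open FirstOrder Language
open scoped FirstOrder
namespace Guaspari
set_option linter.all false

noncomputable def st {M : PAM} : ∀ {m : ℕ}, (Fin m → M) → M
  | 0, _ => 0
  | m + 1, v => J (st (fun i => v (Fin.castSucc i))) (v (Fin.last m))
theorem st_snoc {M : PAM} {m : ℕ} (v : Fin m → M) (x : M) :
    st (Fin.snoc v x : Fin (m+1) → M) = J (st v) x := by
  simp [st]
theorem IsTm.wk {m : ℕ} {f : Fu m} (h : IsTm f) : IsTm (m := m + 1) (fun M w => f M (fun i => w i.castSucc)) := by
  obtain ⟨t, h⟩ := h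
  refine ⟨t.relabel (Sum.map id Fin.castSucc), fun M v => ?_⟩
  rw [← snoc_self v, relabel_cast, h]
  simp
theorem IsTm.st {m : ℕ} : IsTm (m := m) (fun _ v => Guaspari.st v) := by
  induction m with
  | zero => exact IsTm.zero
  | succ m ih =>
    refine IsTm.J (f := fun M v => Guaspari.st (fun i => v (Fin.castSucc i))) ?_ (IsTm.var _)
    exact ih.wk

def TF {m : ℕ} (f : Fu m) : Prop := ∃ c, ∀ M v y, Rel (M := M) c (st v) y ↔ y = f M v
def TP {m : ℕ} (P : Pd m) : Prop := ∃ c, ∀ M v y, Rel (M := M) c (st v) y ↔ y = 0 ∧ P M v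

section base
variable {M : PAM} (a y : M)
theorem rel0 : Rel (.base 0) a y ↔ y = 0 := by simp [Rel, Base]
theorem rel1 : Rel (.base 1) a y ↔ y = a + 1 := by simp [Rel, Base]
theorem rel2 (u v : M) : Rel (.base 2) (J u v) y ↔ y = u := by
  simp only [Rel, Base]
  norm_num
  simp only [J_eq]
  constructor
  · rintro ⟨w, h1, h2, h3⟩; exact h2.symm
  · rintro rfl; exact ⟨v, le_J_right _ _, rfl, rfl⟩
theorem rel3 (u v : M) : Rel (.base 3) (J u v) y ↔ y = v := by
  simp only [Rel, Base]
  norm_num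
  simp only [J_eq]
  constructor
  · rintro ⟨w, h1, h2, h3⟩; exact h3.symm
  · rintro rfl; exact ⟨u, le_J_left _ _, rfl, rfl⟩
theorem rel4 (u v : M) : Rel (.base 4) (J u v) y ↔ y = u + v := by
  simp only [Rel, Base]
  norm_num
  simp only [J_eq]
  constructor
  · rintro ⟨u', h1, v', h2, ⟨rfl, rfl⟩, h3⟩; exact h3
  · rintro rfl; exact ⟨u, le_J_left _ _, v, le_J_right _ _, ⟨rfl, rfl⟩, rfl⟩
theorem rel5 (u v : M) : Rel (.base 5) (J u v) y ↔ y = u * v := by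
  simp only [Rel, Base]
  norm_num
  simp only [J_eq]
  constructor
  · rintro ⟨u', h1, v', h2, ⟨rfl, rfl⟩, h3⟩; exact h3
  · rintro rfl; exact ⟨u, le_J_left _ _, v, le_J_right _ _, ⟨rfl, rfl⟩, rfl⟩
theorem rel6 (u v : M) : Rel (.base 6) (J u v) y ↔ y = 0 ∧ u ≤ v := by
  simp only [Rel, Base]
  norm_num
  simp only [J_eq]
  constructor
  · rintro ⟨u', h1, v', h2, ⟨rfl, rfl⟩, h3⟩; exact ⟨h3.2, h3.1⟩
  · rintro ⟨h1, h2⟩; exact ⟨u, le_J_left _ _, v, le_J_right _ _, ⟨rfl, rfl⟩, h2, h1⟩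
theorem rel7 (u v : M) : Rel (.base 7) (J u v) y ↔ y = 0 ∧ u < v := by
  simp only [Rel, Base]
  norm_num
  simp only [J_eq]
  constructor
  · rintro ⟨u', h1, v', h2, ⟨rfl, rfl⟩, h3⟩; exact ⟨h3.2, h3.1⟩
  · rintro ⟨h1, h2⟩; exact ⟨u, le_J_left _ _, v, le_J_right _ _, ⟨rfl, rfl⟩, h2, h1⟩
theorem rel8 : Rel (.base 8) a y := by simp [Rel, Base]
theorem rel9 : Rel (.base 9) a y ↔ y = a := by
  simp only [Rel, Base]
  norm_num
theorem rel10 : ¬ Rel (.base 10) a y := by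
  simp only [Rel, Base]
  norm_num
end base

section
variable {m : ℕ} {P Q : Pd m} {f g : Fu m}
theorem TF.congr (h : TF f) (e : ∀ M v, f M v = g M v) : TF g := by
  obtain ⟨c, h⟩ := h
  exact ⟨c, fun M v y => by rw [h, e]⟩
theorem TP.congr (h : TP P) (e : ∀ M v, P M v ↔ Q M v) : TP Q := by
  obtain ⟨c, h⟩ := h
  exact ⟨c, fun M v y => by rw [h, e]⟩
theorem TF.pair (hf : TF f) (hg : TF g) : ∃ c, ∀ M v y, Rel (M := M) c (st v) y ↔ y = J (f M v) (g M v) := by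
  obtain ⟨c, h⟩ := hf
  obtain ⟨d, h'⟩ := hg
  refine ⟨.fork c d, fun M v y => ?_⟩
  simp only [Rel, h, h']
  constructor
  · rintro ⟨_, _, h, rfl, rfl⟩; exact h
  · intro h; exact ⟨_, _, h, rfl, rfl⟩
theorem TF.op {o : ∀ M : PAM, M → M → M} (hf : TF f) (hg : TF g) (b : Cd)
    (hb : ∀ M u v y, Rel b (J u v) y ↔ y = o M u v) : TF (fun M v => o M (f M v) (g M v)) := by
  obtain ⟨c, h⟩ := TF.pair hf hg
  refine ⟨.comp c b, fun M v y => ?_⟩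
  simp only [Rel, h, exists_eq_left, hb]
theorem TP.op {o : ∀ M : PAM, M → M → Prop} (hf : TF f) (hg : TF g) (b : Cd)
    (hb : ∀ M u v y, Rel b (J u v) y ↔ y = 0 ∧ o M u v) : TP (fun M v => o M (f M v) (g M v)) := by
  obtain ⟨c, h⟩ := TF.pair hf hg
  refine ⟨.comp c b, fun M v y => ?_⟩
  simp only [Rel, h, exists_eq_left, hb]
theorem TF.zero : TF (m := m) (fun M v => 0) := ⟨.base 0, fun M v y => rel0 _ _⟩
theorem TF.succ (hf : TF f) : TF (fun M v => f M v + 1) := by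
  obtain ⟨c, h⟩ := hf
  refine ⟨.comp c (.base 1), fun M v y => ?_⟩
  simp only [Rel.eq_2, h, exists_eq_left, rel1]
theorem TF.wk (hf : TF f) : TF (m := m + 1) (fun M w => f M (fun i => w i.castSucc)) := by
  obtain ⟨c, h⟩ := hf
  refine ⟨.comp (.base 2) c, fun M v y => ?_⟩
  simp only [Rel.eq_2, st, rel2, exists_eq_left, h]
theorem TF.var : ∀ {m : ℕ} (i : Fin m), TF (fun M v => v i) := by
  intro m
  induction m with
  | zero => exact fun i => i.elim0
  | succ m ih =>
    intro i
    refine Fin.lastCases ?_ (fun i => ?_) i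
    · exact ⟨.base 3, fun M v y => by simp only [st, rel3]⟩
    · exact (ih i).wk
theorem TF.tm (t : LA.Term (Empty ⊕ Fin m)) : TF (fun M v => t.realize (Sum.elim default v)) := by
  induction t with
  | var i =>
    rcases i with i | i
    · exact i.elim
    · exact TF.var i
  | @func l f ts ih =>
    match l, f, ts, ih with
    | 0, f, ts, ih =>
      refine TF.zero.congr fun M v => ?_
      change _ = Structure.funMap _ _
      rw [Subsingleton.elim (fun i => Term.realize (Sum.elim default v) (ts i)) (![] : Fin 0 → M)]
      rfl
    | 1, f, ts, ih =>
      refine (ih 0).succ.congr fun M v => ?_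
      change _ = Structure.funMap _ _
      have : (fun i : Fin 1 => (ts i).realize (Sum.elim default v)) = ![(ts 0).realize (Sum.elim default v)] := by
        funext i
        rw [Subsingleton.elim i 0]
        rfl
      rw [this]
      exact (rs_eq _).symm
    | 2, f, ts, ih =>
      have : ∀ (M : PAM) v, (fun i : Fin 2 => (ts i).realize (M := M) (Sum.elim default v)) =
        ![(ts 0).realize (Sum.elim default v), (ts 1).realize (Sum.elim default v)] := by
        intro M v
        funext i
        fin_cases i <;> rfl
      match f with
      | false =>
        refine ((ih 0).op (ih 1) (.base 4) (o := fun M x y => x + y) (fun M u v y => rel4 _ _ _)).congr fun M v => ?_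
        change _ = Structure.funMap _ _
        rw [this]; rfl
      | true =>
        refine ((ih 0).op (ih 1) (.base 5) (o := fun M x y => x * y) (fun M u v y => rel5 _ _ _)).congr fun M v => ?_
        change _ = Structure.funMap _ _
        rw [this]; rfl
theorem TF.of (h : IsTm f) : TF f := by
  obtain ⟨t, h⟩ := h
  exact (TF.tm t).congr fun M v => h M v
theorem TP.or (hP : TP P) (hQ : TP Q) : TP (fun M v => P M v ∨ Q M v) := by
  obtain ⟨c, h⟩ := hP
  obtain ⟨d, h'⟩ := hQ
  refine ⟨.union c d, fun M v y => ?_⟩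
  simp only [Rel, h, h']
  tauto
theorem TP.and (hP : TP P) (hQ : TP Q) : TP (fun M v => P M v ∧ Q M v) := by
  obtain ⟨c, h⟩ := hP
  obtain ⟨d, h'⟩ := hQ
  refine ⟨.comp (.fork c d) (.base 0), fun M v y => ?_⟩
  simp only [Rel.eq_2, Rel.eq_3, rel0, h, h']
  constructor
  · rintro ⟨_, ⟨u, v, -, h1, h2⟩, h3⟩
    exact ⟨h3, h1.2, h2.2⟩
  · rintro ⟨h1, h2, h3⟩
    exact ⟨_, ⟨0, 0, rfl, ⟨rfl, h2⟩, rfl, h3⟩, h1⟩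
theorem TP.false : TP (m := m) (fun M v => False) := ⟨.base 10, fun M v y => by simp [rel10]⟩
theorem TP.ex {P : Pd (m + 1)} (h : TP P) : TP (fun M v => ∃ x, P M (Fin.snoc v x)) := by
  obtain ⟨c, h⟩ := h
  refine ⟨.comp (.fork (.base 9) (.base 8)) c, fun M v y => ?_⟩
  simp only [Rel.eq_2, Rel.eq_3, rel8, rel9]
  constructor
  · rintro ⟨_, ⟨u, x, rfl, rfl, -⟩, h3⟩
    rw [← st_snoc, h] at h3
    exact ⟨h3.1, x, h3.2⟩
  · rintro ⟨h1, x, h2⟩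
    refine ⟨_, ⟨_, x, rfl, rfl, trivial⟩, ?_⟩
    rw [← st_snoc, h]
    exact ⟨h1, h2⟩
theorem TP.ball {P : Pd (m + 1)} (hf : TF f) (h : TP P) : TP (fun M v => ∀ x ≤ f M v, P M (Fin.snoc v x)) := by
  obtain ⟨c, h⟩ := h
  obtain ⟨d, h'⟩ := hf
  refine ⟨.comp (.fork (.base 9) d) (.ball c), fun M v y => ?_⟩
  simp only [Rel.eq_2, Rel.eq_3, Rel.eq_5, h', rel9]
  constructor
  · rintro ⟨_, ⟨u, x, rfl, rfl, rfl⟩, h3, c', b, h4, h5⟩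
    obtain ⟨rfl, rfl⟩ := J_inj h4
    refine ⟨h3, fun x hx => ?_⟩
    have := h5 x hx
    rw [← st_snoc, h] at this
    exact this.2
  · rintro ⟨h1, h2⟩
    refine ⟨_, ⟨_, _, rfl, rfl, rfl⟩, h1, _, _, rfl, fun x hx => ?_⟩
    rw [← st_snoc, h]
    exact ⟨rfl, h2 x hx⟩
theorem TP.le (hf : TF f) (hg : TF g) : TP (fun M v => f M v ≤ g M v) :=
  TP.op hf hg (.base 6) (o := fun M x y => x ≤ y) fun M u v y => rel6 _ _ _
theorem TP.lt (hf : TF f) (hg : TF g) : TP (fun M v => f M v < g M v) :=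
  TP.op hf hg (.base 7) (o := fun M x y => x < y) fun M u v y => rel7 _ _ _
end

theorem TP.fml {m : ℕ} {φ : LA.BoundedFormula Empty m} (h : IsDelta0 φ) :
    TP (fun M v => φ.Realize default v) ∧ TP (fun M v => ¬ φ.Realize default v) := by
  induction h with
  | falsum =>
    refine ⟨TP.false, ?_⟩
    exact ⟨.base 0, fun M v y => by rw [rel0]; simp [BoundedFormula.realize_bot]⟩
  | equal t u =>
    simp only [BoundedFormula.realize_bdEqual]
    constructor
    · exact ((TP.le (TF.tm t) (TF.tm u)).and (TP.le (TF.tm u) (TF.tm t))).congr fun M v => le_antisymm_iff.symm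
    · exact ((TP.lt (TF.tm t) (TF.tm u)).or (TP.lt (TF.tm u) (TF.tm t))).congr fun M v => ne_iff_lt_or_gt.symm
  | le t u =>
    simp only [real_le, rle_iff, not_le]
    exact ⟨TP.le (TF.tm t) (TF.tm u), TP.lt (TF.tm u) (TF.tm t)⟩
  | imp _ _ h1 h2 =>
    simp only [BoundedFormula.realize_imp]
    exact ⟨(h1.2.or h2.1).congr fun M v => by tauto, (h1.1.and h2.2).congr fun M v => by tauto⟩
  | ball t _ h =>
    simp only [BoundedFormula.realize_all, BoundedFormula.realize_imp, real_le, real_v,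
      relabel_cast, Fin.snoc_last, rle_iff]
    refine ⟨TP.ball (TF.tm t) h.1, ?_⟩
    refine (TP.ex (TP.and (TP.le (TF.var (Fin.last _)) (TF.tm t).wk) h.2)).congr fun M v => ?_
    simp
  | bex t _ h =>
    simp only [BoundedFormula.realize_ex, BoundedFormula.realize_inf, real_le, real_v,
      relabel_cast, Fin.snoc_last, rle_iff]
    constructor
    · refine (TP.ex (TP.and (TP.le (TF.var (Fin.last _)) (TF.tm t).wk) h.1)).congr fun M v => ?_
      simp
    · refine (TP.ball (TF.tm t) h.2).congr fun M v => ?_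
      simp
theorem TP.d0 {m : ℕ} {P : Pd m} (h : D0 P) : TP P := by
  obtain ⟨φ, d, h⟩ := h
  exact (TP.fml d).1.congr fun M v => h M v
theorem TP.sg1 {m : ℕ} {P : Pd m} (h : Sg 1 P) : TP P :=
  Sg.elim h (R := fun m P => TP P) (fun m P h => TP.d0 h.d0) (fun m P h => h.ex)

/-! ### Universal formulas -/
/-- matrix of the universal `Σ_{k+1}` formula -/
def BB : ∀ (k : ℕ) {M : PAM} (e a w : M), Prop
  | 0, _, e, a, w => ∃ p ≤ w, ∃ q ≤ w, ∃ r ≤ w, w = J p (J q r) ∧ Cert p q r ∧ Mem p q r (J (J e a) 0)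
  | k + 1, _, e, a, w => ¬ ∃ w', BB k e (J a w) w'
def UU (k : ℕ) {M : PAM} (e a : M) : Prop := ∃ w, BB k e a w

theorem BB_pi (k : ℕ) : Pi k (m := 3) (fun M v => BB k (v 0) (v 1) (v 2)) := by
  induction k with
  | zero =>
    apply D0.pi0
    unfold BB
    repeat' with_reducible (first | apply IsTm.var | apply IsTm.zero | apply IsTm.J | apply D0.le | apply D0.eq | apply D0.bex | apply D0.and | apply Mem_d0.s4 | apply Cert_d0.s3)
  | succ k ih =>
    have h1 : Sg (k + 1) (m := 3) (fun M v => ∃ w, BB k (v 0) (J (v 1) (v 2)) w) := by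
      apply Sg.ex
      apply Pi.sg
      refine ih.s3 (IsTm.var _) (IsTm.J (IsTm.var _) (IsTm.var _)) (IsTm.var _)
    exact h1.not
theorem UU_sg (k : ℕ) : Sg (k + 1) (m := 2) (fun M v => UU k (v 0) (v 1)) := by
  unfold UU
  apply Sg.ex
  apply Pi.sg
  exact (BB_pi k).s3 (IsTm.var _) (IsTm.var _) (IsTm.var _)
theorem UU_zero {M : PAM} (e a : M) : UU 0 e a ↔ Has (J (J e a) 0) := by
  unfold UU BB Has
  constructor
  · rintro ⟨w, p, -, q, -, r, -, -, h⟩; exact ⟨p, q, r, h⟩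
  · rintro ⟨p, q, r, h⟩
    exact ⟨_, p, le_J_left _ _, q, (le_J_left _ _).trans (le_J_right _ _), r,
      (le_J_right _ _).trans (le_J_right _ _), rfl, h⟩

theorem UU_succ {M : PAM} (k : ℕ) (e a : M) : UU (k + 1) e a ↔ ∃ x, ¬ UU k e (J a x) := Iff.rfl

theorem univ (k : ℕ) : ∀ {m : ℕ} {P : Pd m}, Sg (k + 1) P → ∃ e : ℕ, ∀ M v, P M v ↔ UU k (e : M) (st v) := by
  induction k with
  | zero =>
    intro m P h
    obtain ⟨c, h⟩ := TP.sg1 h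
    refine ⟨cde c, fun M v => ?_⟩
    rw [UU_zero, has_iff, h]
    simp
  | succ k ih =>
    intro m P h
    refine Sg.elim h (R := fun m P => ∃ e : ℕ, ∀ M v, P M v ↔ UU (k+1) (e : M) (st v)) ?_ ?_
    · intro m P h
      obtain ⟨e, he⟩ := ih h.not.wk
      refine ⟨e, fun M v => ?_⟩
      simp only [UU_succ, ← st_snoc, ← he]
      simp
    · rintro m P ⟨e, he⟩
      have h1 : Sg (k + 1) (m := m + 1) (fun M v => (∀ x ≤ v (Fin.last m), ∀ y ≤ v (Fin.last m), ¬ (v (Fin.last m) = J x y)) ∨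
          ∃ x y, v (Fin.last m) = J x y ∧ UU k (e : M) (J (J (st (fun i => v (Fin.castSucc i))) x) y)) := by
        apply Sg.or
        · apply D0.sg
          repeat' with_reducible (first | apply IsTm.var | apply IsTm.J | apply D0.ball | apply D0.not | apply D0.eq)
        · apply Sg.ex
          apply Sg.ex
          apply Sg.and
          · apply D0.sg
            repeat' with_reducible (first | apply IsTm.var | apply IsTm.J | apply D0.eq)
          · refine (UU_sg k).s2 (IsTm.natCast _) (IsTm.J (IsTm.J ?_ (IsTm.var _)) (IsTm.var _))
            exact IsTm.st.wk.wk.wk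
      obtain ⟨e', he'⟩ := ih h1
      refine ⟨e', fun M v => ?_⟩
      simp only [UU_succ, ← st_snoc (v := v), ← he', he]
      simp only [Fin.snoc_last, Fin.snoc_castSucc, not_or, not_exists, not_and]
      simp only [st_snoc]
      constructor
      · rintro ⟨x, y, h⟩
        refine ⟨J x y, ?_, ?_⟩
        · intro h; exact h x (le_J_left _ _) y (le_J_right _ _) rfl
        · intro x' y' h'
          obtain ⟨rfl, rfl⟩ := J_inj h'
          exact h
      · rintro ⟨z, h1, h2⟩
        push Not at h1
        obtain ⟨x, -, y, -, h⟩ := h1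
        exact ⟨x, y, h2 x y h⟩
end Guaspari

open FirstOrder Language
open scoped FirstOrder
namespace Guaspari
set_option linter.all false

theorem TP.sg {m : ℕ} {P : Pd m} (h : TP P) : Sg 1 P := by
  obtain ⟨c, h⟩ := h
  have : Sg 1 (m := m) (fun M v => UU 0 (cde c : M) (st v)) :=
    (UU_sg 0).s2 (IsTm.natCast _) IsTm.st
  refine this.congr fun M v => ?_
  rw [UU_zero, has_iff, h]
  simp
theorem Sg.ball1 {m : ℕ} {f : Fu m} {P : ∀ M : PAM, (Fin m → M) → M → Prop} (hf : IsTm f)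
    (h : Sg 1 (m := m + 1) (fun M w => P M (fun i => w i.castSucc) (w (Fin.last m)))) :
    Sg 1 (fun M v => ∀ x ≤ f M v, P M v x) := by
  refine (TP.ball (TF.of hf) (TP.sg1 h)).sg.congr fun M v => ?_
  simp
theorem nat_le {a b : NatM} : a ≤ b ↔ @LE.le ℕ _ a b := Iff.rfl
theorem nat_add (a b : NatM) : a + b = @HAdd.hAdd ℕ ℕ ℕ _ a b := rfl
theorem nat_mul (a b : NatM) : a * b = @HMul.hMul ℕ ℕ ℕ _ a b := rfl
theorem nat_one : (1 : NatM) = (1 : ℕ) := rfl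
theorem nat_zero : (0 : NatM) = (0 : ℕ) := rfl
theorem nat_lt {a b : NatM} : a < b ↔ @LT.lt ℕ _ a b := by
  rw [← not_le, nat_le]; exact Nat.not_le

def IsPr {M : PAM} (a b n : M) : Prop := (a < b ∧ n = b * b + a) ∨ (b ≤ a ∧ n = a * a + a + b)
theorem IsPr_d0 : D0 (m := 3) (fun M v => IsPr (v 0) (v 1) (v 2)) := by
  unfold IsPr
  repeat' with_reducible (first | apply IsTm.var | apply IsTm.mul | apply IsTm.add | apply D0.lt | apply D0.le | apply D0.eq | apply D0.or | apply D0.and)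
theorem IsPr_nat (a b n : ℕ) : IsPr (M := NatM) a b n ↔ n = Nat.pair a b := by
  have e : IsPr (M := NatM) a b n ↔ ((@LT.lt ℕ _ a b ∧ n = b*b+a) ∨ (@LE.le ℕ _ b a ∧ n = a*a+a+b)) :=
    or_congr (and_congr nat_lt Iff.rfl) Iff.rfl
  rw [e]
  unfold Nat.pair
  split
  · constructor
    · rintro (⟨h1, h2⟩ | ⟨h1, h2⟩)
      · exact h2
      · omega
    · intro h2; left; exact ⟨by assumption, h2⟩
  · constructor
    · rintro (⟨h1, h2⟩ | ⟨h1, h2⟩)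
      · omega
      · exact h2
    · intro h2; right; exact ⟨by omega, h2⟩

def Gr (f : ℕ →. ℕ) : Prop := ∃ P : ∀ M : PAM, M → M → Prop,
  Sg 1 (m := 2) (fun M v => P M (v 0) (v 1)) ∧ ∀ x y : ℕ, y ∈ f x ↔ P NatM x y

theorem mem_prec (f g : ℕ →. ℕ) (a : ℕ) (n y : ℕ) :
    y ∈ (Nat.rec (f a) (fun y IH => IH.bind fun i => g (Nat.pair a (Nat.pair y i))) n : Part ℕ) ↔
    ∃ p q r : NatM, Mem p q r (J (n : NatM) (y : NatM)) ∧ ∀ z ≤ r, Mem p q r z →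
      ∃ i u : NatM, z = J i u ∧ ((i = 0 ∧ u ∈ f a) ∨
        ∃ j t : NatM, i = j + 1 ∧ Mem p q r (J j t) ∧ u ∈ g (Nat.pair a (Nat.pair j t))) := by
  constructor
  · induction n generalizing y with
    | zero =>
      intro h
      obtain ⟨p, q, r, h0⟩ := emp (M := NatM)
      obtain ⟨P, Q, R, h1⟩ := ins p q r p q r (J (0 : NatM) (y : NatM))
      refine ⟨P, Q, R, (h1 _).2 (Or.inr (Or.inr rfl)), fun z _ hz => ?_⟩
      rcases (h1 z).1 hz with hz | hz | rfl
      · exact absurd hz (h0 z)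
      · exact absurd hz (h0 z)
      · exact ⟨_, _, rfl, Or.inl ⟨rfl, h⟩⟩
    | succ n ih =>
      intro h
      obtain ⟨t, h2, h3⟩ := Part.mem_bind_iff.1 h
      obtain ⟨p, q, r, h4, h5⟩ := ih t h2
      obtain ⟨P, Q, R, h1⟩ := ins p q r p q r (J (show NatM from Nat.succ n) (y : NatM))
      refine ⟨P, Q, R, (h1 _).2 (Or.inr (Or.inr rfl)), fun z _ hz => ?_⟩
      have key : Mem p q r z → ∃ i u : NatM, z = J i u ∧ ((i = 0 ∧ u ∈ f a) ∨
        ∃ j t : NatM, i = j + 1 ∧ Mem P Q R (J j t) ∧ u ∈ g (Nat.pair a (Nat.pair j t))) := by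
        intro hz
        obtain ⟨i, u, rfl, h6 | ⟨j, t, h6, h7, h8⟩⟩ := h5 z (Mem_le hz) hz
        · exact ⟨i, u, rfl, Or.inl h6⟩
        · exact ⟨i, u, rfl, Or.inr ⟨j, t, h6, (h1 _).2 (Or.inl h7), h8⟩⟩
      rcases (h1 z).1 hz with hz | hz | rfl
      · exact key hz
      · exact key hz
      · exact ⟨_, _, rfl, Or.inr ⟨n, t, rfl, (h1 _).2 (Or.inl h4), h3⟩⟩
  · rintro ⟨p, q, r, h1, h2⟩
    induction n generalizing y with
    | zero =>
      obtain ⟨i, u, h3, h4⟩ := h2 _ (Mem_le h1) h1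
      obtain ⟨rfl, rfl⟩ := J_inj h3
      rcases h4 with ⟨h4, h5⟩ | ⟨j, t, h4, h5, h6⟩
      · exact h5
      · exact absurd (h4 : @Eq ℕ 0 (Nat.succ j)) (Nat.succ_ne_zero j).symm
    | succ n ih =>
      obtain ⟨i, u, h3, h4⟩ := h2 _ (Mem_le h1) h1
      obtain ⟨rfl, rfl⟩ := J_inj h3
      rcases h4 with ⟨h4, h5⟩ | ⟨j, t, h4, h5, h6⟩
      · exact absurd h4 (Nat.succ_ne_zero n)
      · obtain rfl : n = j := Nat.succ.inj h4
        exact Part.mem_bind_iff.2 ⟨t, ih t h5, h6⟩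

theorem gr_all {f : ℕ →. ℕ} (h : Nat.Partrec f) : Gr f := by
  induction h with
  | zero =>
    refine ⟨fun M x y => y = 0, ?_, fun x y => ?_⟩
    · apply D0.sg; exact D0.eq (IsTm.var _) IsTm.zero
    · simp [pure, PFun.pure]; rfl
  | succ =>
    refine ⟨fun M x y => y = x + 1, ?_, fun x y => ?_⟩
    · apply D0.sg; exact D0.eq (IsTm.var _) (IsTm.add (IsTm.var _) IsTm.one)
    · simp; rfl
  | left =>
    refine ⟨fun M x y => ∃ z, IsPr y z x, ?_, fun x y => ?_⟩
    · apply Sg.ex; apply D0.sg; exact IsPr_d0.s3 (IsTm.var _) (IsTm.var _) (IsTm.var _)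
    · simp only [PFun.coe_val, Part.mem_some_iff]
      constructor
      · rintro rfl
        exact ⟨x.unpair.2, (IsPr_nat _ _ _).2 (Nat.pair_unpair x).symm⟩
      · rintro ⟨z, h⟩
        have h := (IsPr_nat y (show ℕ from z) _).1 h
        rw [h]; exact (congrArg Prod.fst (Nat.unpair_pair y _)).symm
  | right =>
    refine ⟨fun M x y => ∃ z, IsPr z y x, ?_, fun x y => ?_⟩
    · apply Sg.ex; apply D0.sg; exact IsPr_d0.s3 (IsTm.var _) (IsTm.var _) (IsTm.var _)
    · simp only [PFun.coe_val, Part.mem_some_iff]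
      constructor
      · rintro rfl
        exact ⟨x.unpair.1, (IsPr_nat _ _ _).2 (Nat.pair_unpair x).symm⟩
      · rintro ⟨z, h⟩
        have h := (IsPr_nat (show ℕ from z) y _).1 h
        rw [h]; exact (congrArg Prod.snd (Nat.unpair_pair _ y)).symm
  | @pair f g _ _ hf hg =>
    obtain ⟨F, hF, hF'⟩ := hf
    obtain ⟨G, hG, hG'⟩ := hg
    refine ⟨fun M x y => ∃ u v, IsPr u v y ∧ F M x u ∧ G M x v, ?_, fun x y => ?_⟩
    · apply Sg.ex; apply Sg.ex
      refine Sg.and ?_ (Sg.and ?_ ?_)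
      · apply D0.sg; exact IsPr_d0.s3 (IsTm.var _) (IsTm.var _) (IsTm.var _)
      · exact hF.s2 (IsTm.var _) (IsTm.var _)
      · exact hG.s2 (IsTm.var _) (IsTm.var _)
    · constructor
      · intro h
        simp only [Seq.seq, Part.mem_bind_iff, Part.map_eq_map, Part.mem_map_iff] at h
        obtain ⟨_, ⟨u, hu, rfl⟩, v, hv, rfl⟩ := h
        exact ⟨u, v, (IsPr_nat _ _ _).2 rfl, (hF' _ _).1 hu, (hG' _ _).1 hv⟩
      · rintro ⟨u, v, h1, h2, h3⟩
        simp only [Seq.seq, Part.mem_bind_iff, Part.map_eq_map, Part.mem_map_iff]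
        exact ⟨_, ⟨u, (hF' _ _).2 h2, rfl⟩, v, (hG' _ _).2 h3, ((IsPr_nat _ _ _).1 h1).symm⟩
  | @comp f g _ _ hf hg =>
    obtain ⟨F, hF, hF'⟩ := hf
    obtain ⟨G, hG, hG'⟩ := hg
    refine ⟨fun M x y => ∃ u, G M x u ∧ F M u y, ?_, fun x y => ?_⟩
    · apply Sg.ex
      refine Sg.and ?_ ?_
      · exact hG.s2 (IsTm.var _) (IsTm.var _)
      · exact hF.s2 (IsTm.var _) (IsTm.var _)
    · refine Part.mem_bind_iff.trans ?_
      constructor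
      · rintro ⟨u, h1, h2⟩
        exact ⟨u, (hG' _ _).1 h1, (hF' _ _).1 h2⟩
      · rintro ⟨u, h1, h2⟩
        exact ⟨u, (hG' _ _).2 h1, (hF' _ _).2 h2⟩
  | @prec f g _ _ hf hg =>
    obtain ⟨F, hF, hF'⟩ := hf
    obtain ⟨G, hG, hG'⟩ := hg
    refine ⟨fun M x y => ∃ a n, IsPr a n x ∧ ∃ p q r, Mem p q r (J n y) ∧ ∀ z ≤ r, (¬ Mem p q r z) ∨
      ∃ i u, z = J i u ∧ ((i = 0 ∧ F M a u) ∨ ∃ j t, i = j + 1 ∧ Mem p q r (J j t) ∧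
        ∃ c d, IsPr j t c ∧ IsPr a c d ∧ G M d u), ?_, fun x y => ?_⟩
    · repeat' with_reducible (first | apply IsTm.var | apply IsTm.zero | apply IsTm.one | apply IsTm.J | apply IsTm.add | apply hF.s2 | apply hG.s2 | apply IsPr_d0.sg.s3 | apply Mem_d0.sg.s4 | apply Sg.ex | apply Sg.and | apply Sg.or | apply Sg.ball1 | apply D0.sg (D0.eq _ _) | exact D0.sg (Mem_d0.s4 (IsTm.var _) (IsTm.var _) (IsTm.var _) (IsTm.var _)).not | refine D0.sg (D0.eq ?_ ?_))
    · have e1 : ∀ a n : ℕ, (Nat.unpaired (fun a n => Nat.rec (f a)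
          (fun y IH => IH.bind fun i => g (Nat.pair a (Nat.pair y i))) n) (Nat.pair a n) : Part ℕ) =
          Nat.rec (f a) (fun y IH => IH.bind fun i => g (Nat.pair a (Nat.pair y i))) n := by
        intro a n; simp [Nat.unpaired]
      constructor
      · intro h
        obtain ⟨a, n, rfl⟩ : ∃ a n, x = Nat.pair a n := ⟨_, _, (Nat.pair_unpair x).symm⟩
        have h' := (e1 a n) ▸ h
        rw [mem_prec] at h'
        obtain ⟨p, q, r, h1, h2⟩ := h'
        refine ⟨a, n, (IsPr_nat _ _ _).2 rfl, p, q, r, h1, fun z hz => ?_⟩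
        by_cases hm : Mem p q r z
        · right
          obtain ⟨i, u, h3, ⟨h4, h5⟩ | ⟨j, t, h4, h5, h6⟩⟩ := h2 z hz hm
          · exact ⟨i, u, h3, Or.inl ⟨h4, (hF' _ _).1 h5⟩⟩
          · exact ⟨i, u, h3, Or.inr ⟨j, t, h4, h5, _, _, (IsPr_nat _ _ _).2 rfl, (IsPr_nat _ _ _).2 rfl, (hG' _ _).1 h6⟩⟩
        · exact Or.inl hm
      · rintro ⟨a, n, h0, p, q, r, h1, h2⟩
        obtain rfl := (IsPr_nat _ _ _).1 h0
        have := e1 a n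
        refine this ▸ (mem_prec f g a n y).2 ⟨p, q, r, h1, fun z hz hm => ?_⟩
        obtain ⟨i, u, h3, ⟨h4, h5⟩ | ⟨j, t, h4, h5, c, d, h6, h7, h8⟩⟩ := (h2 z hz).resolve_left (fun h => h hm)
        · exact ⟨i, u, h3, Or.inl ⟨h4, (hF' _ _).2 h5⟩⟩
        · refine ⟨i, u, h3, Or.inr ⟨j, t, h4, h5, ?_⟩⟩
          obtain rfl := (IsPr_nat _ _ _).1 h6
          obtain rfl := (IsPr_nat _ _ _).1 h7
          exact (hG' _ _).2 h8
  | @rfind f _ hf =>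
    obtain ⟨F, hF, hF'⟩ := hf
    refine ⟨fun M x y => (∃ c, IsPr x y c ∧ F M c 0) ∧ ∀ m ≤ y, m = y ∨ ∃ c u, IsPr x m c ∧ F M c (u + 1), ?_, fun x y => ?_⟩
    · repeat' with_reducible (first | apply IsTm.var | apply IsTm.zero | apply IsTm.one | apply IsTm.J | apply IsTm.add | apply hF.s2 | apply IsPr_d0.sg.s3 | apply Sg.ex | apply Sg.and | apply Sg.or | apply Sg.ball1 | refine D0.sg (D0.eq ?_ ?_))
    · refine Nat.mem_rfind.trans ?_
      simp only [Part.map_eq_map, Part.mem_map_iff]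
      refine and_congr ?_ ?_
      · constructor
        · rintro ⟨z, h1, h2⟩
          obtain rfl : z = 0 := by simpa using h2
          exact ⟨_, (IsPr_nat _ _ _).2 rfl, (hF' _ _).1 h1⟩
        · rintro ⟨c, h1, h2⟩
          obtain rfl := (IsPr_nat _ _ _).1 h1
          exact ⟨0, (hF' _ _).2 h2, by simp⟩
      · constructor
        · intro h m hm
          rcases Nat.lt_or_eq_of_le hm with hm | hm
          · right
            obtain ⟨z, h1, h2⟩ := h hm
            obtain ⟨u, rfl⟩ : ∃ u, z = u + 1 := Nat.exists_eq_succ_of_ne_zero (by simpa using h2)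
            exact ⟨_, u, (IsPr_nat _ _ _).2 rfl, (hF' _ _).1 h1⟩
          · exact Or.inl hm
        · intro h m hm
          rcases h m (Nat.le_of_lt hm) with h | ⟨c, u, h1, h2⟩
          · exact absurd h (Nat.ne_of_lt hm)
          · obtain rfl := (IsPr_nat _ _ _).1 h1
            exact ⟨Nat.succ u, (hF' _ _).2 h2, by simp⟩

/-- A `Δ₀` enumeration predicate for all r.e. sets. -/
theorem exists_enum : ∃ D : ∀ M : PAM, M → M → M → Prop,
    D0 (m := 3) (fun M v => D M (v 0) (v 1) (v 2)) ∧
    ∀ (c : Nat.Partrec.Code) (a : ℕ), (c.eval a).Dom ↔ ∃ w : ℕ, D NatM (Encodable.encode c : ℕ) a w := by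
  have hp : Nat.Partrec (fun x : ℕ => (Nat.Partrec.Code.eval (Denumerable.ofNat _ x.unpair.1) x.unpair.2)) := by
    have : Partrec (fun x : ℕ => (Nat.Partrec.Code.eval (Denumerable.ofNat _ x.unpair.1) x.unpair.2)) :=
      Nat.Partrec.Code.eval_part.comp
        ((Computable.ofNat _).comp (Computable.fst.comp Computable.unpair))
        (Computable.snd.comp Computable.unpair)
    exact Partrec.nat_iff.1 this
  obtain ⟨F, hF, hF'⟩ := gr_all hp
  have h2 : Sg 1 (m := 2) (fun M v => ∃ c y, IsPr (v 0) (v 1) c ∧ F M c y) := by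
    repeat' with_reducible (first | apply IsTm.var | apply hF.s2 | apply IsPr_d0.sg.s3 | apply Sg.ex | apply Sg.and)
  obtain ⟨e, he⟩ := univ 0 h2
  refine ⟨fun M d a w => BB 0 (e : M) (st ![d, a]) w, ?_, fun c a => ?_⟩
  · refine (BB_pi 0).d0.s3 (IsTm.natCast _) ?_ (IsTm.var _)
    exact IsTm.J (IsTm.J IsTm.zero (IsTm.var _)) (IsTm.var _)
  · have := he NatM ![(Encodable.encode c : ℕ), a]
    refine Iff.trans ?_ this
    constructor
    · intro h
      obtain ⟨y, hy⟩ := Part.dom_iff_mem.1 h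
      refine ⟨Nat.pair (Encodable.encode c) a, y, (IsPr_nat _ _ _).2 rfl, (hF' _ _).1 ?_⟩
      simpa using hy
    · rintro ⟨x, y, h1, h2⟩
      obtain rfl := (IsPr_nat _ _ _).1 h1
      have := (hF' _ _).2 h2
      refine Part.dom_iff_mem.2 ⟨y, ?_⟩
      simpa using this
end Guaspari

open FirstOrder Language
open scoped FirstOrder
namespace Guaspari
set_option linter.all false

/-! Propositional compactness and r.e. unsatisfiability -/
abbrev Cls := List ℕ × List ℕ

def CSat (B : ℕ → Prop) (C : Cls) : Prop := ¬ ((∀ p ∈ C.1, B p) ∧ ∀ q ∈ C.2, ¬ B q)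

def viol (l : List Bool) (C : Cls) : Prop :=
  (∀ p ∈ C.1, l[p]? = some true) ∧ ∀ q ∈ C.2, l[q]? = some false

def allv : ℕ → List (List Bool) := fun n =>
  Nat.rec [ [] ] (fun _ r => r.flatMap fun l => [true :: l, false :: l]) n

theorem allv_succ (n : ℕ) : allv (n + 1) = (allv n).flatMap fun l => [true :: l, false :: l] := rfl

theorem mem_allv (n : ℕ) (l : List Bool) : l ∈ allv n ↔ l.length = n := by
  induction n generalizing l with
  | zero => simp [allv]
  | succ n ih =>
    rw [allv_succ]
    simp only [List.mem_flatMap, ih]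
    cases l with
    | nil => simp
    | cons b l => cases b <;> simp

theorem allv_prim : Primrec allv := by
  unfold allv
  refine Primrec.nat_rec' (f := fun n : ℕ => n) (g := fun _ => [ [] ])
    (h := fun _ p => p.2.flatMap fun l : List Bool => [true :: l, false :: l]) Primrec.id (Primrec.const _) ?_
  refine (Primrec.list_flatMap (f := fun p : ℕ × ℕ × List (List Bool) => p.2.2)
    (g := fun _ l => [true :: l, false :: l]) (Primrec.snd.comp Primrec.snd) ?_).to₂
  refine (Primrec.list_cons.comp (Primrec.list_cons.comp (Primrec.const _) Primrec.snd)
    (Primrec.list_cons.comp (Primrec.list_cons.comp (Primrec.const _) Primrec.snd) (Primrec.const _))).to₂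

theorem viol_prim : PrimrecRel viol := by
  unfold viol
  have e (b : Bool) : PrimrecRel (fun (p : ℕ) (l : List Bool) => l[p]? = some b) :=
    Primrec.eq.comp (Primrec.list_getElem?.comp Primrec.snd Primrec.fst) (Primrec.const _)
  exact PrimrecPred.and
    ((e true).forall_mem_list.comp (Primrec.fst.comp Primrec.snd) Primrec.fst)
    ((e false).forall_mem_list.comp (Primrec.snd.comp Primrec.snd) Primrec.fst)

theorem unsat_iff (f : ℕ → Cls) :
    (¬ ∃ B : ℕ → Prop, ∀ k, CSat B (f k)) ↔ ∃ N, ∀ l ∈ allv N, ∃ k < N, viol l (f k) := by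
  constructor
  · intro h
    by_contra hc
    push Not at hc
    choose l hl hk using hc
    apply h
    let U := Filter.hyperfilter ℕ
    have hU (k : ℕ) : ∀ᶠ N in (U : Filter ℕ), k < N := by
      have : ∀ᶠ N in Filter.cofinite, k < N := by
        rw [Nat.cofinite_eq_atTop]; exact Filter.eventually_gt_atTop k
      exact Filter.hyperfilter_le_cofinite this
    refine ⟨fun x => ∀ᶠ N in (U : Filter ℕ), (l N)[x]? = some true, fun k hv => ?_⟩
    obtain ⟨h1, h2⟩ := hv
    have a1 : ∀ᶠ N in (U : Filter ℕ), ∀ p ∈ (f k).1, (l N)[p]? = some true := by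
      have := (Filter.eventually_all_finite (List.finite_toSet (f k).1) (l := (U : Filter ℕ))
        (p := fun p N => (l N)[p]? = some true)).2 h1
      exact this
    have a2 : ∀ᶠ N in (U : Filter ℕ), ∀ p ∈ (f k).2, (l N)[p]? = some false := by
      have := (Filter.eventually_all_finite (List.finite_toSet (f k).2) (l := (U : Filter ℕ))
        (p := fun p N => (l N)[p]? = some false)).2 (fun q hq => by
          have := h2 q hq
          rw [← Ultrafilter.eventually_not] at this
          filter_upwards [this, hU q] with N h3 h4
          have h5 : q < (l N).length := by rw [(mem_allv N _).1 (hl N)]; exact h4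
          rw [List.getElem?_eq_getElem h5] at h3 ⊢
          simpa using h3)
      exact this
    obtain ⟨N, b1, b2, b3⟩ := (a1.and (a2.and (hU k))).exists
    exact hk N k b3 ⟨b1, b2⟩
  · rintro ⟨N, hN⟩ ⟨B, hB⟩
    classical
    obtain ⟨k, hk, h1, h2⟩ := hN ((List.range N).map fun x => decide (B x)) ((mem_allv _ _).2 (by simp))
    apply hB k
    refine ⟨fun p hp => ?_, fun q hq => ?_⟩
    · have := h1 p hp
      simp only [List.getElem?_map, Option.map_eq_some_iff] at this
      obtain ⟨a, h3, h4⟩ := this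
      have h5 := List.getElem?_eq_some_iff.1 h3
      obtain ⟨h6, h7⟩ := h5
      simp at h7; subst h7; simpa using h4
    · have := h2 q hq
      simp only [List.getElem?_map, Option.map_eq_some_iff] at this
      obtain ⟨a, h3, h4⟩ := this
      have h5 := List.getElem?_eq_some_iff.1 h3
      obtain ⟨h6, h7⟩ := h5
      simp at h7; subst h7; simpa using h4

theorem re_ex {α : Type} [Primcodable α] {R : α → ℕ → Prop} (h : PrimrecRel R) :
    REPred (fun a => ∃ n, R a n) := by
  classical
  have h := h.decide
  have : Partrec (fun a : α => Nat.rfind (fun n => Part.some (decide (R a n)))) := by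
    apply Partrec.rfind
    exact h.to_comp.partrec.to₂
  refine this.dom_re.of_eq fun a => ?_
  refine Nat.rfind_dom.trans ?_
  constructor
  · rintro ⟨n, h1, _⟩; exact ⟨n, by simpa using h1⟩
  · rintro ⟨n, h1⟩; exact ⟨n, by simpa using h1, fun _ => trivial⟩

/-- Primitive recursive families of clauses. -/
def PF {α : Type} [Primcodable α] (F : α → Cls → Prop) : Prop :=
  ∃ f : α → ℕ → Cls, Primrec₂ f ∧ ∀ a C, F a C ↔ ∃ k, f a k = C

theorem PF.or {α : Type} [Primcodable α] {F G : α → Cls → Prop} (hF : PF F) (hG : PF G) :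
    PF (fun a C => F a C ∨ G a C) := by
  obtain ⟨f, hf, hf'⟩ := hF
  obtain ⟨g, hg, hg'⟩ := hG
  refine ⟨fun a k => if k.unpair.1 = 0 then f a k.unpair.2 else g a k.unpair.2, ?_, fun a C => ?_⟩
  · have e : Primrec (fun p : α × ℕ => p.2.unpair.2) :=
      Primrec.snd.comp (Primrec.unpair.comp Primrec.snd)
    have e1 : Primrec (fun p : α × ℕ => p.2.unpair.1) :=
      Primrec.fst.comp (Primrec.unpair.comp Primrec.snd)
    exact Primrec.ite (Primrec.eq.comp e1 (Primrec.const 0)) (hf.comp Primrec.fst e) (hg.comp Primrec.fst e)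
  · show F a C ∨ G a C ↔ ∃ k : ℕ, (if k.unpair.1 = 0 then f a k.unpair.2 else g a k.unpair.2) = C
    rw [hf', hg']
    constructor
    · rintro (⟨k, h⟩ | ⟨k, h⟩)
      · exact ⟨Nat.pair 0 k, by simpa using h⟩
      · exact ⟨Nat.pair 1 k, by simpa using h⟩
    · rintro ⟨k, h⟩
      split at h
      · exact Or.inl ⟨_, h⟩
      · exact Or.inr ⟨_, h⟩

theorem PF.re {α : Type} [Primcodable α] {F : α → Cls → Prop} (hF : PF F) :
    REPred (fun a => ¬ ∃ B : ℕ → Prop, ∀ C, F a C → CSat B C) := by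
  obtain ⟨f, hf, hf'⟩ := hF
  have h1 : PrimrecRel (fun (k : ℕ) (x : List Bool × α) => viol x.1 (f x.2 k)) :=
    viol_prim.comp (Primrec.fst.comp Primrec.snd) (hf.comp (Primrec.snd.comp Primrec.snd) Primrec.fst)
  have h2 : PrimrecRel (fun (l : List Bool) (x : α × ℕ) => ∃ k ∈ List.range x.2, viol l (f x.1 k)) :=
    h1.exists_mem_list.comp (Primrec.list_range.comp (Primrec.snd.comp Primrec.snd))
      (Primrec.pair Primrec.fst (Primrec.fst.comp Primrec.snd))
  have h3 : PrimrecRel (fun (a : α) (N : ℕ) => ∀ l ∈ allv N, ∃ k ∈ List.range N, viol l (f a k)) :=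
    h2.forall_mem_list.comp (allv_prim.comp Primrec.snd) Primrec.id
  refine (re_ex h3).of_eq fun a => ?_
  have := unsat_iff (f a)
  simp only [List.mem_range]
  rw [← this]
  refine not_congr (exists_congr fun B => ?_)
  constructor
  · intro h C hC
    obtain ⟨k, rfl⟩ := (hf' _ _).1 hC
    exact h k
  · intro h k
    exact h _ ((hf' _ _).2 ⟨k, rfl⟩)
end Guaspari

open FirstOrder Language
open scoped FirstOrder
namespace Guaspari
set_option linter.all false

/-! Trees coded by natural numbers -/
def nd (k x y : ℕ) : ℕ := Nat.pair k (Nat.pair x y) + 1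

theorem lt_nd_left (k x y : ℕ) : x < nd k x y :=
  Nat.lt_succ_of_le ((Nat.left_le_pair x y).trans (Nat.right_le_pair k _))
theorem lt_nd_right (k x y : ℕ) : y < nd k x y :=
  Nat.lt_succ_of_le ((Nat.right_le_pair x y).trans (Nat.right_le_pair k _))
theorem nd_inj {k x y k' x' y' : ℕ} : nd k x y = nd k' x' y' ↔ k = k' ∧ x = x' ∧ y = y' := by
  simp [nd, Nat.pair_eq_pair]
theorem zero_or_nd (n : ℕ) : n = 0 ∨ ∃ k x y, n = nd k x y := by
  cases n with
  | zero => exact Or.inl rfl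
  | succ n => exact Or.inr ⟨n.unpair.1, n.unpair.2.unpair.1, n.unpair.2.unpair.2, by simp [nd]⟩

def trec {σ : Type} (z : σ) (f : ℕ → ℕ → ℕ → σ → σ → σ) : ℕ → σ
  | 0 => z
  | n + 1 => f n.unpair.1 n.unpair.2.unpair.1 n.unpair.2.unpair.2
      (trec z f n.unpair.2.unpair.1) (trec z f n.unpair.2.unpair.2)
termination_by n => n
decreasing_by
  · exact Nat.lt_succ_of_le ((Nat.unpair_left_le _).trans (Nat.unpair_right_le _))
  · exact Nat.lt_succ_of_le ((Nat.unpair_right_le _).trans (Nat.unpair_right_le _))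

theorem trec_nd {σ : Type} (z : σ) (f : ℕ → ℕ → ℕ → σ → σ → σ) (k x y : ℕ) :
    trec z f (nd k x y) = f k x y (trec z f x) (trec z f y) := by
  unfold nd
  rw [trec]
  simp
theorem trec_zero {σ : Type} (z : σ) (f : ℕ → ℕ → ℕ → σ → σ → σ) : trec z f 0 = z := by
  rw [trec]

theorem nd_prim {α : Type} [Primcodable α] {k x y : α → ℕ} (hk : Primrec k) (hx : Primrec x) (hy : Primrec y) :
    Primrec (fun a => nd (k a) (x a) (y a)) :=
  Primrec.succ.comp (Primrec₂.natPair.comp hk (Primrec₂.natPair.comp hx hy))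

theorem trec_prim {α σ : Type} [Primcodable α] [Primcodable σ] [Inhabited σ] {z : α → σ}
    {F : α × ℕ × ℕ × ℕ × σ × σ → σ} (hz : Primrec z) (hF : Primrec F) :
    Primrec₂ (fun a n => trec (z a) (fun k x y s t => F (a, k, x, y, s, t)) n) := by
  refine Primrec.nat_strong_rec _ (g := fun a l => some (if l.length = 0 then z a else
    F (a, (l.length - 1).unpair.1, (l.length - 1).unpair.2.unpair.1, (l.length - 1).unpair.2.unpair.2,
      l.getI (l.length - 1).unpair.2.unpair.1, l.getI (l.length - 1).unpair.2.unpair.2))) ?_ ?_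
  · have hl : Primrec (fun p : α × List σ => p.2.length) := Primrec.list_length.comp Primrec.snd
    have h1 : Primrec (fun p : α × List σ => p.2.length - 1) := Primrec.nat_sub.comp hl (Primrec.const 1)
    have h2 := Primrec.fst.comp (Primrec.unpair.comp h1)
    have h3 := Primrec.snd.comp (Primrec.unpair.comp h1)
    have h4 := Primrec.fst.comp (Primrec.unpair.comp h3)
    have h5 := Primrec.snd.comp (Primrec.unpair.comp h3)
    refine Primrec.option_some.comp (Primrec.ite (Primrec.eq.comp hl (Primrec.const 0)) (hz.comp Primrec.fst) ?_)
    exact hF.comp (Primrec.pair Primrec.fst (Primrec.pair h2 (Primrec.pair h4 (Primrec.pair h5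
      (Primrec.pair (Primrec.list_getI.comp Primrec.snd h4) (Primrec.list_getI.comp Primrec.snd h5))))))
  · intro a n
    rcases zero_or_nd n with rfl | ⟨k, x, y, rfl⟩
    · simp [trec_zero]
    · rw [trec_nd]
      have e1 : nd k x y - 1 = Nat.pair k (Nat.pair x y) := rfl
      have e2 : nd k x y ≠ 0 := Nat.succ_ne_zero _
      have gi (m : ℕ) (h : m < nd k x y) : (List.map (trec (z a) fun k x y s t => F (a, k, x, y, s, t))
          (List.range (nd k x y))).getI m = trec (z a) (fun k x y s t => F (a, k, x, y, s, t)) m := by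
        rw [List.getI_eq_getElem _ (by simpa using h)]; simp
      simp only [List.length_map, List.length_range, e1, Nat.unpair_pair, if_neg e2,
        gi _ (lt_nd_left k x y), gi _ (lt_nd_right k x y)]

/-! Codes of terms and formulas -/
def tc {m : ℕ} : LA.Term (Empty ⊕ Fin m) → ℕ
  | .var (.inr i) => nd 0 i 0
  | .func (l := 0) _ _ => nd 1 0 0
  | .func (l := 1) _ ts => nd 2 (tc (ts 0)) 0
  | .func (l := 2) f ts => nd (if (show Bool from f) then 4 else 3) (tc (ts 0)) (tc (ts 1))
  | .func (l := _ + 3) f _ => (show Empty from f).elim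

def fc : ∀ {m : ℕ}, LA.BoundedFormula Empty m → ℕ
  | m, .falsum => nd 0 m 0
  | m, .equal t u => nd 1 m (Nat.pair (tc t) (tc u))
  | m, .rel (l := 2) _ ts => nd 2 m (Nat.pair (tc (ts 0)) (tc (ts 1)))
  | _, .rel (l := 0) R _ => (show Empty from R).elim
  | _, .rel (l := 1) R _ => (show Empty from R).elim
  | _, .rel (l := _ + 3) R _ => (show Empty from R).elim
  | _, .imp φ ψ => nd 3 (fc φ) (fc ψ)
  | _, .all φ => nd 4 (fc φ) 0

theorem term_ind {m : ℕ} {C : LA.Term (Empty ⊕ Fin m) → Prop} (hv : ∀ i, C (vT i)) (hz : C zeroT)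
    (hs : ∀ t, C t → C (succT t)) (ha : ∀ t u, C t → C u → C (addT t u))
    (hm : ∀ t u, C t → C u → C (mulT t u)) (t) : C t := by
  induction t with
  | var i =>
    rcases i with i | i
    · exact i.elim
    · exact hv i
  | @func l f ts ih =>
    match l, f, ts, ih with
    | 0, f, ts, ih =>
      have : (Term.func f ts) = (zeroT : LA.Term (Empty ⊕ Fin m)) := by
        show Term.func f ts = Term.func _ _
        congr 1; exact Subsingleton.elim _ _
      rw [this]; exact hz
    | 1, f, ts, ih =>
      have : (Term.func f ts) = succT (ts 0) := by
        show Term.func f ts = Term.func _ _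
        congr 1; funext i; rw [Subsingleton.elim i 0]; rfl
      rw [this]; exact hs _ (ih 0)
    | 2, f, ts, ih =>
      match f with
      | false =>
        have : (Term.func (L := LA) (l := 2) false ts) = addT (ts 0) (ts 1) := by
          show Term.func _ ts = Term.func _ _
          congr 1; funext i; revert i; rw [Fin.forall_fin_two]; exact ⟨rfl, rfl⟩
        exact this ▸ ha _ _ (ih 0) (ih 1)
      | true =>
        have : (Term.func (L := LA) (l := 2) true ts) = mulT (ts 0) (ts 1) := by
          show Term.func _ ts = Term.func _ _
          congr 1; funext i; revert i; rw [Fin.forall_fin_two]; exact ⟨rfl, rfl⟩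
        exact this ▸ hm _ _ (ih 0) (ih 1)
    | _ + 3, f, ts, ih => exact (show Empty from f).elim

theorem fml_ind {C : ∀ m : ℕ, LA.BoundedFormula Empty m → Prop} (hf : ∀ m, C m ⊥)
    (he : ∀ m t u, C m (t =' u)) (hl : ∀ m t u, C m (leF t u))
    (hi : ∀ m φ ψ, C m φ → C m ψ → C m (φ ⟹ ψ)) (ha : ∀ m φ, C (m + 1) φ → C m (∀' φ))
    {m : ℕ} (φ : LA.BoundedFormula Empty m) : C m φ := by
  induction φ with
  | falsum => exact hf _
  | equal t u => exact he _ t u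
  | imp φ ψ h1 h2 => exact hi _ _ _ h1 h2
  | all φ h => exact ha _ _ h
  | @rel n l R ts =>
    match l, R, ts with
    | 0, R, ts => exact (show Empty from R).elim
    | 1, R, ts => exact (show Empty from R).elim
    | 2, R, ts =>
      have : (BoundedFormula.rel (L := LA) (l := 2) R ts) = leF (ts 0) (ts 1) := by
        show BoundedFormula.rel _ ts = BoundedFormula.rel _ _
        congr 1; funext i; revert i; rw [Fin.forall_fin_two]; exact ⟨rfl, rfl⟩
      rw [this]; exact hl _ _ _
    | _ + 3, R, ts => exact (show Empty from R).elim

theorem tc_v {m : ℕ} (i : Fin m) : tc (vT i) = nd 0 i 0 := rfl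
theorem tc_zero {m : ℕ} : tc (zeroT : LA.Term (Empty ⊕ Fin m)) = nd 1 0 0 := rfl
section
variable {m : ℕ} (t u : LA.Term (Empty ⊕ Fin m))
theorem tc_succ : tc (succT t) = nd 2 (tc t) 0 := rfl
theorem tc_add : tc (addT t u) = nd 3 (tc t) (tc u) := rfl
theorem tc_mul : tc (mulT t u) = nd 4 (tc t) (tc u) := rfl
theorem fc_eq : fc (t =' u) = nd 1 m (Nat.pair (tc t) (tc u)) := rfl
theorem fc_le : fc (leF t u) = nd 2 m (Nat.pair (tc t) (tc u)) := rfl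
theorem fc_falsum : fc (⊥ : LA.BoundedFormula Empty m) = nd 0 m 0 := rfl
theorem fc_imp (φ ψ : LA.BoundedFormula Empty m) : fc (φ ⟹ ψ) = nd 3 (fc φ) (fc ψ) := rfl
theorem fc_all (φ : LA.BoundedFormula Empty (m + 1)) : fc (∀' φ) = nd 4 (fc φ) 0 := rfl
end
end Guaspari

open FirstOrder Language
open scoped FirstOrder
namespace Guaspari
set_option linter.all false

def twfF (p : ℕ × ℕ × ℕ × ℕ × ℕ × ℕ) : ℕ :=
  if p.2.1 = 0 then (if p.2.2.1 < p.1 ∧ p.2.2.2.1 = 0 then 1 else 0)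
  else if p.2.1 = 1 then (if p.2.2.1 = 0 ∧ p.2.2.2.1 = 0 then 1 else 0)
  else if p.2.1 = 2 then (if p.2.2.2.1 = 0 then p.2.2.2.2.1 else 0)
  else if p.2.1 = 3 then p.2.2.2.2.1 * p.2.2.2.2.2
  else if p.2.1 = 4 then p.2.2.2.2.1 * p.2.2.2.2.2
  else 0
def twf (m c : ℕ) : ℕ := trec 0 (fun k x y s t => twfF (m, k, x, y, s, t)) c

def fwF (p : Unit × ℕ × ℕ × ℕ × ℕ × ℕ) : ℕ :=
  if p.2.1 = 0 then (if p.2.2.2.1 = 0 then p.2.2.1 + 1 else 0)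
  else if p.2.1 = 1 then (if twf p.2.2.1 p.2.2.2.1.unpair.1 = 1 ∧ twf p.2.2.1 p.2.2.2.1.unpair.2 = 1 then p.2.2.1 + 1 else 0)
  else if p.2.1 = 2 then (if twf p.2.2.1 p.2.2.2.1.unpair.1 = 1 ∧ twf p.2.2.1 p.2.2.2.1.unpair.2 = 1 then p.2.2.1 + 1 else 0)
  else if p.2.1 = 3 then (if p.2.2.2.2.1 = p.2.2.2.2.2 then p.2.2.2.2.1 else 0)
  else if p.2.1 = 4 then (if p.2.2.2.1 = 0 then p.2.2.2.2.1 - 1 else 0)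
  else 0
def fw (c : ℕ) : ℕ := trec 0 (fun k x y s t => fwF ((), k, x, y, s, t)) c

def tlF (p : Unit × ℕ × ℕ × ℕ × List ℕ × List ℕ) : List ℕ :=
  if p.2.1 = 0 then [2 * (2 * p.2.2.1 + 1)]
  else if p.2.1 = 1 then [2 * Nat.pair 0 0 + 1]
  else if p.2.1 = 2 then (2 * Nat.pair 1 0 + 1) :: p.2.2.2.2.1
  else if p.2.1 = 3 then (2 * Nat.pair 2 (Encodable.encode false) + 1) :: (p.2.2.2.2.1 ++ p.2.2.2.2.2)
  else (2 * Nat.pair 2 (Encodable.encode true) + 1) :: (p.2.2.2.2.1 ++ p.2.2.2.2.2)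
def tl (c : ℕ) : List ℕ := trec [] (fun k x y s t => tlF ((), k, x, y, s, t)) c

def tokN (n : ℕ) : ℕ := 2 * (2 * n + 1) + 1
def tokT (m c : ℕ) : ℕ := 2 * Nat.pair m (Encodable.encode (tl c))

def glF (p : Unit × ℕ × ℕ × ℕ × List ℕ × List ℕ) : List ℕ :=
  if p.2.1 = 0 then [tokN (p.2.2.1 + 2)]
  else if p.2.1 = 1 then [tokT p.2.2.1 p.2.2.2.1.unpair.1, tokT p.2.2.1 p.2.2.2.1.unpair.2]
  else if p.2.1 = 2 then [2 * (2 * Nat.pair 2 0) + 1, tokN p.2.2.1, tokT p.2.2.1 p.2.2.2.1.unpair.1, tokT p.2.2.1 p.2.2.2.1.unpair.2]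
  else if p.2.1 = 3 then tokN 0 :: (p.2.2.2.2.1 ++ p.2.2.2.2.2)
  else tokN 1 :: p.2.2.2.2.1
def gl (c : ℕ) : List ℕ := trec [] (fun k x y s t => glF ((), k, x, y, s, t)) c

section
open Primrec
section
variable {α σ τ : Type} [Primcodable α] [Primcodable σ] [Primcodable τ]
theorem p2 : Primrec (fun p : α × ℕ × ℕ × ℕ × σ × τ => p.2.1) := fst.comp snd
theorem p3 : Primrec (fun p : α × ℕ × ℕ × ℕ × σ × τ => p.2.2.1) := fst.comp (snd.comp snd)
theorem p4 : Primrec (fun p : α × ℕ × ℕ × ℕ × σ × τ => p.2.2.2.1) := fst.comp (snd.comp (snd.comp snd))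
theorem p5 : Primrec (fun p : α × ℕ × ℕ × ℕ × σ × τ => p.2.2.2.2.1) :=
  fst.comp (snd.comp (snd.comp (snd.comp snd)))
theorem p6 : Primrec (fun p : α × ℕ × ℕ × ℕ × σ × τ => p.2.2.2.2.2) :=
  snd.comp (snd.comp (snd.comp (snd.comp snd)))
theorem peq {f g : α → ℕ} (hf : Primrec f) (hg : Primrec g) : PrimrecPred (fun a => f a = g a) :=
  Primrec.eq.comp hf hg
theorem plt {f g : α → ℕ} (hf : Primrec f) (hg : Primrec g) : PrimrecPred (fun a => f a < g a) :=
  Primrec.nat_lt.comp hf hg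
theorem pmul {f g : α → ℕ} (hf : Primrec f) (hg : Primrec g) : Primrec (fun a => f a * g a) :=
  Primrec.nat_mul.comp hf hg
theorem padd {f g : α → ℕ} (hf : Primrec f) (hg : Primrec g) : Primrec (fun a => f a + g a) :=
  Primrec.nat_add.comp hf hg
theorem psub {f g : α → ℕ} (hf : Primrec f) (hg : Primrec g) : Primrec (fun a => f a - g a) :=
  Primrec.nat_sub.comp hf hg
theorem ppair {f g : α → ℕ} (hf : Primrec f) (hg : Primrec g) : Primrec (fun a => Nat.pair (f a) (g a)) :=
  Primrec₂.natPair.comp hf hg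
theorem pu1 {f : α → ℕ} (hf : Primrec f) : Primrec (fun a => (f a).unpair.1) := fst.comp (unpair.comp hf)
theorem pu2 {f : α → ℕ} (hf : Primrec f) : Primrec (fun a => (f a).unpair.2) := snd.comp (unpair.comp hf)
theorem pcons {f : α → ℕ} {g : α → List ℕ} (hf : Primrec f) (hg : Primrec g) :
    Primrec (fun a => f a :: g a) := list_cons.comp hf hg
theorem papp {f g : α → List ℕ} (hf : Primrec f) (hg : Primrec g) :
    Primrec (fun a => f a ++ g a) := list_append.comp hf hg
end

theorem twf_prim : Primrec₂ twf := by
  refine trec_prim (α := ℕ) (F := twfF) (const 0) ?_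
  unfold twfF
  repeat' with_reducible first | exact p2 | exact p3 | exact p4 | exact p5 | exact p6 | exact fst | exact const _ | apply Primrec.ite | apply PrimrecPred.and | apply peq | apply plt | apply pmul
theorem ptwf {α : Type} [Primcodable α] {f g : α → ℕ} (hf : Primrec f) (hg : Primrec g) :
    Primrec (fun a => twf (f a) (g a)) := twf_prim.comp hf hg
theorem fw_prim : Primrec fw := by
  refine (trec_prim (α := Unit) (F := fwF) (const 0) ?_).comp (const ()) Primrec.id
  unfold fwF
  repeat' with_reducible first | exact p2 | exact p3 | exact p4 | exact p5 | exact p6 | exact fst | exact const _ | apply Primrec.ite | apply PrimrecPred.and | apply peq | apply plt | apply ptwf | apply pu1 | apply pu2 | apply padd | apply psub | apply pmul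
theorem tl_prim : Primrec tl := by
  refine (trec_prim (α := Unit) (F := tlF) (const []) ?_).comp (const ()) Primrec.id
  unfold tlF
  repeat' with_reducible first | exact p2 | exact p3 | exact p4 | exact p5 | exact p6 | exact fst | exact const _ | apply Primrec.ite | apply PrimrecPred.and | apply peq | apply plt | apply pcons | apply papp | apply padd | apply pmul
theorem ptokN {α : Type} [Primcodable α] {f : α → ℕ} (hf : Primrec f) : Primrec (fun a => tokN (f a)) := by
  unfold tokN
  repeat' with_reducible first | exact hf | exact const _ | apply padd | apply pmul
theorem ptokT {α : Type} [Primcodable α] {f g : α → ℕ} (hf : Primrec f) (hg : Primrec g) :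
    Primrec (fun a => tokT (f a) (g a)) := by
  unfold tokT
  exact pmul (const _) (ppair hf (Primrec.encode.comp (tl_prim.comp hg)))
theorem gl_prim : Primrec gl := by
  refine (trec_prim (α := Unit) (F := glF) (const []) ?_).comp (const ()) Primrec.id
  unfold glF
  repeat' with_reducible first | exact p2 | exact p3 | exact p4 | exact p5 | exact p6 | exact fst | exact const _ | apply Primrec.ite | apply PrimrecPred.and | apply peq | apply plt | apply pcons | apply papp | apply ptokN | apply ptokT | apply pu1 | apply pu2 | apply padd | apply pmul
end

theorem twf_nd (m k x y : ℕ) : twf m (nd k x y) = twfF (m, k, x, y, twf m x, twf m y) := trec_nd _ _ _ _ _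
theorem twf_0 (m : ℕ) : twf m 0 = 0 := trec_zero _ _
theorem fw_nd (k x y : ℕ) : fw (nd k x y) = fwF ((), k, x, y, fw x, fw y) := trec_nd _ _ _ _ _
theorem fw_0 : fw 0 = 0 := trec_zero _ _
theorem tl_nd (k x y : ℕ) : tl (nd k x y) = tlF ((), k, x, y, tl x, tl y) := trec_nd _ _ _ _ _
theorem gl_nd (k x y : ℕ) : gl (nd k x y) = glF ((), k, x, y, gl x, gl y) := trec_nd _ _ _ _ _

theorem twf_tc {m : ℕ} (t : LA.Term (Empty ⊕ Fin m)) : twf m (tc t) = 1 := by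
  induction t using term_ind with
  | hv i => rw [tc_v, twf_nd]; simp [twfF]
  | hz => rw [tc_zero, twf_nd]; simp [twfF]
  | hs t h => rw [tc_succ, twf_nd, h]; simp [twfF]
  | ha t u h1 h2 => rw [tc_add, twf_nd, h1, h2]; simp [twfF]
  | hm t u h1 h2 => rw [tc_mul, twf_nd, h1, h2]; simp [twfF]

theorem fw_fc {m : ℕ} (φ : LA.BoundedFormula Empty m) : fw (fc φ) = m + 1 := by
  induction φ using fml_ind with
  | hf m => rw [fc_falsum, fw_nd]; simp [fwF]
  | he m t u => rw [fc_eq, fw_nd]; simp [fwF, twf_tc]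
  | hl m t u => rw [fc_le, fw_nd]; simp [fwF, twf_tc]
  | hi m φ ψ h1 h2 => rw [fc_imp, fw_nd, h1, h2]; simp [fwF]
  | ha m φ h => rw [fc_all, fw_nd, h]; simp [fwF]

theorem tc_of_twf (m c : ℕ) (h : twf m c = 1) : ∃ t : LA.Term (Empty ⊕ Fin m), tc t = c := by
  induction c using Nat.strong_induction_on with
  | _ c ih =>
    rcases zero_or_nd c with rfl | ⟨k, x, y, rfl⟩
    · rw [twf_0] at h; omega
    · have hx := ih x (lt_nd_left k x y)
      have hy := ih y (lt_nd_right k x y)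
      rw [twf_nd] at h
      simp only [twfF] at h
      split_ifs at h with h0 a0 h1 a1 h2 a2 h3 h4
      · obtain ⟨a, rfl⟩ := a0; subst h0; exact ⟨vT ⟨x, a⟩, rfl⟩
      · subst h1; exact ⟨zeroT, by rw [tc_zero, a1.1, a1.2]⟩
      · obtain ⟨t, ht⟩ := hx h
        subst h2; exact ⟨succT t, by rw [tc_succ, ht, a2]⟩
      · obtain ⟨t, ht⟩ := hx (Nat.eq_one_of_mul_eq_one_right h)
        obtain ⟨u, hu⟩ := hy (Nat.eq_one_of_mul_eq_one_left h)
        subst h3; exact ⟨addT t u, by rw [tc_add, ht, hu]⟩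
      · obtain ⟨t, ht⟩ := hx (Nat.eq_one_of_mul_eq_one_right h)
        obtain ⟨u, hu⟩ := hy (Nat.eq_one_of_mul_eq_one_left h)
        subst h4; exact ⟨mulT t u, by rw [tc_mul, ht, hu]⟩

theorem fc_of_fw (m c : ℕ) (h : fw c = m + 1) : ∃ φ : LA.BoundedFormula Empty m, fc φ = c := by
  induction c using Nat.strong_induction_on generalizing m with
  | _ c ih =>
    rcases zero_or_nd c with rfl | ⟨k, x, y, rfl⟩
    · rw [fw_0] at h; omega
    · have hx := fun m => ih x (lt_nd_left k x y) m
      have hy := fun m => ih y (lt_nd_right k x y) m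
      rw [fw_nd] at h
      simp only [fwF] at h
      split_ifs at h with h0 a0 h1 a1 h2 a2 h3 a3 h4 a4
      · subst h0; exact ⟨⊥, by rw [fc_falsum, a0]; congr 1; omega⟩
      · obtain rfl : x = m := by omega
        obtain ⟨t, ht⟩ := tc_of_twf _ _ a1.1
        obtain ⟨u, hu⟩ := tc_of_twf _ _ a1.2
        subst h1; exact ⟨t =' u, by rw [fc_eq, ht, hu, Nat.pair_unpair]⟩
      · obtain rfl : x = m := by omega
        obtain ⟨t, ht⟩ := tc_of_twf _ _ a2.1
        obtain ⟨u, hu⟩ := tc_of_twf _ _ a2.2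
        subst h2; exact ⟨leF t u, by rw [fc_le, ht, hu, Nat.pair_unpair]⟩
      · obtain ⟨φ, hφ⟩ := hx m h
        obtain ⟨ψ, hψ⟩ := hy m (a3 ▸ h)
        subst h3; exact ⟨φ ⟹ ψ, by rw [fc_imp, hφ, hψ]⟩
      · obtain ⟨φ, hφ⟩ := hx (m + 1) (by omega)
        subst h4; exact ⟨∀' φ, by rw [fc_all, hφ, a4]⟩

theorem encode_map {α : Type} [Encodable α] (l : List α) :
    Encodable.encode l = Encodable.encode (l.map Encodable.encode) := by
  induction l with
  | nil => rfl
  | cons a l ih => rw [List.map_cons, Encodable.encode_list_cons, Encodable.encode_list_cons, ih]; rfl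

theorem tl_tc {m : ℕ} (t : LA.Term (Empty ⊕ Fin m)) :
    (t.listEncode).map Encodable.encode = tl (tc t) := by
  induction t using term_ind with
  | hv i => rw [tc_v, tl_nd]; rfl
  | hz => rw [tc_zero, tl_nd]; rfl
  | hs t h => rw [tc_succ, tl_nd, ← h]; simp [tlF, succT, Functions.apply₁, Term.listEncode, List.finRange_succ]; rfl
  | ha t u h1 h2 =>
    rw [tc_add, tl_nd, ← h1, ← h2]
    simp [tlF, addT, Functions.apply₂, Term.listEncode, List.finRange_succ]; rfl
  | hm t u h1 h2 =>
    rw [tc_mul, tl_nd, ← h1, ← h2]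
    simp [tlF, mulT, Functions.apply₂, Term.listEncode, List.finRange_succ]; rfl

theorem tokT_tc {m : ℕ} (t : LA.Term (Empty ⊕ Fin m)) :
    Encodable.encode (Sum.inl ⟨m, t⟩ : (Σ k, LA.Term (Empty ⊕ Fin k)) ⊕ ((Σ n, LA.Relations n) ⊕ ℕ)) =
      tokT m (tc t) := by
  unfold tokT
  rw [← tl_tc, ← encode_map]
  rfl

theorem gl_fc {m : ℕ} (φ : LA.BoundedFormula Empty m) :
    (φ.listEncode).map Encodable.encode = gl (fc φ) := by
  induction φ using fml_ind with
  | hf m => rw [fc_falsum, gl_nd]; rfl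
  | he m t u =>
    rw [fc_eq, gl_nd]
    show [_, _] = _
    rw [tokT_tc, tokT_tc]
    simp [glF]
  | hl m t u =>
    rw [fc_le, gl_nd]
    simp only [glF, Nat.unpair_pair]
    rw [← tokT_tc, ← tokT_tc]
    rfl
  | hi m φ ψ h1 h2 =>
    rw [fc_imp, gl_nd, ← h1, ← h2]
    show List.map _ ((_ :: φ.listEncode) ++ ψ.listEncode) = _
    rw [List.map_append]; rfl
  | ha m φ h => rw [fc_all, gl_nd, ← h]; rfl

theorem gnum_eq (φ : Snt) : gnum φ = Encodable.encode (gl (fc φ)) := by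
  rw [← gl_fc, ← encode_map]; rfl

theorem gnum_inj {φ ψ : Snt} (h : gnum φ = gnum ψ) : φ = ψ := by
  have := BoundedFormula.encoding.encode_injective (Encodable.encode_injective h)
  simpa using this
end Guaspari

open FirstOrder Language
open scoped FirstOrder
namespace Guaspari
set_option linter.all false

abbrev dl (v : ℕ) : List ℕ := Denumerable.ofNat (List ℕ) v
def sn (v x : ℕ) : ℕ := Encodable.encode (dl v ++ [x])

def tevF (p : List ℕ × ℕ × ℕ × ℕ × ℕ × ℕ) : ℕ :=
  if p.2.1 = 0 then p.1.getD p.2.2.1 0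
  else if p.2.1 = 2 then nd 2 p.2.2.2.2.1 0
  else if p.2.1 = 3 then nd 3 p.2.2.2.2.1 p.2.2.2.2.2
  else if p.2.1 = 4 then nd 4 p.2.2.2.2.1 p.2.2.2.2.2
  else nd 1 0 0
def tev (v : List ℕ) (c : ℕ) : ℕ := trec (nd 1 0 0) (fun k x y s t => tevF (v, k, x, y, s, t)) c
def num (n : ℕ) : ℕ := Nat.rec (nd 1 0 0) (fun _ r => nd 2 r 0) n

def cl (c v : ℕ) := nd 0 c v
def aE (a b : ℕ) := nd 1 a b
def aL (a b : ℕ) := nd 2 a b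

abbrev R4 := (ℕ × ℕ) × ℕ × ℕ × ℕ × ℕ

def r1 (p : R4) : Cls := ([cl (nd 0 p.2.1 0) p.2.2.1], [])
def r2 (p : R4) : Cls := ([cl (nd 3 p.2.1 p.2.2.1) p.2.2.2.1, cl p.2.1 p.2.2.2.1], [cl p.2.2.1 p.2.2.2.1])
def r3 (p : R4) : Cls := ([], [cl (nd 3 p.2.1 p.2.2.1) p.2.2.2.1, cl p.2.1 p.2.2.2.1])
def r4 (p : R4) : Cls := ([cl p.2.2.1 p.2.2.2.1], [cl (nd 3 p.2.1 p.2.2.1) p.2.2.2.1])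
def r5 (p : R4) : Cls := ([cl (nd 4 p.2.1 0) p.2.2.1], [cl p.2.1 (sn p.2.2.1 p.2.2.2.1)])
def r6 (p : R4) : Cls := ([cl p.2.1 (sn p.2.2.1 (nd 5 p.2.1 p.2.2.1))], [cl (nd 4 p.2.1 0) p.2.2.1])
def r7 (p : R4) : Cls := ([cl (nd 1 p.2.1 p.2.2.1) p.2.2.2.1],
  [aE (tev (dl p.2.2.2.1) p.2.2.1.unpair.1) (tev (dl p.2.2.2.1) p.2.2.1.unpair.2)])
def r8 (p : R4) : Cls := ([aE (tev (dl p.2.2.2.1) p.2.2.1.unpair.1) (tev (dl p.2.2.2.1) p.2.2.1.unpair.2)],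
  [cl (nd 1 p.2.1 p.2.2.1) p.2.2.2.1])
def r9 (p : R4) : Cls := ([cl (nd 2 p.2.1 p.2.2.1) p.2.2.2.1],
  [aL (tev (dl p.2.2.2.1) p.2.2.1.unpair.1) (tev (dl p.2.2.2.1) p.2.2.1.unpair.2)])
def r10 (p : R4) : Cls := ([aL (tev (dl p.2.2.2.1) p.2.2.1.unpair.1) (tev (dl p.2.2.2.1) p.2.2.1.unpair.2)],
  [cl (nd 2 p.2.1 p.2.2.1) p.2.2.2.1])
def r11 (p : R4) : Cls := ([], [aE p.2.1 p.2.1])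
def r12 (p : R4) : Cls := ([aE p.2.1 p.2.2.1, aE p.2.1 p.2.2.2.1], [aE p.2.2.1 p.2.2.2.1])
def r13 (p : R4) : Cls := ([aE p.2.1 p.2.2.1], [aE (nd 2 p.2.1 0) (nd 2 p.2.2.1 0)])
def r14 (p : R4) : Cls := ([aE p.2.1 p.2.2.1, aE p.2.2.2.1 p.2.2.2.2],
  [aE (nd 3 p.2.1 p.2.2.2.1) (nd 3 p.2.2.1 p.2.2.2.2)])
def r15 (p : R4) : Cls := ([aE p.2.1 p.2.2.1, aE p.2.2.2.1 p.2.2.2.2],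
  [aE (nd 4 p.2.1 p.2.2.2.1) (nd 4 p.2.2.1 p.2.2.2.2)])
def r16 (p : R4) : Cls := ([aE p.2.1 p.2.2.1, aE p.2.2.2.1 p.2.2.2.2, aL p.2.1 p.2.2.2.1],
  [aL p.2.2.1 p.2.2.2.2])
def r17 (c : Nat.Partrec.Code) (p : R4) : Cls :=
  if fw p.2.1 = 1 ∧ (c.evaln p.2.2.1 (Encodable.encode (gl p.2.1))).isSome = true then ([], [cl p.2.1 0]) else ([0], [0])
def r18 (e : ℕ) (p : R4) : Cls := ([cl e (Encodable.encode [num p.1.1, num p.1.2])], [])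

def G (r : R4 → Cls) (a : ℕ × ℕ) (C : Cls) : Prop := ∃ x y z w, r (a, x, y, z, w) = C

theorem G_pf {r : R4 → Cls} (h : Primrec r) : PF (G r) := by
  refine ⟨fun a k => r (a, k.unpair.1, k.unpair.2.unpair.1, k.unpair.2.unpair.2.unpair.1,
    k.unpair.2.unpair.2.unpair.2), ?_, fun a C => ?_⟩
  · refine h.comp (Primrec.pair Primrec.fst (Primrec.pair ?_ (Primrec.pair ?_ (Primrec.pair ?_ ?_))))
    all_goals
      repeat' with_reducible first | exact Primrec.snd | apply pu1 | apply pu2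
  · constructor
    · rintro ⟨x, y, z, w, h⟩
      exact ⟨Nat.pair x (Nat.pair y (Nat.pair z w)), by simpa using h⟩
    · rintro ⟨k, h⟩; exact ⟨_, _, _, _, h⟩

def Fam (c : Nat.Partrec.Code) (e : ℕ) (a : ℕ × ℕ) (C : Cls) : Prop :=
  G r1 a C ∨ G r2 a C ∨ G r3 a C ∨ G r4 a C ∨ G r5 a C ∨ G r6 a C ∨ G r7 a C ∨ G r8 a C ∨ G r9 a C ∨
  G r10 a C ∨ G r11 a C ∨ G r12 a C ∨ G r13 a C ∨ G r14 a C ∨ G r15 a C ∨ G r16 a C ∨ G (r17 c) a C ∨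
  G (r18 e) a C

section
open Primrec
theorem tev_prim : Primrec₂ tev := by
  refine trec_prim (α := List ℕ) (F := tevF) (const _) ?_
  unfold tevF
  have : Primrec (fun p : List ℕ × ℕ × ℕ × ℕ × ℕ × ℕ => p.1.getD p.2.2.1 0) :=
    (list_getD 0).comp fst p3
  repeat' with_reducible first | exact this | exact p2 | exact p3 | exact p4 | exact p5 | exact p6 | exact const _ | apply Primrec.ite | apply peq | apply nd_prim
variable {α : Type} [Primcodable α] {f g : α → ℕ}
theorem pdl (hf : Primrec f) : Primrec (fun a => dl (f a)) := (Primrec.ofNat _).comp hf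
theorem ptev (hf : Primrec f) (hg : Primrec g) : Primrec (fun a => tev (dl (f a)) (g a)) :=
  tev_prim.comp (pdl hf) hg
theorem psn (hf : Primrec f) (hg : Primrec g) : Primrec (fun a => sn (f a) (g a)) :=
  Primrec.encode.comp (list_concat.comp (pdl hf) hg)
theorem pcl (hf : Primrec f) (hg : Primrec g) : Primrec (fun a => cl (f a) (g a)) := nd_prim (const _) hf hg
theorem paE (hf : Primrec f) (hg : Primrec g) : Primrec (fun a => aE (f a) (g a)) := nd_prim (const _) hf hg
theorem paL (hf : Primrec f) (hg : Primrec g) : Primrec (fun a => aL (f a) (g a)) := nd_prim (const _) hf hg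
theorem num_prim : Primrec num :=
  Primrec.nat_rec' (f := fun n : ℕ => n) (g := fun _ => nd 1 0 0) (h := fun _ p => nd 2 p.2 0) Primrec.id (const _)
    (nd_prim (const _) (snd.comp snd) (const _)).to₂
theorem pnum (hf : Primrec f) : Primrec (fun a => num (f a)) := num_prim.comp hf
theorem pcls {f g : α → List ℕ} (hf : Primrec f) (hg : Primrec g) : Primrec (fun a => ((f a, g a) : Cls)) :=
  Primrec.pair hf hg
theorem penc {f : α → List ℕ} (hf : Primrec f) : Primrec (fun a => Encodable.encode (f a)) :=
  Primrec.encode.comp hf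
theorem pev (c : Nat.Partrec.Code) (hf : Primrec f) (hg : Primrec g) :
    PrimrecPred (fun a => (c.evaln (f a) (g a)).isSome = true) :=
  Primrec.eq.comp (Primrec.option_isSome.comp (Nat.Partrec.Code.primrec_evaln.comp
    (Primrec.pair (Primrec.pair hf (const c)) hg))) (const true)

theorem r17_prim (c : Nat.Partrec.Code) : Primrec (r17 c) := by
  unfold r17
  refine Primrec.ite (PrimrecPred.and (peq (fw_prim.comp ?_) (const _)) (pev c ?_ (penc (gl_prim.comp ?_)))) (pcls (const _) (pcons (pcl ?_ (const _)) (const _))) (const _)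
  · exact fst.comp snd
  · exact fst.comp (snd.comp snd)
  · exact fst.comp snd
  · exact fst.comp snd
theorem r18_prim (e : ℕ) : Primrec (r18 e) := by
  unfold r18
  exact pcls (pcons (pcl (const _) (penc (pcons (pnum (fst.comp fst)) (pcons (pnum (snd.comp fst)) (const _))))) (const _)) (const _)

theorem Fam_pf (c : Nat.Partrec.Code) (e : ℕ) : PF (Fam c e) := by
  have q1 : Primrec (fun p : R4 => p.2.1) := fst.comp snd
  have q2 : Primrec (fun p : R4 => p.2.2.1) := fst.comp (snd.comp snd)
  have q3 : Primrec (fun p : R4 => p.2.2.2.1) := fst.comp (snd.comp (snd.comp snd))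
  have q4 : Primrec (fun p : R4 => p.2.2.2.2) := snd.comp (snd.comp (snd.comp snd))
  unfold Fam
  refine PF.or (G_pf ?_) (PF.or (G_pf ?_) (PF.or (G_pf ?_) (PF.or (G_pf ?_) (PF.or (G_pf ?_) (PF.or (G_pf ?_) (PF.or (G_pf ?_) (PF.or (G_pf ?_) (PF.or (G_pf ?_) (PF.or (G_pf ?_) (PF.or (G_pf ?_) (PF.or (G_pf ?_) (PF.or (G_pf ?_) (PF.or (G_pf ?_) (PF.or (G_pf ?_) (PF.or (G_pf ?_) (PF.or (G_pf (r17_prim c)) (G_pf (r18_prim e))))))))))))))))))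
  · unfold r1
    repeat' with_reducible first | exact q1 | exact q2 | exact q3 | exact q4 | exact const _ | apply pcls | apply pcons | apply pcl | apply paE | apply paL | apply psn | apply ptev | apply pu1 | apply pu2 | apply nd_prim
  · unfold r2
    repeat' with_reducible first | exact q1 | exact q2 | exact q3 | exact q4 | exact const _ | apply pcls | apply pcons | apply pcl | apply paE | apply paL | apply psn | apply ptev | apply pu1 | apply pu2 | apply nd_prim
  · unfold r3
    repeat' with_reducible first | exact q1 | exact q2 | exact q3 | exact q4 | exact const _ | apply pcls | apply pcons | apply pcl | apply paE | apply paL | apply psn | apply ptev | apply pu1 | apply pu2 | apply nd_prim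
  · unfold r4
    repeat' with_reducible first | exact q1 | exact q2 | exact q3 | exact q4 | exact const _ | apply pcls | apply pcons | apply pcl | apply paE | apply paL | apply psn | apply ptev | apply pu1 | apply pu2 | apply nd_prim
  · unfold r5
    repeat' with_reducible first | exact q1 | exact q2 | exact q3 | exact q4 | exact const _ | apply pcls | apply pcons | apply pcl | apply paE | apply paL | apply psn | apply ptev | apply pu1 | apply pu2 | apply nd_prim
  · unfold r6
    repeat' with_reducible first | exact q1 | exact q2 | exact q3 | exact q4 | exact const _ | apply pcls | apply pcons | apply pcl | apply paE | apply paL | apply psn | apply ptev | apply pu1 | apply pu2 | apply nd_prim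
  · unfold r7
    repeat' with_reducible first | exact q1 | exact q2 | exact q3 | exact q4 | exact const _ | apply pcls | apply pcons | apply pcl | apply paE | apply paL | apply psn | apply ptev | apply pu1 | apply pu2 | apply nd_prim
  all_goals
    first | unfold r8 | unfold r9 | unfold r10 | unfold r11 | unfold r12 | unfold r13 | unfold r14 | unfold r15 | unfold r16
    repeat' with_reducible first | exact q1 | exact q2 | exact q3 | exact q4 | exact const _ | apply pcls | apply pcons | apply pcl | apply paE | apply paL | apply psn | apply ptev | apply pu1 | apply pu2 | apply nd_prim
end
end Guaspari

open FirstOrder Language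
open scoped FirstOrder
namespace Guaspari
set_option linter.all false

structure GoodV (c : Nat.Partrec.Code) (e : ℕ) (a : ℕ × ℕ) (B : ℕ → Prop) : Prop where
  h1 : ∀ x y, ¬ B (cl (nd 0 x 0) y)
  h2 : ∀ x y z, B (cl (nd 3 x y) z) → B (cl x z) → B (cl y z)
  h3 : ∀ x y z, B (cl (nd 3 x y) z) ∨ B (cl x z)
  h4 : ∀ x y z, B (cl y z) → B (cl (nd 3 x y) z)
  h5 : ∀ x y z, B (cl (nd 4 x 0) y) → B (cl x (sn y z))
  h6 : ∀ x y, B (cl x (sn y (nd 5 x y))) → B (cl (nd 4 x 0) y)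
  h7 : ∀ x y z, B (cl (nd 1 x y) z) ↔ B (aE (tev (dl z) y.unpair.1) (tev (dl z) y.unpair.2))
  h9 : ∀ x y z, B (cl (nd 2 x y) z) ↔ B (aL (tev (dl z) y.unpair.1) (tev (dl z) y.unpair.2))
  h11 : ∀ x, B (aE x x)
  h12 : ∀ x y z, B (aE x y) → B (aE x z) → B (aE y z)
  h13 : ∀ x y, B (aE x y) → B (aE (nd 2 x 0) (nd 2 y 0))
  h14 : ∀ x y z w, B (aE x y) → B (aE z w) → B (aE (nd 3 x z) (nd 3 y w))
  h15 : ∀ x y z w, B (aE x y) → B (aE z w) → B (aE (nd 4 x z) (nd 4 y w))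
  h16 : ∀ x y z w, B (aE x y) → B (aE z w) → B (aL x z) → B (aL y w)
  h17 : ∀ x y, fw x = 1 → (c.evaln y (Encodable.encode (gl x))).isSome = true → B (cl x 0)
  h18 : ¬ B (cl e (Encodable.encode [num a.1, num a.2]))

theorem good_of {c e a B} (h : ∀ C, Fam c e a C → CSat B C) : GoodV c e a B := by
  have g1 : ∀ C, G r1 a C → CSat B C := fun C hC => h C (Or.inl hC)
  have g2 : ∀ C, G r2 a C → CSat B C := fun C hC => h C (Or.inr (Or.inl hC))
  have g3 : ∀ C, G r3 a C → CSat B C := fun C hC => h C (Or.inr (Or.inr (Or.inl hC)))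
  have g4 : ∀ C, G r4 a C → CSat B C := fun C hC => h C (Or.inr (Or.inr (Or.inr (Or.inl hC))))
  have g5 : ∀ C, G r5 a C → CSat B C := fun C hC => h C (Or.inr (Or.inr (Or.inr (Or.inr (Or.inl hC)))))
  have g6 : ∀ C, G r6 a C → CSat B C := fun C hC => h C (Or.inr (Or.inr (Or.inr (Or.inr (Or.inr (Or.inl hC))))))
  have g7 : ∀ C, G r7 a C → CSat B C := fun C hC => h C (Or.inr (Or.inr (Or.inr (Or.inr (Or.inr (Or.inr (Or.inl hC)))))))
  have g8 : ∀ C, G r8 a C → CSat B C := fun C hC => h C (Or.inr (Or.inr (Or.inr (Or.inr (Or.inr (Or.inr (Or.inr (Or.inl hC))))))))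
  have g9 : ∀ C, G r9 a C → CSat B C := fun C hC => h C (Or.inr (Or.inr (Or.inr (Or.inr (Or.inr (Or.inr (Or.inr (Or.inr (Or.inl hC)))))))))
  have g10 : ∀ C, G r10 a C → CSat B C := fun C hC => h C (Or.inr (Or.inr (Or.inr (Or.inr (Or.inr (Or.inr (Or.inr (Or.inr (Or.inr (Or.inl hC))))))))))
  have g11 : ∀ C, G r11 a C → CSat B C := fun C hC => h C (Or.inr (Or.inr (Or.inr (Or.inr (Or.inr (Or.inr (Or.inr (Or.inr (Or.inr (Or.inr (Or.inl hC)))))))))))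
  have g12 : ∀ C, G r12 a C → CSat B C := fun C hC => h C (Or.inr (Or.inr (Or.inr (Or.inr (Or.inr (Or.inr (Or.inr (Or.inr (Or.inr (Or.inr (Or.inr (Or.inl hC))))))))))))
  have g13 : ∀ C, G r13 a C → CSat B C := fun C hC => h C (Or.inr (Or.inr (Or.inr (Or.inr (Or.inr (Or.inr (Or.inr (Or.inr (Or.inr (Or.inr (Or.inr (Or.inr (Or.inl hC)))))))))))))
  have g14 : ∀ C, G r14 a C → CSat B C := fun C hC => h C (Or.inr (Or.inr (Or.inr (Or.inr (Or.inr (Or.inr (Or.inr (Or.inr (Or.inr (Or.inr (Or.inr (Or.inr (Or.inr (Or.inl hC))))))))))))))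
  have g15 : ∀ C, G r15 a C → CSat B C := fun C hC => h C (Or.inr (Or.inr (Or.inr (Or.inr (Or.inr (Or.inr (Or.inr (Or.inr (Or.inr (Or.inr (Or.inr (Or.inr (Or.inr (Or.inr (Or.inl hC)))))))))))))))
  have g16 : ∀ C, G r16 a C → CSat B C := fun C hC => h C (Or.inr (Or.inr (Or.inr (Or.inr (Or.inr (Or.inr (Or.inr (Or.inr (Or.inr (Or.inr (Or.inr (Or.inr (Or.inr (Or.inr (Or.inr (Or.inl hC))))))))))))))))
  have g17 : ∀ C, G (r17 c) a C → CSat B C := fun C hC => h C (Or.inr (Or.inr (Or.inr (Or.inr (Or.inr (Or.inr (Or.inr (Or.inr (Or.inr (Or.inr (Or.inr (Or.inr (Or.inr (Or.inr (Or.inr (Or.inr (Or.inl hC)))))))))))))))))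
  have g18 : ∀ C, G (r18 e) a C → CSat B C := fun C hC => h C (Or.inr (Or.inr (Or.inr (Or.inr (Or.inr (Or.inr (Or.inr (Or.inr (Or.inr (Or.inr (Or.inr (Or.inr (Or.inr (Or.inr (Or.inr (Or.inr (Or.inr (hC))))))))))))))))))
  constructor
  · intro x y; simpa [CSat, r1] using g1 _ ⟨x, y, 0, 0, rfl⟩
  · intro x y z; simpa [CSat, r2] using g2 _ ⟨x, y, z, 0, rfl⟩
  · intro x y z
    have := g3 _ ⟨x, y, z, 0, rfl⟩
    simp [CSat, r3] at this; tauto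
  · intro x y z; simpa [CSat, r4] using g4 _ ⟨x, y, z, 0, rfl⟩
  · intro x y z; simpa [CSat, r5] using g5 _ ⟨x, y, z, 0, rfl⟩
  · intro x y; simpa [CSat, r6] using g6 _ ⟨x, y, 0, 0, rfl⟩
  · intro x y z
    constructor
    · simpa [CSat, r7] using g7 _ ⟨x, y, z, 0, rfl⟩
    · simpa [CSat, r8] using g8 _ ⟨x, y, z, 0, rfl⟩
  · intro x y z
    constructor
    · simpa [CSat, r9] using g9 _ ⟨x, y, z, 0, rfl⟩
    · simpa [CSat, r10] using g10 _ ⟨x, y, z, 0, rfl⟩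
  · intro x; simpa [CSat, r11] using g11 _ ⟨x, 0, 0, 0, rfl⟩
  · intro x y z; simpa [CSat, r12] using g12 _ ⟨x, y, z, 0, rfl⟩
  · intro x y; simpa [CSat, r13] using g13 _ ⟨x, y, 0, 0, rfl⟩
  · intro x y z w; simpa [CSat, r14] using g14 _ ⟨x, y, z, w, rfl⟩
  · intro x y z w; simpa [CSat, r15] using g15 _ ⟨x, y, z, w, rfl⟩
  · intro x y z w; simpa [CSat, r16] using g16 _ ⟨x, y, z, w, rfl⟩
  · intro x y h1 h2
    have := g17 _ ⟨x, y, 0, 0, rfl⟩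
    rw [r17, if_pos ⟨h1, h2⟩] at this
    simpa [CSat] using this
  · simpa [CSat, r18] using g18 _ ⟨0, 0, 0, 0, rfl⟩

theorem of_good {c e a B} (g : GoodV c e a B) : ∀ C, Fam c e a C → CSat B C := by
  unfold Fam
  rintro C (h | h | h | h | h | h | h | h | h | h | h | h | h | h | h | h | h | h) <;>
    obtain ⟨x, y, z, w, rfl⟩ := h
  · simpa [CSat, r1] using g.h1 x y
  · simpa [CSat, r2] using g.h2 x y z
  · have := g.h3 x y z
    simp [CSat, r3]; tauto
  · simpa [CSat, r4] using g.h4 x y z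
  · simpa [CSat, r5] using g.h5 x y z
  · simpa [CSat, r6] using g.h6 x y
  · simpa [CSat, r7] using (g.h7 x y z).1
  · simpa [CSat, r8] using (g.h7 x y z).2
  · simpa [CSat, r9] using (g.h9 x y z).1
  · simpa [CSat, r10] using (g.h9 x y z).2
  · simpa [CSat, r11] using g.h11 x
  · simpa [CSat, r12] using g.h12 x y z
  · simpa [CSat, r13] using g.h13 x y
  · simpa [CSat, r14] using g.h14 x y z w
  · simpa [CSat, r15] using g.h15 x y z w
  · simpa [CSat, r16] using g.h16 x y z w
  · unfold r17
    split_ifs with h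
    · simpa [CSat] using g.h17 x y h.1 h.2
    · simp [CSat]
  · simpa [CSat, r18] using g.h18

theorem dl_enc (l : List ℕ) : dl (Encodable.encode l) = l := Denumerable.ofNat_encode l
theorem dl_sn (v x : ℕ) : dl (sn v x) = dl v ++ [x] := dl_enc _
theorem enc_dl (v : ℕ) : Encodable.encode (dl v) = v := Denumerable.encode_ofNat v
theorem lt_enc : ∀ (l : List ℕ) (x : ℕ), x ∈ l → x < Encodable.encode l
  | [], x, h => by simp at h
  | y :: l, x, h => by
    rw [Encodable.encode_list_cons]
    rcases List.mem_cons.1 h with rfl | h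
    · exact Nat.lt_succ_of_le (Nat.left_le_pair _ _)
    · exact (lt_enc l x h).trans_le ((Nat.right_le_pair _ _).trans (Nat.le_succ _))
theorem lt_dl (v x : ℕ) (h : x ∈ dl v) : x < v := by
  have := lt_enc _ x h
  rwa [enc_dl] at this

theorem ofFn_snoc {α : Type} {n : ℕ} (v : Fin n → α) (a : α) :
    List.ofFn (Fin.snoc v a : Fin (n + 1) → α) = List.ofFn v ++ [a] := by
  rw [List.ofFn_succ']; simp

theorem tev_nd (v k x y) : tev v (nd k x y) = tevF (v, k, x, y, tev v x, tev v y) := trec_nd _ _ _ _ _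
theorem tev_0 (v) : tev v 0 = nd 1 0 0 := trec_zero _ _

/-! Soundness -/
section
variable {N : Type} [LA.Structure N]

def tvN (w : List N) (c : ℕ) : N := trec rz (fun k x y s t =>
  if k = 0 then w.getD x rz else if k = 2 then rs s else if k = 3 then ra s t
  else if k = 4 then rm s t else rz) c
theorem tvN_nd (w : List N) (k x y : ℕ) : tvN w (nd k x y) =
  if k = 0 then w.getD x rz else if k = 2 then rs (tvN w x) else if k = 3 then ra (tvN w x) (tvN w y)
  else if k = 4 then rm (tvN w x) (tvN w y) else rz := trec_nd _ _ _ _ _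
theorem tvN_0 (w : List N) : tvN w 0 = rz := trec_zero _ _

def SatC (c : ℕ) : List N → Prop := trec (fun _ => False) (fun k x y s t w =>
  if k = 1 then tvN w y.unpair.1 = tvN w y.unpair.2 else if k = 2 then rle (tvN w y.unpair.1) (tvN w y.unpair.2)
  else if k = 3 then (s w → t w) else if k = 4 then ∀ a, s (w ++ [a]) else False) c
theorem SatC_nd (w : List N) (k x y : ℕ) : SatC (nd k x y) w =
  if k = 1 then tvN w y.unpair.1 = tvN w y.unpair.2 else if k = 2 then rle (tvN w y.unpair.1) (tvN w y.unpair.2)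
  else if k = 3 then (SatC x w → SatC y w) else if k = 4 then ∀ a, SatC x (w ++ [a]) else False :=
  congrFun (trec_nd (σ := List N → Prop) _ _ _ _ _) w

theorem tvN_tc {m : ℕ} (v : Fin m → N) (t : LA.Term (Empty ⊕ Fin m)) :
    tvN (List.ofFn v) (tc t) = t.realize (Sum.elim default v) := by
  induction t using term_ind with
  | hv i => rw [tc_v, tvN_nd, real_v]; simp
  | hz => rw [tc_zero, tvN_nd, real_zero]; simp
  | hs t h => rw [tc_succ, tvN_nd, real_succ, h]; simp
  | ha t u h1 h2 => rw [tc_add, tvN_nd, real_add, h1, h2]; simp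
  | hm t u h1 h2 => rw [tc_mul, tvN_nd, real_mul, h1, h2]; simp

theorem SatC_fc {m : ℕ} (φ : LA.BoundedFormula Empty m) : ∀ (v : Fin m → N),
    SatC (fc φ) (List.ofFn v) ↔ φ.Realize default v := by
  induction φ using fml_ind with
  | hf m => intro v; rw [fc_falsum, SatC_nd]; simp
  | he m t u => intro v; rw [fc_eq, SatC_nd, BoundedFormula.realize_bdEqual]; simp [tvN_tc]
  | hl m t u => intro v; rw [fc_le, SatC_nd, real_le]; simp [tvN_tc]
  | hi m φ ψ h1 h2 => intro v; rw [fc_imp, SatC_nd, BoundedFormula.realize_imp]; simp [h1, h2]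
  | ha m φ h =>
    intro v; rw [fc_all, SatC_nd, BoundedFormula.realize_all]
    rw [if_neg (by decide), if_neg (by decide), if_neg (by decide), if_pos rfl]
    exact forall_congr' fun a => by rw [← ofFn_snoc, h]

noncomputable def WW (c : ℕ) (w : List N) : N := by
  classical exact if h : ∃ a, ¬ SatC c (w ++ [a]) then h.choose else rz
theorem WW_spec (c : ℕ) (w : List N) (h : SatC c (w ++ [WW c w])) (a : N) : SatC c (w ++ [a]) := by
  by_contra ha
  have h' : ∃ a, ¬ SatC c (w ++ [a]) := ⟨a, ha⟩
  unfold WW at h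
  rw [dif_pos h'] at h
  exact h'.choose_spec h

noncomputable def II : ℕ → N
  | 0 => rz
  | n + 1 =>
    if n.unpair.1 = 2 then rs (II n.unpair.2.unpair.1)
    else if n.unpair.1 = 3 then ra (II n.unpair.2.unpair.1) (II n.unpair.2.unpair.2)
    else if n.unpair.1 = 4 then rm (II n.unpair.2.unpair.1) (II n.unpair.2.unpair.2)
    else if n.unpair.1 = 5 then WW n.unpair.2.unpair.1 ((dl n.unpair.2.unpair.2).attach.map (fun z => II z.1))
    else rz
termination_by n => n
decreasing_by
  all_goals first
    | exact Nat.lt_succ_of_le ((Nat.unpair_left_le _).trans (Nat.unpair_right_le _))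
    | exact Nat.lt_succ_of_le ((Nat.unpair_right_le _).trans (Nat.unpair_right_le _))
    | exact Nat.lt_succ_of_le ((lt_dl _ _ z.2).le.trans ((Nat.unpair_right_le _).trans (Nat.unpair_right_le _)))

theorem II_0 : (II 0 : N) = rz := by rw [II]
theorem II_nd (k x y : ℕ) : (II (nd k x y) : N) = if k = 2 then rs (II x)
    else if k = 3 then ra (II x) (II y) else if k = 4 then rm (II x) (II y)
    else if k = 5 then WW x ((dl y).map II) else rz := by
  unfold nd
  rw [II]
  simp

theorem II_tev (v : List ℕ) (c : ℕ) : (II (tev v c) : N) = tvN (v.map II) c := by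
  induction c using Nat.strong_induction_on with
  | _ c ih =>
    rcases zero_or_nd c with rfl | ⟨k, x, y, rfl⟩
    · rw [tev_0, tvN_0, II_nd]; simp
    · rw [tev_nd, tvN_nd, ← ih _ (lt_nd_left k x y), ← ih _ (lt_nd_right k x y), ← II_0, List.getD_map]
      unfold tevF
      dsimp only
      split_ifs <;> simp [II_nd, II_0]

theorem II_num (n : ℕ) : (II (num n) : N) = rs^[n] rz := by
  induction n with
  | zero => show II (nd 1 0 0) = _; rw [II_nd]; simp
  | succ n ih => show II (nd 2 (num n) 0) = _; rw [II_nd, Function.iterate_succ_apply', ← ih]; simp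

def BN (N : Type) [LA.Structure N] (p : ℕ) : Prop :=
  (∃ c v, p = nd 0 c v ∧ SatC c ((dl v).map (II (N := N)))) ∨ (∃ a b, p = nd 1 a b ∧ (II a : N) = II b) ∨
  (∃ a b, p = nd 2 a b ∧ rle (II a : N) (II b))
theorem BN_cl (c v : ℕ) : BN N (cl c v) ↔ SatC c ((dl v).map (II (N := N))) := by
  simp [BN, cl, nd_inj]
theorem BN_aE (a b : ℕ) : BN N (aE a b) ↔ (II a : N) = II b := by
  simp [BN, aE, nd_inj]
theorem BN_aL (a b : ℕ) : BN N (aL a b) ↔ rle (II a : N) (II b) := by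
  simp [BN, aL, nd_inj]

theorem sound5 (T : Thy) (c : Nat.Partrec.Code) (hc : ∀ a, (c.eval a).Dom → ∃ φ ∈ T, gnum φ = a)
    (hN : N ⊨ T) (χ : LA.BoundedFormula Empty 2) (a : ℕ × ℕ)
    (h : ¬ χ.Realize default ![(rs^[a.1] rz : N), rs^[a.2] rz]) : GoodV c (fc χ) a (BN N) := by
  constructor <;> simp only [BN_cl, BN_aE, BN_aL, dl_sn, dl_enc, SatC_nd, II_tev, List.map_append, List.map_cons, List.map_nil]
  · simp
  · intro x y z; simp
  · intro x y z; simp; tauto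
  · intro x y z; simp; tauto
  · intro x y z; simp; exact fun h => h _
  · intro x y; simp [II_nd]; exact WW_spec _ _
  · intro x y z; simp
  · intro x y z; simp
  · simp
  · intro x y z h1 h2; rw [← h1, h2]
  · intro x y h; simp [II_nd, h]
  · intro x y z w h1 h2; simp [II_nd, h1, h2]
  · intro x y z w h1 h2; simp [II_nd, h1, h2]
  · intro x y z w h1 h2 h3; rwa [← h1, ← h2]
  · intro x y h1 h2
    obtain ⟨φ, rfl⟩ := fc_of_fw 0 x h1
    obtain ⟨b, hb⟩ := Option.isSome_iff_exists.1 h2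
    have hd := Nat.Partrec.Code.evaln_sound hb
    obtain ⟨ψ, hψ, e⟩ := hc _ (Part.dom_iff_mem.2 ⟨b, hd⟩)
    rw [← gnum_eq] at e
    obtain rfl := gnum_inj e
    have : dl 0 = [] := dl_enc []
    rw [this]
    have h3 := hN.realize_of_mem _ hψ
    have := (SatC_fc ψ (default : Fin 0 → N)).2 h3
    simpa using this
  · rw [II_num, II_num]
    intro h'
    apply h
    rw [← SatC_fc]
    simpa using h'
end
end Guaspari

open FirstOrder Language
open scoped FirstOrder
namespace Guaspari
set_option linter.all false

section
variable {c : Nat.Partrec.Code} {e : ℕ} {a : ℕ × ℕ} {B : ℕ → Prop} (g : GoodV c e a B)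

def gset (g : GoodV c e a B) : Setoid ℕ where
  r x y := B (aE x y)
  iseqv := ⟨g.h11, fun h => g.h12 _ _ _ h (g.h11 _), fun h1 h2 => g.h12 _ _ _ (g.h12 _ _ _ h1 (g.h11 _)) h2⟩

def GQ (g : GoodV c e a B) : Type := Quotient (gset g)
def gmk (x : ℕ) : GQ g := Quotient.mk (gset g) x
theorem gmk_eq (x y : ℕ) : gmk g x = gmk g y ↔ B (aE x y) := Quotient.eq (r := gset g)
theorem gmk_surj (q : GQ g) : ∃ x, gmk g x = q := Quotient.exists_rep q
noncomputable def gout (q : GQ g) : ℕ := (gmk_surj g q).choose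
theorem gout_mk (x : ℕ) : B (aE (gout g (gmk g x)) x) :=
  (gmk_eq g _ _).1 (gmk_surj g (gmk g x)).choose_spec

noncomputable instance gstr : LA.Structure (GQ g) where
  funMap {n} f v := match n, f with
    | 0, _ => gmk g (nd 1 0 0)
    | 1, _ => gmk g (nd 2 (gout g (v 0)) 0)
    | 2, false => gmk g (nd 3 (gout g (v 0)) (gout g (v 1)))
    | 2, true => gmk g (nd 4 (gout g (v 0)) (gout g (v 1)))
  RelMap {n} r v := match n, r with
    | 2, _ => B (aL (gout g (v 0)) (gout g (v 1)))

theorem g_rz : (rz : GQ g) = gmk g (nd 1 0 0) := rfl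
theorem g_rs (x : ℕ) : rs (gmk g x) = gmk g (nd 2 x 0) :=
  (gmk_eq g _ _).2 (g.h13 _ _ (gout_mk g x))
theorem g_ra (x y : ℕ) : ra (gmk g x) (gmk g y) = gmk g (nd 3 x y) :=
  (gmk_eq g _ _).2 (g.h14 _ _ _ _ (gout_mk g x) (gout_mk g y))
theorem g_rm (x y : ℕ) : rm (gmk g x) (gmk g y) = gmk g (nd 4 x y) :=
  (gmk_eq g _ _).2 (g.h15 _ _ _ _ (gout_mk g x) (gout_mk g y))
theorem g_symm (g : GoodV c e a B) {x y : ℕ} (h : B (aE x y)) : B (aE y x) := g.h12 _ _ _ h (g.h11 _)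
theorem g_rle (x y : ℕ) : rle (gmk g x) (gmk g y) ↔ B (aL x y) :=
  ⟨g.h16 _ _ _ _ (gout_mk g x) (gout_mk g y), g.h16 _ _ _ _ (g_symm g (gout_mk g x)) (g_symm g (gout_mk g y))⟩

theorem g_tev {m : ℕ} (v : Fin m → ℕ) (t : LA.Term (Empty ⊕ Fin m)) :
    t.realize (Sum.elim default (fun i => gmk g (v i))) = gmk g (tev (List.ofFn v) (tc t)) := by
  induction t using term_ind with
  | hv i => rw [tc_v, tev_nd, real_v]; simp [tevF]
  | hz => rw [tc_zero, tev_nd, real_zero]; simp [tevF, g_rz]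
  | hs t h => rw [tc_succ, tev_nd, real_succ, h]; simp [tevF, g_rs]
  | ha t u h1 h2 => rw [tc_add, tev_nd, real_add, h1, h2]; simp [tevF, g_ra]
  | hm t u h1 h2 => rw [tc_mul, tev_nd, real_mul, h1, h2]; simp [tevF, g_rm]

theorem g_truth {m : ℕ} (φ : LA.BoundedFormula Empty m) : ∀ (v : Fin m → ℕ),
    B (cl (fc φ) (Encodable.encode (List.ofFn v))) ↔ φ.Realize default (fun i => gmk g (v i)) := by
  induction φ using fml_ind with
  | hf m => intro v; rw [fc_falsum]; exact iff_of_false (g.h1 _ _) (fun h => h)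
  | he m t u => intro v; rw [fc_eq, BoundedFormula.realize_bdEqual, g.h7, dl_enc, g_tev, g_tev, gmk_eq]; simp
  | hl m t u => intro v; rw [fc_le, real_le, g.h9, dl_enc, g_tev, g_tev, g_rle]; simp
  | hi m φ ψ h1 h2 =>
    intro v; rw [fc_imp, BoundedFormula.realize_imp, ← h1, ← h2]
    have a1 := g.h2 (fc φ) (fc ψ) (Encodable.encode (List.ofFn v))
    have a2 := g.h3 (fc φ) (fc ψ) (Encodable.encode (List.ofFn v))
    have a3 := g.h4 (fc φ) (fc ψ) (Encodable.encode (List.ofFn v))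
    tauto
  | ha m φ h =>
    intro v; rw [fc_all, BoundedFormula.realize_all]
    have key (x : ℕ) : B (cl (fc φ) (sn (Encodable.encode (List.ofFn v)) x)) ↔
        φ.Realize default (Fin.snoc (fun i => gmk g (v i)) (gmk g x)) := by
      have := h (Fin.snoc v x)
      rw [ofFn_snoc] at this
      unfold sn
      rw [dl_enc, this]
      have e : (fun i => gmk g ((Fin.snoc v x : Fin (m + 1) → ℕ) i)) = Fin.snoc (fun i => gmk g (v i)) (gmk g x) := by
        funext i
        refine Fin.lastCases ?_ (fun i => ?_) i <;> simp
      rw [e]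
    constructor
    · intro hb q
      obtain ⟨x, rfl⟩ := gmk_surj g q
      exact (key x).1 (g.h5 _ _ _ hb)
    · intro hr
      exact g.h6 _ _ ((key _).2 (hr _))

theorem g_num (n : ℕ) : (rs^[n] rz : GQ g) = gmk g (num n) := by
  induction n with
  | zero => rfl
  | succ n ih => rw [Function.iterate_succ_apply', ih, g_rs]; rfl
end

theorem compl (T : Thy) (c : Nat.Partrec.Code) (hc : ∀ φ ∈ T, (c.eval (gnum φ)).Dom)
    (χ : LA.BoundedFormula Empty 2) (a : ℕ × ℕ) (B : ℕ → Prop) (g : GoodV c (fc χ) a B) :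
    ∃ M : Theory.ModelType.{0,0,0} T, ¬ χ.Realize default ![(rs^[a.1] rz : M), rs^[a.2] rz] := by
  have hM : GQ g ⊨ T := by
    refine ⟨fun φ hφ => ?_⟩
    have := (g_truth g φ (default : Fin 0 → ℕ)).1 (by
      obtain ⟨b, hb⟩ := Part.dom_iff_mem.1 (hc φ hφ)
      obtain ⟨k, hk⟩ := Nat.Partrec.Code.evaln_complete.1 hb
      have h1 := g.h17 (fc φ) k (fw_fc φ) (by rw [← gnum_eq, hk]; rfl)
      simpa using h1)
    have e : (fun i => gmk g ((default : Fin 0 → ℕ) i)) = default := Subsingleton.elim _ _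
    rw [e] at this
    exact this
  haveI : Nonempty (GQ g) := ⟨gmk g 0⟩
  refine ⟨⟨GQ g⟩, ?_⟩
  intro h
  apply g.h18
  have := (g_truth g χ ![num a.1, num a.2]).2 (by
    convert h using 1
    funext i
    revert i
    rw [Fin.forall_fin_two]
    exact ⟨(g_num g _).symm, (g_num g _).symm⟩)
  simpa using this

theorem re_thm (T : Thy) (hT : CompThy T) (χ : LA.BoundedFormula Empty 2) :
    REPred (fun p : ℕ × ℕ => ∀ M : Theory.ModelType.{0,0,0} T,
      χ.Realize default ![(rs^[p.1] rz : M), rs^[p.2] rz]) := by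
  have h1 : REPred (fun m : ℕ => ∃ φ ∈ T, gnum φ = m) := ComputablePred.to_re hT
  obtain ⟨c, hc⟩ : ∃ c : Nat.Partrec.Code, ∀ a, (c.eval a).Dom ↔ ∃ φ ∈ T, gnum φ = a := by
    have h2 : Nat.Partrec (fun a => (Part.assert (∃ φ ∈ T, gnum φ = a) fun _ => Part.some ()).map fun _ => 0) := by
      exact Partrec.nat_iff.1 (Partrec.map h1 (Computable.const 0).to₂)
    obtain ⟨c, hc⟩ := Nat.Partrec.Code.exists_code.1 h2
    refine ⟨c, fun a => ?_⟩
    rw [hc]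
    simp [Part.assert]
  have h2 := (Fam_pf c (fc χ)).re
  refine h2.of_eq fun p => ?_
  constructor
  · intro h M
    by_contra hM
    exact h ⟨_, of_good (sound5 T c (fun a ha => (hc a).1 ha) M.is_model χ p hM)⟩
  · rintro h ⟨B, hB⟩
    obtain ⟨M, hM⟩ := compl T c (fun φ hφ => (hc _).2 ⟨φ, hφ, rfl⟩) χ p B (good_of hB)
    exact hM (h M)
end Guaspari

open FirstOrder Language
open scoped FirstOrder
namespace Guaspari
set_option linter.all false

/-! ### Semantic form of provability -/
def Mo (T : Thy) (M : PAM) : Prop := ∀ φ ∈ T, Sentence.Realize M φ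

theorem prv_iff {T : Thy} (hT : ExtPA T) (φ : Snt) : Prv T φ ↔ ∀ M : PAM, Mo T M → Sentence.Realize M φ := by
  unfold Prv
  rw [Theory.models_sentence_iff]
  constructor
  · intro h M hM
    haveI : (M : Type) ⊨ T := ⟨hM⟩
    exact h ⟨M⟩
  · intro h M
    haveI : (M : Type) ⊨ PAAx := ⟨fun ψ hψ => by
      have := hT ψ hψ
      unfold Prv at this
      rw [Theory.models_sentence_iff] at this
      exact this M⟩
    exact h ⟨M⟩ (fun φ hφ => M.is_model.realize_of_mem φ hφ)

theorem prv_mem {T : Thy} {φ : Snt} (h : φ ∈ T) : Prv T φ :=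
  Theory.models_sentence_of_mem h
theorem ext_of_sub {T T' : Thy} (h : T ⊆ T') (hT : ExtPA T) : ExtPA T' := fun φ hφ => by
  have h0 := hT φ hφ
  unfold Prv at h0 ⊢
  rw [Theory.models_sentence_iff] at h0 ⊢
  intro M
  haveI : (M : Type) ⊨ T := Theory.Model.mono M.is_model h
  exact h0 ⟨M⟩
theorem ext_PA : ExtPA PAAx := fun φ h => prv_mem h
theorem ext_add {T : Thy} (hT : ExtPA T) (φ : Snt) : ExtPA (add T φ) := ext_of_sub (Set.subset_insert _ _) hT
theorem mo_add {T : Thy} {φ : Snt} {M : PAM} : Mo (add T φ) M ↔ Sentence.Realize M φ ∧ Mo T M := by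
  simp [Mo, add]
theorem mo_union {T U : Thy} {M : PAM} : Mo (T ∪ U) M ↔ Mo T M ∧ Mo U M := by
  simp only [Mo, Set.mem_union, or_imp, forall_and]
theorem mo_PA (M : PAM) : Mo PAAx M := fun φ h => M.is_model.realize_of_mem φ h
theorem mo_of_prv {T : Thy} (hT : ExtPA T) {M : PAM} (hM : Mo T M) {φ : Snt} (h : Prv T φ) :
    Sentence.Realize M φ := (prv_iff hT φ).1 h M hM
theorem con_iff {T : Thy} (hT : ExtPA T) : Con T ↔ ∃ M : PAM, Mo T M := by
  unfold Con
  rw [prv_iff hT]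
  push Not
  exact ⟨fun ⟨M, h, _⟩ => ⟨M, h⟩, fun ⟨M, h⟩ => ⟨M, h, fun h => h⟩⟩
theorem r_and {M : PAM} (φ ψ : Snt) : Sentence.Realize M (φ ⊓ ψ) ↔ Sentence.Realize M φ ∧ Sentence.Realize M ψ :=
  BoundedFormula.realize_inf
theorem r_or {M : PAM} (φ ψ : Snt) : Sentence.Realize M (φ ⊔ ψ) ↔ Sentence.Realize M φ ∨ Sentence.Realize M ψ :=
  BoundedFormula.realize_sup
theorem r_imp {M : PAM} (φ ψ : Snt) : Sentence.Realize M (φ ⟹ ψ) ↔ (Sentence.Realize M φ → Sentence.Realize M ψ) :=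
  BoundedFormula.realize_imp

theorem sg_of {k : ℕ} {P : Pd 0} (h : Sg k P) : ∃ φ ∈ SigmaS k, ∀ M : PAM, Sentence.Realize M φ ↔ P M default :=
  let ⟨φ, h1, h2⟩ := h; ⟨φ, h1, fun M => h2 M default⟩
theorem pi_of {k : ℕ} {P : Pd 0} (h : Pi k P) : ∃ φ ∈ PiS k, ∀ M : PAM, Sentence.Realize M φ ↔ P M default :=
  let ⟨φ, h1, h2⟩ := h; ⟨φ, h1, fun M => h2 M default⟩
theorem of_sg {k : ℕ} {φ : Snt} (h : φ ∈ SigmaS k) : Sg k (m := 0) (fun M v => Sentence.Realize M φ) :=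
  ⟨φ, h, fun M v => by rw [Subsingleton.elim v default]; rfl⟩
theorem of_pi {k : ℕ} {φ : Snt} (h : φ ∈ PiS k) : Pi k (m := 0) (fun M v => Sentence.Realize M φ) :=
  ⟨φ, h, fun M v => by rw [Subsingleton.elim v default]; rfl⟩

def S (k : ℕ) {M : PAM} (e : M) : Prop := UU k e 0
theorem S_sg (k : ℕ) : Sg (k + 1) (m := 1) (fun M v => S k (v 0)) :=
  (UU_sg k).s2 (IsTm.var _) IsTm.zero
theorem S_sig {k : ℕ} {φ : Snt} (h : φ ∈ SigmaS (k + 1)) : ∃ e : ℕ, ∀ M : PAM, Sentence.Realize M φ ↔ S k (e : M) := by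
  obtain ⟨e, he⟩ := univ k (of_sg h)
  exact ⟨e, fun M => he M default⟩
theorem S_pi {k : ℕ} {φ : Snt} (h : φ ∈ PiS (k + 1)) : ∃ e : ℕ, ∀ M : PAM, Sentence.Realize M φ ↔ ¬ S k (e : M) := by
  obtain ⟨e, he⟩ := univ k (of_pi h).not
  exact ⟨e, fun M => by rw [← not_not (a := Sentence.Realize M φ), he M default]; rfl⟩

theorem Pi.ball {k m : ℕ} {f : Fu m} {P : ∀ M : PAM, (Fin m → M) → M → Prop} (hf : IsTm f)
    (h : Pi k (m := m + 1) (fun M w => P M (fun i => w i.castSucc) (w (Fin.last m)))) :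
    Pi k (fun M v => ∀ x ≤ f M v, P M v x) := by
  cases k with
  | zero => exact (D0.ball hf h.d0).pi0
  | succ k =>
    apply Pi.all
    apply Pi.imp
    · exact (D0.le (IsTm.var _) hf.wk).sg
    · exact h

theorem num_cast (M : PAM) (n : ℕ) : (rs^[n] rz : M) = (n : M) := by
  induction n with
  | zero => simp [rz_eq]
  | succ n ih => rw [Function.iterate_succ_apply', ih, rs_eq]; push_cast; rfl

/-! ### The sentences -/
section
variable (D : ∀ M : PAM, M → M → M → Prop) (k : ℕ) {M : PAM}
def HH (d x a : M) : Prop := ∃ w ≤ x, D M d a w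
def Ev1 (d x : M) : Prop := HH D d x (J 0 2)
def Ev2 (d x : M) : Prop := HH D d x (J 0 3)
def sig0 (d : M) : Prop := (∃ x, ∃ e, e ≤ x ∧ HH D d x (J e 0) ∧ ¬ Ev1 D d x ∧ ¬ Ev2 D d x ∧ S k e) ∨
  ∃ x, Ev2 D d x ∧ ¬ Ev1 D d x
def SF (d x : M) : Prop := ∃ p q r : M, (∀ e ≤ x, HH D d x (J e 1) → ∃ w ≤ r, Mem p q r (J e w)) ∧
  ∀ e ≤ r, ∀ w ≤ r, Mem p q r (J e w) → BB k e 0 w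
def pi0' (d : M) : Prop := ¬ ∃ x, (Ev2 D d x ∧ ¬ Ev1 D d x) ∧ SF D k d x
def chi (d a : M) : Prop :=
  (∃ e, a = J e 0 ∧ (sig0 D k d ∧ pi0' D k d → ¬ S k e)) ∨
  (∃ e, a = J e 1 ∧ (sig0 D k d ∧ pi0' D k d → S k e)) ∨
  (a = J 0 2 ∧ sig0 D k d) ∨ (a = J 0 3 ∧ pi0' D k d)

variable {D}
theorem HH_d0 (hD : D0 (m := 3) (fun M v => D M (v 0) (v 1) (v 2))) : D0 (m := 3) (fun M v => HH D (v 0) (v 1) (v 2)) := by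
  unfold HH
  repeat' with_reducible (first | apply IsTm.var | apply D0.bex | apply hD.s3)
theorem Ev1_d0 (hD : D0 (m := 3) (fun M v => D M (v 0) (v 1) (v 2))) : D0 (m := 2) (fun M v => Ev1 D (v 0) (v 1)) :=
  (HH_d0 hD).s3 (IsTm.var _) (IsTm.var _) (IsTm.J IsTm.zero (IsTm.ofNat 2))
theorem Ev2_d0 (hD : D0 (m := 3) (fun M v => D M (v 0) (v 1) (v 2))) : D0 (m := 2) (fun M v => Ev2 D (v 0) (v 1)) :=
  (HH_d0 hD).s3 (IsTm.var _) (IsTm.var _) (IsTm.J IsTm.zero (IsTm.ofNat 3))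
theorem sig0_sg (hD : D0 (m := 3) (fun M v => D M (v 0) (v 1) (v 2))) : Sg (k + 1) (m := 1) (fun M v => sig0 D k (v 0)) := by
  unfold sig0
  apply Sg.or
  · apply Sg.ex
    apply Sg.ex
    refine Sg.and (D0.sg (D0.le ?_ ?_)) (Sg.and (D0.sg ((HH_d0 hD).s3 ?_ ?_ ?_)) (Sg.and (D0.sg (D0.not ((Ev1_d0 hD).s2 ?_ ?_)))
      (Sg.and (D0.sg (D0.not ((Ev2_d0 hD).s2 ?_ ?_))) ((S_sg k).s1 ?_))))
    all_goals repeat' with_reducible (first | apply IsTm.var | apply IsTm.J | apply IsTm.zero)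
  · apply Sg.ex
    refine Sg.and (D0.sg ((Ev2_d0 hD).s2 ?_ ?_)) (D0.sg (D0.not ((Ev1_d0 hD).s2 ?_ ?_)))
    all_goals repeat' with_reducible (first | apply IsTm.var | apply IsTm.J | apply IsTm.zero)
theorem SF_sg (hD : D0 (m := 3) (fun M v => D M (v 0) (v 1) (v 2))) : Sg (k + 1) (m := 2) (fun M v => SF D k (v 0) (v 1)) := by
  unfold SF
  apply Sg.ex
  apply Sg.ex
  apply Sg.ex
  apply Sg.and
  · apply D0.sg
    repeat' with_reducible (first | apply IsTm.var | apply IsTm.zero | apply IsTm.one | apply IsTm.J | apply D0.ball | apply D0.bex | apply D0.imp | apply (HH_d0 hD).s3 | apply Mem_d0.s4)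
  · apply Pi.sg
    apply Pi.ball (IsTm.var _)
    apply Pi.ball (IsTm.var _)
    apply Pi.imp
    · apply D0.sg
      repeat' with_reducible (first | apply IsTm.var | apply IsTm.J | apply Mem_d0.s4)
    · exact (BB_pi k).s3 (IsTm.var _) IsTm.zero (IsTm.var _)
theorem pi0_pi (hD : D0 (m := 3) (fun M v => D M (v 0) (v 1) (v 2))) : Pi (k + 1) (m := 1) (fun M v => pi0' D k (v 0)) := by
  unfold pi0'
  apply Sg.not
  apply Sg.ex
  refine Sg.and (Sg.and (D0.sg ((Ev2_d0 hD).s2 ?_ ?_)) (D0.sg (D0.not ((Ev1_d0 hD).s2 ?_ ?_)))) ((SF_sg k hD).s2 ?_ ?_)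
  all_goals exact IsTm.var _
theorem chi_df (hD : D0 (m := 3) (fun M v => D M (v 0) (v 1) (v 2))) : Df (m := 2) (fun M v => chi D k (v 0) (v 1)) := by
  have h1 := (sig0_sg k hD).toDf
  have h2 := (pi0_pi k hD).toDf
  have h3 := (S_sg k).toDf
  unfold chi
  repeat' with_reducible (first | apply IsTm.var | apply IsTm.zero | apply IsTm.one | apply IsTm.ofNat | apply IsTm.J | apply Df.eq | apply Df.or | apply Df.ex | apply Df.and | apply Df.not | apply Df.imp | apply h1.s1 | apply h2.s1 | apply h3.s1)
end

section
variable {D : ∀ M : PAM, M → M → M → Prop} {k : ℕ} {M : PAM}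
theorem HH.mono {d x y a : M} (h : HH D d x a) (hx : x ≤ y) : HH D d y a :=
  let ⟨w, h1, h2⟩ := h; ⟨w, h1.trans hx, h2⟩
theorem SF_imp {d x e : M} (h : SF D k d x) (he : e ≤ x) (hc : HH D d x (J e 1)) : S k e := by
  obtain ⟨p, q, r, h1, h2⟩ := h
  obtain ⟨w, hw, hm⟩ := h1 e he hc
  exact ⟨w, h2 e ((le_J_left _ _).trans (Mem_le hm)) w hw hm⟩
theorem wit_set (l : List M) (h : ∀ e ∈ l, S k e) : ∃ p q r : M, (∀ e ∈ l, ∃ w, Mem p q r (J e w)) ∧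
    ∀ e w, Mem p q r (J e w) → BB k e 0 w := by
  induction l with
  | nil =>
    obtain ⟨p, q, r, h⟩ := emp (M := M)
    exact ⟨p, q, r, by simp, fun e w h' => (h _ h').elim⟩
  | cons e0 l ih =>
    obtain ⟨p, q, r, h1, h2⟩ := ih (fun e he => h e (List.mem_cons_of_mem _ he))
    obtain ⟨w0, hw0⟩ := h e0 List.mem_cons_self
    obtain ⟨P, Q, R, h3⟩ := ins p q r p q r (J e0 w0)
    refine ⟨P, Q, R, fun e he => ?_, fun e w hm => ?_⟩
    · rcases List.mem_cons.1 he with rfl | he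
      · exact ⟨w0, (h3 _).2 (Or.inr (Or.inr rfl))⟩
      · obtain ⟨w, hw⟩ := h1 e he
        exact ⟨w, (h3 _).2 (Or.inl hw)⟩
    · rcases (h3 _).1 hm with h | h | h
      · exact h2 _ _ h
      · exact h2 _ _ h
      · obtain ⟨rfl, rfl⟩ := J_inj h
        exact hw0
theorem SF_of {d x : M} (l : List M) (hl : ∀ e ≤ x, HH D d x (J e 1) → e ∈ l) (h : ∀ e ∈ l, S k e) : SF D k d x := by
  obtain ⟨p, q, r, h1, h2⟩ := wit_set l h
  refine ⟨p, q, r, fun e he hc => ?_, fun e _ w _ hm => h2 e w hm⟩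
  obtain ⟨w, hw⟩ := h1 e (hl e he hc)
  exact ⟨w, (le_J_right _ _).trans (Mem_le hw), hw⟩
end
end Guaspari

open FirstOrder Language
open scoped FirstOrder
namespace Guaspari
set_option linter.all false

def Wn (D : ∀ M : PAM, M → M → M → Prop) (d x a : ℕ) : Prop := ∃ w ≤ x, D NatM d a w
def FX (D : ∀ M : PAM, M → M → M → Prop) (k d : ℕ) (T U : Thy) : Prop :=
  ∀ a : ℕ, (∃ x, Wn D d x a) ↔
    (∀ M : PAM, Mo T M → chi D k (d : M) (a : M)) ∨ (∀ M : PAM, Mo U M → chi D k (d : M) (a : M))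
theorem FX.symm {D k d T U} (h : FX D k d T U) : FX D k d U T := fun a => (h a).trans or_comm

theorem re_mo {T : Thy} (hT : GoodThy T) (χ : LA.BoundedFormula Empty 2)
    {P : ∀ M : PAM, M → M → Prop} (h : ∀ (M : PAM) (v : Fin 2 → M), χ.Realize default v ↔ P M (v 0) (v 1)) :
    REPred (fun p : ℕ × ℕ => ∀ M : PAM, Mo T M → P M (p.1 : M) (p.2 : M)) := by
  refine (re_thm T hT.1 χ).of_eq fun p => ?_
  constructor
  · intro h1 M hM
    haveI : (M : Type) ⊨ T := ⟨hM⟩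
    have h2 := h1 ⟨M⟩
    have h3 := (h M ![(rs^[p.1] rz : M), rs^[p.2] rz]).1 h2
    simpa [num_cast] using h3
  · intro h1 M
    haveI : (M : Type) ⊨ PAAx := ⟨fun ψ hψ => by
      have h0 := hT.2.2 ψ hψ
      unfold Prv at h0
      rw [Theory.models_sentence_iff] at h0
      exact h0 M⟩
    let N : PAM := ⟨M⟩
    have h2 := h1 N (fun φ hφ => M.is_model.realize_of_mem φ hφ)
    have h3 := (h N ![(rs^[p.1] rz : N), rs^[p.2] rz]).2 (by simpa [num_cast] using h2)
    exact h3

theorem exists_FX {T U : Thy} (hT : GoodThy T) (hU : GoodThy U) (k : ℕ) :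
    ∃ D : ∀ M : PAM, M → M → M → Prop, D0 (m := 3) (fun M v => D M (v 0) (v 1) (v 2)) ∧
      ∃ d : ℕ, FX D k d T U := by
  obtain ⟨D, hD, hE⟩ := exists_enum
  obtain ⟨χ, hχ⟩ := chi_df k hD
  have h1 := re_mo hT χ (P := fun M a b => chi D k a b) hχ
  have h2 := re_mo hU χ (P := fun M a b => chi D k a b) hχ
  obtain ⟨g, hg, hg2⟩ := Partrec.merge' h1 h2
  have h3 : Partrec₂ (fun (c : Nat.Partrec.Code) (a : ℕ) => (g (Encodable.encode c, a)).map (fun _ => (0 : ℕ))) := by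
    have h4 : Computable (fun p : Nat.Partrec.Code × ℕ => (Encodable.encode p.1, p.2)) :=
      (Computable.encode.comp Computable.fst).pair Computable.snd
    exact (hg.comp h4).map (Computable.const 0).to₂
  obtain ⟨c, hc⟩ := Nat.Partrec.Code.fixed_point₂ h3
  refine ⟨D, hD, Encodable.encode c, fun a => ?_⟩
  have h5 := hE c a
  rw [hc] at h5
  have h6 := (hg2 (Encodable.encode c, a)).2
  simp only [Part.map_Dom] at h5
  rw [h6] at h5
  have h7 : (∃ x, Wn D (Encodable.encode c) x a) ↔ ∃ w : ℕ, D NatM (Encodable.encode c : ℕ) a w :=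
    ⟨fun ⟨x, w, _, h⟩ => ⟨w, h⟩, fun ⟨w, h⟩ => ⟨w, w, le_rfl, h⟩⟩
  rw [h7, ← h5]
  simp [Part.assert]

section
variable {D : ∀ M : PAM, M → M → M → Prop} {k d : ℕ} {T U : Thy}

theorem Wn.mono {x y a : ℕ} (h : Wn D d x a) (hx : x ≤ y) : Wn D d y a :=
  let ⟨w, h1, h2⟩ := h; ⟨w, h1.trans hx, h2⟩

theorem HH_abs (hD : D0 (m := 3) (fun M v => D M (v 0) (v 1) (v 2))) (M : PAM) (x a : ℕ) :
    HH D (d : M) (x : M) (a : M) ↔ Wn D d x a := by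
  constructor
  · rintro ⟨w, h1, h2⟩
    obtain ⟨w, h3, rfl⟩ := le_nat x w h1
    exact ⟨w, h3, (hD.abs (M := M) ![d, a, w]).1 h2⟩
  · rintro ⟨w, h1, h2⟩
    exact ⟨w, by exact_mod_cast h1, (hD.abs (M := M) ![d, a, w]).2 h2⟩
theorem HH_0 (hD : D0 (m := 3) (fun M v => D M (v 0) (v 1) (v 2))) (M : PAM) (x e : ℕ) :
    HH D (d : M) (x : M) (J (e : M) 0) ↔ Wn D d x (jn e 0) := by
  rw [← HH_abs hD M, jn_cast]; simp
theorem HH_1 (hD : D0 (m := 3) (fun M v => D M (v 0) (v 1) (v 2))) (M : PAM) (x e : ℕ) :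
    HH D (d : M) (x : M) (J (e : M) 1) ↔ Wn D d x (jn e 1) := by
  rw [← HH_abs hD M, jn_cast]; simp
theorem Ev1_abs (hD : D0 (m := 3) (fun M v => D M (v 0) (v 1) (v 2))) (M : PAM) (x : ℕ) :
    Ev1 D (d : M) (x : M) ↔ Wn D d x (jn 0 2) := by
  rw [← HH_abs hD M, jn_cast]; simp [Ev1]
theorem Ev2_abs (hD : D0 (m := 3) (fun M v => D M (v 0) (v 1) (v 2))) (M : PAM) (x : ℕ) :
    Ev2 D (d : M) (x : M) ↔ Wn D d x (jn 0 3) := by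
  rw [← HH_abs hD M, jn_cast]; simp [Ev2]

def Ph (D : ∀ M : PAM, M → M → M → Prop) (k d : ℕ) (M : PAM) : Prop := sig0 D k (d : M) ∧ pi0' D k (d : M)

theorem c01 {M : PAM} : (0 : M) ≠ 1 := by exact_mod_cast (by decide : (0:ℕ) ≠ 1)
theorem c02 {M : PAM} : (0 : M) ≠ 2 := by exact_mod_cast (by decide : (0:ℕ) ≠ 2)
theorem c03 {M : PAM} : (0 : M) ≠ 3 := by exact_mod_cast (by decide : (0:ℕ) ≠ 3)
theorem c12 {M : PAM} : (1 : M) ≠ 2 := by exact_mod_cast (by decide : (1:ℕ) ≠ 2)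
theorem c13 {M : PAM} : (1 : M) ≠ 3 := by exact_mod_cast (by decide : (1:ℕ) ≠ 3)
theorem c23 {M : PAM} : (2 : M) ≠ 3 := by exact_mod_cast (by decide : (2:ℕ) ≠ 3)

theorem chi0 (M : PAM) (e : ℕ) : chi D k (d : M) ((jn e 0 : ℕ) : M) ↔ (Ph D k d M → ¬ S k (e : M)) := by
  rw [jn_cast]
  simp [chi, J_eq, c01, c02, c03, Ph]
theorem chi1 (M : PAM) (e : ℕ) : chi D k (d : M) ((jn e 1 : ℕ) : M) ↔ (Ph D k d M → S k (e : M)) := by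
  rw [jn_cast]
  simp [chi, J_eq, c01.symm, c12, c13, Ph]
theorem chi2 (M : PAM) : chi D k (d : M) ((jn 0 2 : ℕ) : M) ↔ sig0 D k (d : M) := by
  rw [jn_cast]
  simp [chi, J_eq, c02.symm, c12.symm, c23]
theorem chi3 (M : PAM) : chi D k (d : M) ((jn 0 3 : ℕ) : M) ↔ pi0' D k (d : M) := by
  rw [jn_cast]
  simp [chi, J_eq, c03.symm, c13.symm, c23.symm]

theorem FX.w0 (h : FX D k d T U) (e : ℕ) : (∃ x, Wn D d x (jn e 0)) ↔
    (∀ M : PAM, Mo T M → Ph D k d M → ¬ S k (e : M)) ∨ (∀ M : PAM, Mo U M → Ph D k d M → ¬ S k (e : M)) := by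
  rw [h]; simp only [chi0]
theorem FX.w1 (h : FX D k d T U) (e : ℕ) : (∃ x, Wn D d x (jn e 1)) ↔
    (∀ M : PAM, Mo T M → Ph D k d M → S k (e : M)) ∨ (∀ M : PAM, Mo U M → Ph D k d M → S k (e : M)) := by
  rw [h]; simp only [chi1]
theorem FX.w2 (h : FX D k d T U) : (∃ x, Wn D d x (jn 0 2)) ↔
    (∀ M : PAM, Mo T M → sig0 D k (d : M)) ∨ (∀ M : PAM, Mo U M → sig0 D k (d : M)) := by
  rw [h]; simp only [chi2]
theorem FX.w3 (h : FX D k d T U) : (∃ x, Wn D d x (jn 0 3)) ↔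
    (∀ M : PAM, Mo T M → pi0' D k (d : M)) ∨ (∀ M : PAM, Mo U M → pi0' D k (d : M)) := by
  rw [h]; simp only [chi3]

/-- consistency of T with the Pi consequences of U -/
def CC (n : ℕ) (T U : Thy) : Prop := ∃ M : PAM, Mo T M ∧ ∀ P : Pd 0, Pi n P → (∀ N : PAM, Mo U N → P N default) → P M default
theorem cc_of {n : ℕ} (hT : ExtPA T) (hU : ExtPA U) (h : Con (T ∪ ThIn (PiS n) U)) : CC n T U := by
  obtain ⟨M, hM⟩ := (con_iff (ext_of_sub Set.subset_union_left hT)).1 h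
  rw [mo_union] at hM
  refine ⟨M, hM.1, fun P hP h => ?_⟩
  obtain ⟨φ, h1, h2⟩ := pi_of hP
  rw [← h2]
  exact hM.2 φ ⟨h1, (prv_iff hU φ).2 fun N hN => (h2 N).2 (h N hN)⟩

theorem key1 (hD : D0 (m := 3) (fun M v => D M (v 0) (v 1) (v 2))) (h : FX D k d T U) (hc : CC (k + 1) T U)
    (x0 : ℕ) (h1 : Wn D d x0 (jn 0 2)) (h2 : ∀ x < x0, ¬ Wn D d x (jn 0 2) ∧ ¬ Wn D d x (jn 0 3))
    (hT : ∀ M : PAM, Mo T M → sig0 D k (d : M)) : False := by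
  have lt : ∀ (M : PAM) (x : M), ¬ Ev1 D (d : M) x → ∃ y < x0, x = (y : M) := by
    intro M x hx
    rcases le_total x (x0 : M) with h' | h'
    · obtain ⟨y, hy, rfl⟩ := le_nat _ _ h'
      refine ⟨y, lt_of_le_of_ne hy ?_, rfl⟩
      rintro rfl
      exact hx ((Ev1_abs hD M y).2 h1)
    · exact (hx (HH.mono ((Ev1_abs hD M x0).2 h1) h')).elim
  have hpi : ∀ M : PAM, pi0' D k (d : M) := by
    rintro M ⟨x, ⟨hx1, hx2⟩, _⟩
    obtain ⟨y, hy, rfl⟩ := lt M x hx2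
    exact (h2 y hy).2 ((Ev2_abs hD M y).1 hx1)
  obtain ⟨M, hM, hM2⟩ := hc
  have hs := hT M hM
  have hs' := hs
  rcases hs with ⟨x, e, he, hh, e1, e2, hS⟩ | ⟨x, hx1, hx2⟩
  · obtain ⟨y, hy, rfl⟩ := lt M x e1
    obtain ⟨e, hey, rfl⟩ := le_nat _ _ he
    rw [HH_0 hD] at hh
    rcases (h.w0 e).1 ⟨y, hh⟩ with h3 | h3
    · exact h3 M hM ⟨hs', hpi M⟩ hS
    · refine hM2 (fun M v => ¬ S k (e : M)) (((S_sg k).s1 (IsTm.natCast e)).not) (fun N hN hS' => ?_) hS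
      refine h3 N hN ⟨Or.inl ⟨y, e, ?_, (HH_0 hD N y e).2 hh, ?_, ?_, hS'⟩, hpi N⟩ hS'
      · exact_mod_cast hey
      · rw [Ev1_abs hD]; exact (h2 y hy).1
      · rw [Ev2_abs hD]; exact (h2 y hy).2
  · obtain ⟨y, hy, rfl⟩ := lt M x hx2
    exact (h2 y hy).2 ((Ev2_abs hD M y).1 hx1)

theorem pi_list (k : ℕ) (l : List ℕ) : Pi (k + 1) (m := 0) (fun M v => ∃ e ∈ l, ¬ S k (e : M)) := by
  induction l with
  | nil =>
    exact D0.falsum.pi.congr fun M v => by simp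
  | cons a l ih =>
    refine ((((S_sg k).s1 (IsTm.natCast a)).not).or ih).congr fun M v => ?_
    simp

theorem key2 (hD : D0 (m := 3) (fun M v => D M (v 0) (v 1) (v 2))) (h : FX D k d T U) (hc : CC (k + 1) U T)
    (x0 : ℕ) (h1 : ¬ Wn D d x0 (jn 0 2)) (h1' : Wn D d x0 (jn 0 3))
    (h2 : ∀ x < x0, ¬ Wn D d x (jn 0 2) ∧ ¬ Wn D d x (jn 0 3))
    (hT : ∀ M : PAM, Mo T M → pi0' D k (d : M)) : False := by
  classical
  have hsig : ∀ M : PAM, sig0 D k (d : M) := fun M =>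
    Or.inr ⟨(x0 : M), (Ev2_abs hD M x0).2 h1', fun h => h1 ((Ev1_abs hD M x0).1 h)⟩
  have hG : ∃ G : List ℕ, ∀ e, e ∈ G ↔ e ≤ x0 ∧ Wn D d x0 (jn e 1) :=
    ⟨(List.range (x0 + 1)).filter (fun e => Wn D d x0 (jn e 1)), by simp [Nat.lt_succ_iff]⟩
  obtain ⟨G, hG⟩ := hG
  have hGU : ∃ GU : List ℕ, ∀ e, e ∈ GU ↔ e ∈ G ∧ ∀ M : PAM, Mo U M → Ph D k d M → S k (e : M) :=
    ⟨G.filter (fun e => ∀ M : PAM, Mo U M → Ph D k d M → S k (e : M)), by simp⟩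
  obtain ⟨GU, hGU⟩ := hGU
  obtain ⟨M, hM, hM2⟩ := hc
  have h3 : ∃ e ∈ GU, ¬ S k (e : M) := by
    refine hM2 (fun M v => ∃ e ∈ GU, ¬ S k (e : M)) (pi_list k GU) (fun N hN => ?_)
    by_contra hcon
    push Not at hcon
    refine hT N hN ⟨(x0 : N), ⟨(Ev2_abs hD N x0).2 h1', fun h => h1 ((Ev1_abs hD N x0).1 h)⟩, ?_⟩
    refine SF_of (G.map (fun e : ℕ => (e : N))) (fun e he hh => ?_) (fun e he => ?_)
    · obtain ⟨e, he', rfl⟩ := le_nat _ _ he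
      exact List.mem_map.2 ⟨e, (hG e).2 ⟨he', (HH_1 hD N x0 e).1 hh⟩, rfl⟩
    · obtain ⟨e, heG, rfl⟩ := List.mem_map.1 he
      rcases (h.w1 e).1 ⟨x0, ((hG e).1 heG).2⟩ with h4 | h4
      · exact h4 N hN ⟨hsig N, hT N hN⟩
      · exact hcon e ((hGU e).2 ⟨heG, h4⟩)
  obtain ⟨e, he, hS⟩ := h3
  obtain ⟨he, h4⟩ := (hGU e).1 he
  obtain ⟨he1, he2⟩ := (hG e).1 he
  by_cases hp : pi0' D k (d : M)
  · exact hS (h4 M hM ⟨hsig M, hp⟩)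
  · unfold pi0' at hp
    push Not at hp
    obtain ⟨x, ⟨hx1, hx2⟩, hx3⟩ := hp
    have hx : (x0 : M) ≤ x := by
      by_contra hlt
      push Not at hlt
      obtain ⟨y, hy, rfl⟩ := le_nat _ _ hlt.le
      have hy' : y < x0 := by exact_mod_cast hlt
      exact (h2 y hy').2 ((Ev2_abs hD M y).1 hx1)
    refine hS (SF_imp hx3 (le_trans ?_ hx) (HH.mono ((HH_1 hD M x0 e).2 he2) hx))
    exact_mod_cast he1

theorem no_event (hD : D0 (m := 3) (fun M v => D M (v 0) (v 1) (v 2))) (h : FX D k d T U) (hc : CC (k + 1) T U)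
    (hc' : CC (k + 1) U T) (x : ℕ) : ¬ Wn D d x (jn 0 2) ∧ ¬ Wn D d x (jn 0 3) := by
  classical
  induction x using Nat.strong_induction_on with
  | _ x ih =>
  have hA : ¬ Wn D d x (jn 0 2) := fun h1 => by
    rcases h.w2.1 ⟨x, h1⟩ with h2 | h2
    · exact key1 hD h hc x h1 ih h2
    · exact key1 hD h.symm hc' x h1 ih h2
  refine ⟨hA, fun h1 => ?_⟩
  rcases h.w3.1 ⟨x, h1⟩ with h2 | h2
  · exact key2 hD h hc' x hA h1 ih h2
  · exact key2 hD h.symm hc x hA h1 ih h2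

theorem hsp (hD : D0 (m := 3) (fun M v => D M (v 0) (v 1) (v 2))) (h : FX D k d T U)
    (hne : ∀ x, ¬ Wn D d x (jn 0 2) ∧ ¬ Wn D d x (jn 0 3)) {φ : Snt}
    (hφ : ∀ M : PAM, Sentence.Realize M φ ↔ Ph D k d M) (hT : ExtPA T) : HSPCons (k + 1) T φ := by
  intro V hV σ hσ π hπ hp
  obtain ⟨a, ha⟩ := S_sig hσ
  obtain ⟨b, hb⟩ := S_pi hπ
  rw [prv_iff (ext_add hV.1 φ)] at hp
  have hv : ∀ M : PAM, Mo V M → Ph D k d M → S k (a : M) ∧ ¬ S k (b : M) := by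
    intro M hM hP
    have := hp M (mo_add.2 ⟨(hφ M).2 hP, hM⟩)
    rwa [r_and, ha, hb] at this
  have hVT : ∀ M : PAM, Mo T M → Mo V M := fun M hM ψ hψ => mo_of_prv hT hM (hV.2 ψ (prv_mem hψ))
  obtain ⟨x1, hx1⟩ := (h.w1 a).2 (Or.inl fun M hM hP => (hv M (hVT M hM) hP).1)
  obtain ⟨x2, hx2⟩ := (h.w0 b).2 (Or.inl fun M hM hP => (hv M (hVT M hM) hP).2)
  rw [prv_iff hV.1]
  intro M hM
  rw [r_or, ha, hb]
  by_cases hs : sig0 D k (d : M)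
  · by_cases hp : pi0' D k (d : M)
    · exact Or.inl (hv M hM ⟨hs, hp⟩).1
    · left
      unfold pi0' at hp
      push Not at hp
      obtain ⟨x, ⟨e1, e2⟩, hx3⟩ := hp
      have hx : ((max a x1 : ℕ) : M) ≤ x := by
        by_contra hlt
        push Not at hlt
        obtain ⟨y, hy, rfl⟩ := le_nat _ _ hlt.le
        exact (hne y).2 ((Ev2_abs hD M y).1 e1)
      refine SF_imp hx3 (le_trans ?_ hx) (HH.mono ((HH_1 hD M _ a).2 (hx1.mono (le_max_right a x1))) hx)
      exact_mod_cast le_max_left a x1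
  · right
    intro hS
    refine hs (Or.inl ⟨((max b x2 : ℕ) : M), b, ?_, (HH_0 hD M _ b).2 (hx2.mono (le_max_right _ _)), ?_, ?_, hS⟩)
    · exact_mod_cast le_max_left b x2
    · rw [Ev1_abs hD]; exact (hne _).1
    · rw [Ev2_abs hD]; exact (hne _).2
end

theorem one_two {T U : Thy} (hT : GoodThy T) (hU : GoodThy U) (k : ℕ) (h : Cpair (k + 1) T U) :
    ∃ φ ∈ SigAndPiS (k + 1), SimExHSP (k + 1) T U φ := by
  obtain ⟨D, hD, d, hF⟩ := exists_FX hT hU k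
  have hc := cc_of hT.2.2 hU.2.2 h.1
  have hc' := cc_of hU.2.2 hT.2.2 h.2
  have hne := no_event hD hF hc hc'
  obtain ⟨σ, hσ, hσ'⟩ := sg_of ((sig0_sg k hD).s1 (m := 0) (IsTm.natCast d))
  obtain ⟨π, hπ, hπ'⟩ := pi_of ((pi0_pi k hD).s1 (m := 0) (IsTm.natCast d))
  have hφ : ∀ M : PAM, Sentence.Realize M (σ ⊓ π) ↔ Ph D k d M := fun M => by
    rw [r_and, hσ', hπ']; rfl
  refine ⟨σ ⊓ π, ⟨σ, hσ, π, hπ, rfl⟩, hsp hD hF hne hφ hT.2.2, hsp hD hF.symm hne hφ hU.2.2, ⟨σ, hσ, ?_, ?_, ?_⟩, ⟨π, hπ, ?_, ?_, ?_⟩⟩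
  · rw [prv_iff (ext_add ext_PA _)]
    intro M hM
    exact ((r_and _ _).1 (mo_add.1 hM).1).1
  · rw [prv_iff hT.2.2]
    intro hp
    obtain ⟨x, hx⟩ := hF.w2.2 (Or.inl fun M hM => (hσ' M).1 (hp M hM))
    exact (hne x).1 hx
  · rw [prv_iff hU.2.2]
    intro hp
    obtain ⟨x, hx⟩ := hF.w2.2 (Or.inr fun M hM => (hσ' M).1 (hp M hM))
    exact (hne x).1 hx
  · rw [prv_iff (ext_add ext_PA _)]
    intro M hM
    exact ((r_and _ _).1 (mo_add.1 hM).1).2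
  · rw [prv_iff hT.2.2]
    intro hp
    obtain ⟨x, hx⟩ := hF.w3.2 (Or.inl fun M hM => (hπ' M).1 (hp M hM))
    exact (hne x).2 hx
  · rw [prv_iff hU.2.2]
    intro hp
    obtain ⟨x, hx⟩ := hF.w3.2 (Or.inr fun M hM => (hπ' M).1 (hp M hM))
    exact (hne x).2 hx

theorem compact {T U : Thy} (hT : ExtPA T) (hU : ExtPA U) {n : ℕ} (h : ¬ Con (T ∪ ThIn (PiS n) U)) :
    ∃ P : Pd 0, Pi n P ∧ (∀ N : PAM, Mo U N → P N default) ∧ ∀ M : PAM, Mo T M → ¬ P M default := by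
  classical
  unfold Con at h
  rw [not_not] at h
  unfold Prv at h
  obtain ⟨T0, h0, h1⟩ := Theory.models_iff_finset_models.1 h
  have key : ∀ T0 : Finset Snt, (T0 : Set Snt) ⊆ T ∪ ThIn (PiS n) U → ∃ P : Pd 0, Pi n P ∧
      (∀ N : PAM, Mo U N → P N default) ∧ ∀ M : PAM, Mo T M → P M default → ∀ ψ ∈ T0, Sentence.Realize M ψ := by
    intro T0
    induction T0 using Finset.induction_on with
    | empty => exact fun _ => ⟨fun M v => ¬ False, D0.falsum.not.pi, fun _ _ h => h, by simp⟩
    | insert a s has ih =>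
      intro hs
      rw [Finset.coe_insert, Set.insert_subset_iff] at hs
      obtain ⟨P, hP, h2, h3⟩ := ih hs.2
      rcases hs.1 with ha | ha
      · refine ⟨P, hP, h2, fun M hM hp ψ hψ => ?_⟩
        rcases Finset.mem_insert.1 hψ with rfl | hψ
        · exact hM _ ha
        · exact h3 M hM hp ψ hψ
      · refine ⟨_, (of_pi ha.1).and hP, fun N hN => ⟨mo_of_prv hU hN ha.2, h2 N hN⟩, fun M hM hp ψ hψ => ?_⟩
        rcases Finset.mem_insert.1 hψ with rfl | hψ
        · exact hp.1
        · exact h3 M hM hp.2 ψ hψ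
  obtain ⟨P, hP, h2, h3⟩ := key T0 h0
  refine ⟨P, hP, h2, fun M hM hp => ?_⟩
  rw [Theory.models_sentence_iff] at h1
  haveI : (M : Type) ⊨ (T0 : LA.Theory) := ⟨fun ψ hψ => h3 M hM hp ψ hψ⟩
  exact h1 ⟨M⟩

theorem three_one_half {T U : Thy} (hT : ExtPA T) (hU : ExtPA U) {n : ℕ} {φ : Snt} (h : HSPCons n T φ)
    (h2 : ∃ ψ ∈ PiS n, Prv (add PAAx φ) ψ ∧ ¬ Prv U ψ) : Con (T ∪ ThIn (PiS n) U) := by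
  by_contra hc
  obtain ⟨P, hP, h3, h4⟩ := compact hT hU hc
  obtain ⟨ψ, hψ, h5, h6⟩ := h2
  obtain ⟨σ, hσ, hσ'⟩ := sg_of hP.not
  rw [prv_iff (ext_add ext_PA _)] at h5
  have hE : ExtPA (add PAAx (φ ⟹ σ)) := ext_add ext_PA _
  have hV : SubThy (add PAAx (φ ⟹ σ)) T := by
    refine ⟨hE, fun χ hχ => ?_⟩
    rw [prv_iff hE] at hχ
    rw [prv_iff hT]
    intro M hM
    exact hχ M (mo_add.2 ⟨(r_imp _ _).2 fun _ => (hσ' M).2 (h4 M hM), mo_PA M⟩)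
  have h7 := h _ hV σ hσ ψ hψ (by
    rw [prv_iff (ext_add hE _)]
    intro M hM
    obtain ⟨m1, m2⟩ := mo_add.1 hM
    obtain ⟨m3, m4⟩ := mo_add.1 m2
    exact (r_and _ _).2 ⟨(r_imp _ _).1 m3 m1, h5 M (mo_add.2 ⟨m1, m4⟩)⟩)
  rw [prv_iff hE] at h7
  apply h6
  rw [prv_iff hU]
  intro M hM
  by_cases hφ : Sentence.Realize M φ
  · exact h5 M (mo_add.2 ⟨hφ, mo_PA M⟩)
  · rcases (r_or _ _).1 (h7 M (mo_add.2 ⟨(r_imp _ _).2 fun h => (hφ h).elim, mo_PA M⟩)) with h8 | h8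
    · exact ((hσ' M).1 h8 (h3 M hM)).elim
    · exact h8

/-- Theorem 5.10. -/
theorem stmt_8 (T U : Thy) (hT : GoodThy T) (hU : GoodThy U) (n : ℕ) (hn : 1 ≤ n) :
    List.TFAE
      [Cpair n T U,
       ∃ φ ∈ SigAndPiS n, SimExHSP n T U φ,
       ∃ φ : Snt, SimExHSP n T U φ] := by
  obtain ⟨k, rfl⟩ : ∃ k, n = k + 1 := ⟨n - 1, by omega⟩
  tfae_have 1 → 2 := one_two hT hU k
  tfae_have 2 → 3 := fun ⟨φ, _, h⟩ => ⟨φ, h⟩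
  tfae_have 3 → 1 := by
    rintro ⟨φ, h1, h2, _, ψ, hψ, h3, h4, h5⟩
    exact ⟨three_one_half hT.2.2 hU.2.2 h1 ⟨ψ, hψ, h3, h5⟩, three_one_half hU.2.2 hT.2.2 h2 ⟨ψ, hψ, h3, h4⟩⟩
  tfae_finish
end Guaspari
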